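/- arXiv:2512.09428 — 6 statements merged into one kernel-verified Lean document; each statement's English description precedes it below -/
import Mathlib

section
/- Let K be an algebraically closed field of characteristic 0 and let W be a 2-dimensional K-linear subspace of the space of binary cubic forms (homogeneous polynomials of degree 3 in K[u,v]) such that W contains no nonzero cube of a linear form. Then there exist linearly independent linear forms x, y ∈ K[u,v] and scalars a, b ∈ K such that W is spanned by the two cubics x³ + a·y³ and x³ + b·(x+y)³. -/
open MvPolynomial

/-- A pencil of univariate polynomials without base points contains a separable member. -/
lemma Polynomial.exists_separable_add_C_mul {K : Type*} [Field K] [CharZero K] [IsAlgClosed K]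
    (q p : Polynomial K) (hq : 0 < q.degree)
    (hqp : ∀ z, q.eval z = 0 → p.eval z ≠ 0) :
    ∃ s : K, (q + Polynomial.C s * p).Separable := by
  have hcop : IsCoprime q p := by
    rw [Polynomial.isCoprime_iff_aeval_ne_zero_of_isAlgClosed K K]
    intro z
    by_cases h : q.eval z = 0
    · exact Or.inr (by simpa using hqp z h)
    · exact Or.inl (by simpa using h)
  set w := q * Polynomial.derivative p - Polynomial.derivative q * p with hw
  have hw0 : w ≠ 0 := by
    intro h0
    have h1 : q ∣ Polynomial.derivative q * p := ⟨Polynomial.derivative p, by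
      rw [hw] at h0; exact (sub_eq_zero.mp h0).symm⟩
    have h2 := hcop.dvd_of_dvd_mul_right h1
    have hq0 : q ≠ 0 := by rintro rfl; simp at hq
    have h3 : Polynomial.derivative q ≠ 0 := by
      intro h
      have := Polynomial.derivative_eq_zero.mp h
      have := Polynomial.natDegree_pos_iff_degree_pos.mpr hq
      omega
    exact absurd (Polynomial.degree_le_of_dvd h2 h3)
      (not_le.mpr (Polynomial.degree_derivative_lt hq0))
  classical
  obtain ⟨s, hs⟩ := Infinite.exists_notMem_finset
    (w.roots.toFinset.image fun z => -(q.eval z) / p.eval z)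
  refine ⟨s, ?_⟩
  rw [Polynomial.Separable, Polynomial.isCoprime_iff_aeval_ne_zero_of_isAlgClosed K K]
  intro z
  by_contra! h
  obtain ⟨h1, h2⟩ := h
  simp only [Polynomial.coe_aeval_eq_eval, Polynomial.eval_add, Polynomial.eval_mul,
    Polynomial.eval_C, Polynomial.derivative_add, Polynomial.derivative_mul,
    Polynomial.derivative_C, zero_mul, zero_add] at h1 h2
  have hp : p.eval z ≠ 0 := fun hp => hqp z (by simpa [hp] using h1) hp
  apply hs
  rw [Finset.mem_image]
  refine ⟨z, ?_, ?_⟩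
  · rw [Multiset.mem_toFinset, Polynomial.mem_roots hw0, Polynomial.IsRoot, hw]
    simp only [Polynomial.eval_sub, Polynomial.eval_mul]
    linear_combination (Polynomial.derivative p).eval z * h1 - p.eval z * h2
  · field_simp
    linear_combination -h1

/-- The coordinate map `c ↦ c₀ u³ + c₁ u²v + c₂ uv² + c₃ v³` for binary cubics. -/
noncomputable def binaryCubic (K : Type*) [Field K] :
    (Fin 4 → K) →ₗ[K] MvPolynomial (Fin 2) K where
  toFun c := C (c 0) * X 0 ^ 3 + C (c 1) * (X 0 ^ 2 * X 1) + C (c 2) * (X 0 * X 1 ^ 2)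
    + C (c 3) * X 1 ^ 3
  map_add' a b := by simp only [Pi.add_apply, map_add]; ring
  map_smul' r a := by
    simp only [Pi.smul_apply, smul_eq_mul, map_mul, RingHom.id_apply, smul_eq_C_mul]; ring

lemma binaryCubic_apply {K : Type*} [Field K] (c : Fin 4 → K) :
    binaryCubic K c = C (c 0) * X 0 ^ 3 + C (c 1) * (X 0 ^ 2 * X 1)
      + C (c 2) * (X 0 * X 1 ^ 2) + C (c 3) * X 1 ^ 3 := rfl

lemma mem_range_binaryCubic {K : Type*} [Field K] {f : MvPolynomial (Fin 2) K}
    (hf : f.IsHomogeneous 3) : f ∈ LinearMap.range (binaryCubic K) := by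
  rw [f.as_sum]
  refine Submodule.sum_mem _ fun d hd => ?_
  have h3 : d 0 + d 1 = 3 := by
    have := hf (mem_support_iff.mp hd)
    simpa [Finsupp.weight_apply, Finsupp.sum_fintype] using this
  rw [monomial_eq, Finsupp.prod_fintype _ _ (by simp), Fin.prod_univ_two]
  generalize coeff d f = r
  have h0 : d 0 ≤ 3 := by omega
  obtain h | h | h | h : d 0 = 0 ∨ d 0 = 1 ∨ d 0 = 2 ∨ d 0 = 3 := by omega
  · rw [h, show d 1 = 3 by omega]
    exact ⟨![0, 0, 0, r], by simp [binaryCubic_apply]⟩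
  · rw [h, show d 1 = 2 by omega]
    exact ⟨![0, 0, r, 0], by simp [binaryCubic_apply]⟩
  · rw [h, show d 1 = 1 by omega]
    exact ⟨![0, r, 0, 0], by simp [binaryCubic_apply]⟩
  · rw [h, show d 1 = 0 by omega]
    exact ⟨![r, 0, 0, 0], by simp [binaryCubic_apply]⟩

lemma binaryCubic_injective {K : Type*} [Field K] [CharZero K] :
    Function.Injective (binaryCubic K) := by
  rw [injective_iff_map_eq_zero]
  intro c hc
  have e (s t : K) : c 0 * s ^ 3 + c 1 * (s ^ 2 * t) + c 2 * (s * t ^ 2) + c 3 * t ^ 3 = 0 := by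
    have := congrArg (eval ![s, t]) hc
    simpa [binaryCubic_apply] using this
  have e1 := e 1 0
  have e2 := e 0 1
  have e3 := e 1 1
  have e4 := e (-1) 1
  ext i
  fin_cases i <;> simp only [Pi.zero_apply] <;> grind

/-- The linear form `z u + v`. -/
noncomputable def linearFormOfRoot {K : Type*} [Field K] (z : K) : MvPolynomial (Fin 2) K :=
  C z * X 0 + X 1

lemma isHomogeneous_linearFormOfRoot {K : Type*} [Field K] (z : K) :
    (linearFormOfRoot z).IsHomogeneous 1 := by
  simpa [linearFormOfRoot] using
    ((isHomogeneous_C (Fin 2) z).mul (isHomogeneous_X K (0 : Fin 2))).add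
      (isHomogeneous_X K (1 : Fin 2))

lemma binaryCubic_linearFormOfRoot {K : Type*} [Field K] (z : K) :
    binaryCubic K ![z ^ 3, 3 * z ^ 2, 3 * z, 1] = linearFormOfRoot z ^ 3 := by
  simp only [binaryCubic_apply, linearFormOfRoot, Matrix.cons_val, map_mul, map_pow, map_one,
    map_ofNat]
  ring

/-- A codimension-two space of coefficient vectors is cut out by two linear equations. -/
lemma exists_two_equations {K : Type*} [Field K] (V : Submodule K (Fin 4 → K))
    (hV : Module.finrank K V = 2) :
    ∃ A B : (Fin 4 → K) →ₗ[K] K, ∀ c, c ∈ V ↔ A c = 0 ∧ B c = 0 := by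
  have hQ : Module.finrank K ((Fin 4 → K) ⧸ V) = Module.finrank K (Fin 2 → K) := by
    have := V.finrank_quotient_add_finrank
    simp only [Module.finrank_fin_fun] at this ⊢
    omega
  let e := LinearEquiv.ofFinrankEq _ _ hQ
  refine ⟨LinearMap.proj 0 ∘ₗ e.toLinearMap ∘ₗ V.mkQ, LinearMap.proj 1 ∘ₗ e.toLinearMap ∘ₗ V.mkQ,
    fun c => ?_⟩
  rw [← Submodule.Quotient.mk_eq_zero V, ← e.map_eq_zero_iff, funext_iff]
  simp [Fin.forall_fin_two]

lemma linearMap_apply_fin_four {K : Type*} [Field K] (A : (Fin 4 → K) →ₗ[K] K) (c : Fin 4 → K) :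
    A c = c 0 * A (Pi.single 0 1) + c 1 * A (Pi.single 1 1) + c 2 * A (Pi.single 2 1)
      + c 3 * A (Pi.single 3 1) := by
  have (i : Fin 4) : (Pi.single i 1 : Fin 4 → K) = fun j => if i = j then 1 else 0 := by
    ext j
    simp [Pi.single_apply, eq_comm]
  simp only [LinearMap.pi_apply_eq_sum_univ A c, Fin.sum_univ_four, this, smul_eq_mul]

/-- If two equations on binary cubics have no common zero among cubes of linear forms, some
member of the pencil they span vanishes on three distinct cubes. -/
lemma exists_three_cubes {K : Type*} [Field K] [CharZero K] [IsAlgClosed K]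
    (A B : (Fin 4 → K) →ₗ[K] K) (hA : A (Pi.single 0 1) ≠ 0)
    (hB : B (Pi.single 0 1) = 0)
    (hAB : ∀ z : K, A ![z ^ 3, 3 * z ^ 2, 3 * z, 1] = 0 → B ![z ^ 3, 3 * z ^ 2, 3 * z, 1] ≠ 0) :
    ∃ s z₁ z₂ z₃ : K, z₁ ≠ z₂ ∧ z₁ ≠ z₃ ∧ z₂ ≠ z₃ ∧
      ∀ z ∈ ({z₁, z₂, z₃} : Set K), A ![z ^ 3, 3 * z ^ 2, 3 * z, 1]
        + s * B ![z ^ 3, 3 * z ^ 2, 3 * z, 1] = 0 := by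
  let P (F : (Fin 4 → K) →ₗ[K] K) : Polynomial K :=
    (Cubic.mk (F (Pi.single 0 1)) (3 * F (Pi.single 1 1)) (3 * F (Pi.single 2 1))
      (F (Pi.single 3 1))).toPoly
  have hP (F : (Fin 4 → K) →ₗ[K] K) (z : K) :
      (P F).eval z = F ![z ^ 3, 3 * z ^ 2, 3 * z, 1] := by
    rw [linearMap_apply_fin_four F]
    simp [P, Cubic.toPoly]
    ring
  have hdA : (P A).degree = 3 := Cubic.degree_of_a_ne_zero hA
  obtain ⟨s, hs⟩ := Polynomial.exists_separable_add_C_mul (P A) (P B) (by rw [hdA]; norm_num)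
    (by simpa only [hP] using hAB)
  have hdB : (Polynomial.C s * P B).degree < (P A).degree := by
    rw [hdA]
    rw [← Polynomial.smul_eq_C_mul]
    refine (Polynomial.degree_smul_le s _).trans_lt ?_
    exact (Cubic.degree_of_a_eq_zero hB).trans_lt (by norm_num)
  classical
  have hcard : (P A + Polynomial.C s * P B).roots.toFinset.card = 3 := by
    rw [Multiset.toFinset_card_of_nodup (Polynomial.nodup_roots hs),
      ← (IsAlgClosed.splits _).natDegree_eq_card_roots]
    apply Polynomial.natDegree_eq_of_degree_eq_some
    rw [Polynomial.degree_add_eq_left_of_degree_lt hdB, hdA]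
    rfl
  obtain ⟨z₁, z₂, z₃, h12, h13, h23, hz⟩ := Finset.card_eq_three.mp hcard
  refine ⟨s, z₁, z₂, z₃, h12, h13, h23, fun z hmem => ?_⟩
  replace hmem : z ∈ ({z₁, z₂, z₃} : Finset K) := by simpa using hmem
  rw [← hz, Multiset.mem_toFinset] at hmem
  simpa [hP] using (Polynomial.mem_roots'.mp hmem).2

lemma exists_eval_pair {K : Type*} [Field K] {z₁ z₂ p q : K} (hz : z₁ ≠ z₂) (hp : p ≠ 0)
    (hq : q ≠ 0) (s t : K) : ∃ w : Fin 2 → K,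
      eval w (p • linearFormOfRoot z₁) = s ∧ eval w (q • linearFormOfRoot z₂) = t := by
  have hz' := sub_ne_zero.mpr hz
  refine ⟨![(s / p - t / q) / (z₁ - z₂), (z₁ * (t / q) - z₂ * (s / p)) / (z₁ - z₂)], ?_, ?_⟩ <;>
  · simp [linearFormOfRoot, smul_eval]
    field_simp
    ring

lemma linearIndependent_of_eval_pair {K : Type*} [Field K] {x y : MvPolynomial (Fin 2) K}
    (hxy : ∀ s t : K, ∃ w : Fin 2 → K, eval w x = s ∧ eval w y = t) :
    LinearIndependent K ![x, y] := by
  rw [LinearIndependent.pair_iff]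
  intro r t h
  have e (s u : K) : r * s + t * u = 0 := by
    obtain ⟨w, rfl, rfl⟩ := hxy s u
    simpa [smul_eval] using congrArg (eval w) h
  exact ⟨by simpa using e 1 0, by simpa using e 0 1⟩

lemma linearIndependent_pencil {K : Type*} [Field K] [CharZero K] {x y : MvPolynomial (Fin 2) K}
    (hxy : ∀ s t : K, ∃ w : Fin 2 → K, eval w x = s ∧ eval w y = t) {a b : K} (ha : a ≠ 0)
    (hb : b ≠ 0) : LinearIndependent K ![x ^ 3 + a • y ^ 3, x ^ 3 + b • (x + y) ^ 3] := by
  rw [LinearIndependent.pair_iff]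
  intro r t h
  have e (s u : K) : r * (s ^ 3 + a * u ^ 3) + t * (s ^ 3 + b * (s + u) ^ 3) = 0 := by
    obtain ⟨w, rfl, rfl⟩ := hxy s u
    simpa [smul_eval, mul_add] using congrArg (eval w) h
  have h6 : 6 * (t * b) = 0 := by linear_combination e 1 1 - e 1 0 - e 0 1
  have ht : t = 0 := by simpa [hb] using h6
  subst ht
  refine ⟨?_, rfl⟩
  simpa [ha] using e 0 1

/-- **Lemma 2.5 (better_pencil_form).** A 2-dimensional space of binary cubics containing
no nonzero cube of a linear form is spanned by `x³ + a·y³` and `x³ + b·(x+y)³` for some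
linearly independent linear forms `x, y` and scalars `a, b`. -/
theorem stmt0 {K : Type*} [Field K] [CharZero K] [IsAlgClosed K]
    (W : Submodule K (MvPolynomial (Fin 2) K))
    (hhom : ∀ f ∈ W, MvPolynomial.IsHomogeneous f 3)
    (hdim : Module.finrank K W = 2)
    (hnocube : ∀ f ∈ W, ∀ ℓ : MvPolynomial (Fin 2) K,
      MvPolynomial.IsHomogeneous ℓ 1 → f = ℓ ^ 3 → f = 0) :
    ∃ x y : MvPolynomial (Fin 2) K,
      MvPolynomial.IsHomogeneous x 1 ∧ MvPolynomial.IsHomogeneous y 1 ∧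
      LinearIndependent K ![x, y] ∧
      ∃ a b : K, W = Submodule.span K {x ^ 3 + a • y ^ 3, x ^ 3 + b • (x + y) ^ 3} := by
  have hV : Module.finrank K (W.comap (binaryCubic K)) = 2 := by
    rw [(Submodule.equivMapOfInjective _ binaryCubic_injective _).finrank_eq,
      Submodule.map_comap_eq_of_le fun f hf => mem_range_binaryCubic (hhom f hf), hdim]
  obtain ⟨A, B, hAB⟩ : ∃ A B : (Fin 4 → K) →ₗ[K] K, A (Pi.single 0 1) ≠ 0 ∧
      B (Pi.single 0 1) = 0 ∧ ∀ c, binaryCubic K c ∈ W ↔ A c = 0 ∧ B c = 0 := by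
    obtain ⟨A, B, h⟩ := exists_two_equations _ hV
    have h0 : ¬ (A (Pi.single 0 1) = 0 ∧ B (Pi.single 0 1) = 0) := by
      rw [← h]
      intro hm
      have := hnocube _ hm (X 0) (isHomogeneous_X _ _) (by simp [binaryCubic_apply])
      have h1 := congrFun (binaryCubic_injective (this.trans (map_zero _).symm)) 0
      simp at h1
    simp only [Submodule.mem_comap] at h
    by_cases hA : A (Pi.single 0 1) = 0
    · refine ⟨B, A, fun hB => h0 ⟨hA, hB⟩, hA, fun c => ?_⟩
      rw [h, and_comm]
    · refine ⟨A, B - (B (Pi.single 0 1) / A (Pi.single 0 1)) • A, hA, ?_, fun c => ?_⟩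
      · simp [hA]
      · rw [h]
        constructor <;> rintro ⟨h1, h2⟩ <;> simp_all
  obtain ⟨hA0, hB0, hmem⟩ := hAB
  have hne (z : K) (h1 : A ![z ^ 3, 3 * z ^ 2, 3 * z, 1] = 0) :
      B ![z ^ 3, 3 * z ^ 2, 3 * z, 1] ≠ 0 := by
    intro h2
    have := hnocube _ ((hmem _).2 ⟨h1, h2⟩) _ (isHomogeneous_linearFormOfRoot z)
      (binaryCubic_linearFormOfRoot z)
    have h1 := congrFun (binaryCubic_injective (this.trans (map_zero _).symm)) 3
    simp at h1
  obtain ⟨s, z₁, z₂, z₃, h12, h13, h23, hz⟩ := exists_three_cubes A B hA0 hB0 hne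
  set β : K → K := fun z => B ![z ^ 3, 3 * z ^ 2, 3 * z, 1]
  have hβ0 : ∀ z ∈ ({z₁, z₂, z₃} : Set K), β z ≠ 0 := fun z hmz h0 =>
    hne z (by simpa [show B ![z ^ 3, 3 * z ^ 2, 3 * z, 1] = 0 from h0] using hz z hmz) h0
  have hcomb : ∀ z ∈ ({z₁, z₂, z₃} : Set K), ∀ z' ∈ ({z₁, z₂, z₃} : Set K), ∀ r r' : K,
      r * β z + r' * β z' = 0 → r • linearFormOfRoot z ^ 3 + r' • linearFormOfRoot z' ^ 3 ∈ W := by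
    intro z hmz z' hmz' r r' h
    rw [← binaryCubic_linearFormOfRoot, ← binaryCubic_linearFormOfRoot, ← map_smul, ← map_smul,
      ← map_add, hmem]
    simp only [map_add, map_smul, smul_eq_mul]
    exact ⟨by linear_combination r * hz z hmz + r' * hz z' hmz' - s * h, h⟩
  have hβ1 := hβ0 z₁ (by simp)
  have hβ2 := hβ0 z₂ (by simp)
  have hβ3 := hβ0 z₃ (by simp)
  have d12 := sub_ne_zero.mpr h12
  obtain ⟨p, q, hp, hq, hpq, hpqz⟩ : ∃ p q : K, p ≠ 0 ∧ q ≠ 0 ∧ p + q = 1 ∧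
      p * z₁ + q * z₂ = z₃ := by
    refine ⟨(z₃ - z₂) / (z₁ - z₂), (z₁ - z₃) / (z₁ - z₂),
      div_ne_zero (sub_ne_zero.mpr h23.symm) d12, div_ne_zero (sub_ne_zero.mpr h13) d12, ?_, ?_⟩
    · field_simp
      ring
    · field_simp
      ring
  have hsum : p • linearFormOfRoot z₁ + q • linearFormOfRoot z₂ = linearFormOfRoot z₃ := by
    simp only [linearFormOfRoot, smul_eq_C_mul, ← hpqz, map_add, map_mul]
    have : (C p + C q : MvPolynomial (Fin 2) K) = 1 := by rw [← map_add, hpq, map_one]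
    linear_combination X 1 * this
  have hev := exists_eval_pair h12 hp hq
  have ha : -(p ^ 3 * β z₁) / (q ^ 3 * β z₂) ≠ 0 := by simp [hp, hq, hβ1, hβ2]
  have hb : -(p ^ 3 * β z₁) / β z₃ ≠ 0 := by simp [hp, hβ1, hβ3]
  have hind := linearIndependent_pencil hev ha hb
  refine ⟨p • linearFormOfRoot z₁, q • linearFormOfRoot z₂, ?_, ?_, ?_,
    -(p ^ 3 * β z₁) / (q ^ 3 * β z₂), -(p ^ 3 * β z₁) / β z₃, ?_⟩
  · exact (homogeneousSubmodule _ K 1).smul_mem p (isHomogeneous_linearFormOfRoot z₁)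
  · exact (homogeneousSubmodule _ K 1).smul_mem q (isHomogeneous_linearFormOfRoot z₂)
  · exact linearIndependent_of_eval_pair hev
  · symm
    have : FiniteDimensional K W := Module.finite_of_finrank_eq_succ hdim
    refine Submodule.eq_of_le_of_finrank_eq (Submodule.span_le.mpr ?_) ?_
    rotate_left
    · have := finrank_span_eq_card hind
      rw [Matrix.range_cons_cons_empty, Fintype.card_fin] at this
      rw [this, hdim]
    rintro f (rfl | rfl)
    · rw [smul_pow, smul_pow, smul_smul]
      refine hcomb z₁ (by simp) z₂ (by simp) _ _ ?_
      field_simp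
      ring
    · rw [hsum, smul_pow]
      refine hcomb z₁ (by simp) z₃ (by simp) _ _ ?_
      field_simp
      ring
end

section
/- Let K be an algebraically closed field of characteristic 0, R = K[α_1,α_2,α_3], and let F ∈ K[x_1,x_2,x_3] be a homogeneous polynomial of degree 3 whose three partial derivatives ∂F/∂x_1, ∂F/∂x_2, ∂F/∂x_3 are linearly independent over K (equivalently, F depends essentially on 3 variables, i.e., Ann(F) contains no nonzero linear form). Let Ann(F)_k denote the degree-k graded piece of Ann(F), and let R_1·Ann(F)_2 denote the K-span of all products α_j·q with j ∈ {1,2,3} and q ∈ Ann(F)_2. If R_1·Ann(F)_2 is a proper subspace of Ann(F)_3 (i.e., Ann(F) has at least one minimal generator in degree 3), then dim_K ( Ann(F)_3 / R_1·Ann(F)_2 ) = 2, i.e., Ann(F) has exactly two minimal cubic generators. -/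
open MvPolynomial

noncomputable def pdOp {K : Type*} [CommSemiring K] {n : ℕ} (m : Fin n →₀ ℕ) :
    Module.End K (MvPolynomial (Fin n) K) :=
  ((List.finRange n).map fun i =>
    ((MvPolynomial.pderiv i).toLinearMap : Module.End K (MvPolynomial (Fin n) K)) ^ m i).prod

/-- `contract p F = p ⌟ F`: `p` acts on `F` as a constant-coefficient differential operator. -/
noncomputable def contract {K : Type*} [CommSemiring K] {n : ℕ}
    (p F : MvPolynomial (Fin n) K) : MvPolynomial (Fin n) K :=
  ∑ m ∈ p.support, p.coeff m • pdOp m F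

/-- The degree-`k` graded piece of `Ann(F)`, as a set. -/
def annDeg {K : Type*} [CommSemiring K] {n : ℕ} (F : MvPolynomial (Fin n) K) (k : ℕ) :
    Set (MvPolynomial (Fin n) K) :=
  {p | MvPolynomial.IsHomogeneous p k ∧ contract p F = 0}

open Module in
theorem even_finrank_of_isAlt_of_ker_eq_bot {K V : Type*} [Field K] [CharZero K]
    [AddCommGroup V] [Module K V] [FiniteDimensional K V] {B : LinearMap.BilinForm K V}
    (hB : B.IsAlt) (hker : LinearMap.ker B = ⊥) : Even (finrank K V) := by
  by_contra hodd
  rw [Nat.not_even_iff_odd] at hodd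
  let b := finBasis K V
  have hnd : B.Nondegenerate := by
    exact (LinearMap.IsRefl.nondegenerate_iff_separatingLeft hB.isRefl).2
      (LinearMap.separatingLeft_iff_ker_eq_bot.2 hker)
  rw [LinearMap.BilinForm.nondegenerate_iff_det_ne_zero b] at hnd
  apply hnd
  have htr : (LinearMap.BilinForm.toMatrix b B).transpose = -LinearMap.BilinForm.toMatrix b B := by
    ext i j
    simp [LinearMap.BilinForm.toMatrix_apply, hB.neg_eq]
  have hdet := congrArg Matrix.det htr
  rw [Matrix.det_transpose, Matrix.det_neg, Fintype.card_fin, hodd.neg_one_pow] at hdet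
  exact self_eq_neg.1 (by simpa using hdet)

open Module in
theorem exists_finrank_eq_finrank_ker_add_two_mul {K V : Type*} [Field K] [CharZero K]
    [AddCommGroup V] [Module K V] [FiniteDimensional K V] {B : LinearMap.BilinForm K V}
    (hB : B.IsAlt) : ∃ r, finrank K V = finrank K (LinearMap.ker B) + 2 * r := by
  obtain ⟨W, hW⟩ := (LinearMap.ker B).exists_isCompl
  have hev : Even (finrank K W) := by
    refine even_finrank_of_isAlt_of_ker_eq_bot (B := B.restrict W)
      (fun x => hB.self_eq_zero (x : V)) ?_
    rw [LinearMap.ker_eq_bot']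
    intro x hx
    have hxker : (x : V) ∈ LinearMap.ker B := by
      rw [LinearMap.mem_ker]
      ext y
      obtain ⟨u, hu, w, hw, rfl⟩ := Submodule.mem_sup.1
        (hW.sup_eq_top.ge (Submodule.mem_top (x := y)))
      have h1 : B x w = 0 := LinearMap.congr_fun hx ⟨w, hw⟩
      have h2 : B x u = 0 := hB.isRefl _ _ (by simp [LinearMap.mem_ker.1 hu])
      simp [h1, h2]
    exact Subtype.ext (Submodule.disjoint_def.1 hW.disjoint _ hxker x.2)
  obtain ⟨r, hr⟩ := hev
  refine ⟨r, ?_⟩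
  rw [← Submodule.finrank_add_eq_of_isCompl hW, hr]
  ring

namespace Trilinear

variable {K : Type*} [Field K]
  (T : (Fin 3 → K) →ₗ[K] (Fin 3 → K) →ₗ[K] (Fin 3 → K) →ₗ[K] K)

/-- The endomorphisms `φ` for which `T (φ a) b c` is symmetric in `a` and `b`. -/
def centroid : Submodule K ((Fin 3 → K) →ₗ[K] (Fin 3 → K)) where
  carrier := {φ | ∀ a b c, T (φ a) b c = T (φ b) a c}
  add_mem' := fun h h' a b c => by simp [h a b c, h' a b c]
  zero_mem' := fun a b c => by simp
  smul_mem' := fun r φ h a b c => by simp [h a b c]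

variable {T}

theorem mem_centroid_of_single {φ : (Fin 3 → K) →ₗ[K] (Fin 3 → K)}
    (h : ∀ i j c, T (φ (Pi.single i 1)) (Pi.single j 1) c
      = T (φ (Pi.single j 1)) (Pi.single i 1) c) : φ ∈ centroid T := by
  have key : T ∘ₗ φ = (T ∘ₗ φ).flip := by
    refine (Pi.basisFun K (Fin 3)).ext fun i => (Pi.basisFun K (Fin 3)).ext fun j => ?_
    refine LinearMap.ext fun c => ?_
    simpa using h i j c
  intro a b c
  exact LinearMap.congr_fun (LinearMap.congr_fun (LinearMap.congr_fun key a) b) c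

variable (T) in
/-- The alternating form whose radical is the centroid. -/
def altForm : LinearMap.BilinForm K ((Fin 3 → K) →ₗ[K] (Fin 3 → K)) :=
  LinearMap.mk₂ K (fun φ ψ =>
      T (φ (Pi.single 0 1)) (ψ (Pi.single 1 1)) (Pi.single 2 1)
      + T (φ (Pi.single 1 1)) (ψ (Pi.single 2 1)) (Pi.single 0 1)
      + T (φ (Pi.single 2 1)) (ψ (Pi.single 0 1)) (Pi.single 1 1)
      - T (φ (Pi.single 0 1)) (ψ (Pi.single 2 1)) (Pi.single 1 1)
      - T (φ (Pi.single 2 1)) (ψ (Pi.single 1 1)) (Pi.single 0 1)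
      - T (φ (Pi.single 1 1)) (ψ (Pi.single 0 1)) (Pi.single 2 1))
    (fun _ _ _ => by simp only [LinearMap.add_apply, map_add]; ring)
    (fun _ _ _ => by simp only [LinearMap.smul_apply, map_smul, smul_eq_mul]; ring)
    (fun _ _ _ => by simp only [LinearMap.add_apply, map_add]; ring)
    (fun _ _ _ => by simp only [LinearMap.smul_apply, map_smul, smul_eq_mul]; ring)

theorem altForm_isAlt (h₁ : ∀ a b c, T a b c = T b a c) : (altForm T).IsAlt := by
  intro φ
  simp only [altForm, LinearMap.mk₂_apply]
  rw [h₁ (φ (Pi.single 1 1)) (φ (Pi.single 0 1)), h₁ (φ (Pi.single 2 1)) (φ (Pi.single 1 1)),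
    h₁ (φ (Pi.single 2 1)) (φ (Pi.single 0 1))]
  ring

theorem ker_altForm (h₂ : ∀ a b c, T a b c = T a c b) :
    LinearMap.ker (altForm T) = centroid T := by
  ext φ
  rw [LinearMap.mem_ker]
  constructor
  · intro h
    have key : ∀ k v, altForm T φ ((LinearMap.proj k).smulRight v) = 0 := fun k v => by simp [h]
    apply mem_centroid_of_single
    intro i j c
    have h0 := key 0 c
    have h1 := key 1 c
    have h2 := key 2 c
    simp [altForm] at h0 h1 h2
    rw [h₂, h₂ (φ (Pi.single j 1))]
    fin_cases i <;> fin_cases j <;> simp only [Fin.zero_eta, Fin.mk_one, Fin.reduceFinMk] <;>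
      first
      | linear_combination h0 | linear_combination h1 | linear_combination h2
      | linear_combination -h0 | linear_combination -h1 | linear_combination -h2
  · intro h
    ext ψ
    have h' : ∀ a b c, T (φ a) b c = T (φ c) b a := fun a b c => by
      rw [h₂, h a c b, h₂]
    simp only [altForm, LinearMap.mk₂_apply, LinearMap.zero_apply]
    rw [h' (Pi.single 0 1) (ψ (Pi.single 1 1)), h' (Pi.single 1 1) (ψ (Pi.single 2 1)),
      h' (Pi.single 2 1) (ψ (Pi.single 0 1))]
    ring

theorem exists_apply_ne_zero [CharZero K] (h₁ : ∀ a b c, T a b c = T b a c)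
    (h₂ : ∀ a b c, T a b c = T a c b) (hnd : ∀ a, (∀ b c, T a b c = 0) → a = 0) :
    ∃ a p q r s, T a p r * T a q s - T a p s * T a q r ≠ 0 := by
  by_contra! hmin
  replace hmin : ∀ a p q r s, T a p r * T a q s = T a p s * T a q r :=
    fun a p q r s => sub_eq_zero.1 (hmin a p q r s)
  have hu : ∃ u, T u u u ≠ 0 := by
    by_contra! h0
    have h1 : ∀ a b, T a a b = 0 := fun a b => by
      have h := hmin a a b a b
      rw [h0, zero_mul, h₂ a b a] at h
      exact mul_self_eq_zero.1 h.symm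
    have h2 : ∀ a b c, T a b c = 0 := fun a b c => by
      have h := h1 (a + b) c
      simp only [map_add, LinearMap.add_apply, h1, h₁ b a c, zero_add, add_zero] at h
      exact add_self_eq_zero.1 h
    have h3 := hnd (Pi.single 0 1) (fun b c => h2 _ b c)
    simpa using congrFun h3 0
  obtain ⟨u, hu⟩ := hu
  have hH : ∀ b, T u u b = 0 → ∀ c, T u b c = 0 := fun b hb c => by
    have h := hmin u u b u c
    rw [h₂ u b u, hb, mul_zero] at h
    exact (mul_eq_zero.1 h).resolve_left hu
  have hHH : ∀ b, T u u b = 0 → ∀ c, T b b c = 0 := fun b hb c => by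
    have h := hmin (u + b) b u c u
    simp only [map_add, LinearMap.add_apply, hH b hb, h₁ b u, h₂ b b u, zero_add, add_zero,
      zero_mul] at h
    exact (mul_eq_zero.1 h).resolve_right hu
  have hHH' : ∀ b b', T u u b = 0 → T u u b' = 0 → ∀ c, T b b' c = 0 := fun b b' hb hb' c => by
    have h := hHH (b + b') (by simp [hb, hb']) c
    simp only [map_add, LinearMap.add_apply, hHH b hb, hHH b' hb', h₁ b' b c, zero_add,
      add_zero] at h
    exact add_self_eq_zero.1 h
  have hproj : ∀ v, T u u (T u u u • v - T u u v • u) = 0 := fun v => by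
    simp only [map_sub, map_smul, smul_eq_mul]
    ring
  have hzero : ∀ b, T u u b = 0 → b = 0 := fun b hb => hnd b fun x c => by
    have h := hHH' b _ hb (hproj x) c
    simp only [map_sub, map_smul, LinearMap.sub_apply, LinearMap.smul_apply, h₁ b u c, hH b hb c,
      mul_zero, sub_zero, smul_eq_mul] at h
    exact (mul_eq_zero.1 h).resolve_left hu
  have he : ∀ v, T u u u • v - T u u v • u = 0 := fun v => hzero _ (hproj v)
  have h00 := congrFun (he (Pi.single 0 1)) 0
  have h10 := congrFun (he (Pi.single 1 1)) 0
  have h11 := congrFun (he (Pi.single 1 1)) 1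
  simp [sub_eq_zero] at h00 h10 h11
  rcases h10 with h | h
  · rw [h, zero_mul] at h11
    exact hu h11
  · rw [h, mul_zero] at h00
    exact hu h00

open Module in
theorem exists_span_of_apply_eq_zero [CharZero K] (h₁ : ∀ a b c, T a b c = T b a c)
    (h₂ : ∀ a b c, T a b c = T a c b) (hnd : ∀ a, (∀ b c, T a b c = 0) → a = 0) :
    ∃ a w, ∀ x, (∀ c, T a x c = 0) → ∃ r : K, r • w = x := by
  obtain ⟨a, p, q, r, s, h⟩ := exists_apply_ne_zero h₁ h₂ hnd
  let g : (Fin 3 → K) →ₗ[K] K × K := ((T a).flip r).prod ((T a).flip s)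
  have hg : Function.Surjective g := by
    rintro ⟨y, z⟩
    set D := T a p r * T a q s - T a p s * T a q r with hD
    refine ⟨D⁻¹ • ((y * T a q s - z * T a q r) • p + (z * T a p r - y * T a p s) • q), ?_⟩
    ext <;> simp [g] <;> field_simp <;> rw [hD] <;> ring
  have hker : finrank K (LinearMap.ker g) = 1 := by
    have h := LinearMap.finrank_range_add_finrank_ker g
    rw [LinearMap.range_eq_top.2 hg, finrank_top] at h
    simp at h
    omega
  obtain ⟨w, -, hw⟩ := finrank_eq_one_iff'.1 hker
  refine ⟨a, w, fun x hx => ?_⟩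
  obtain ⟨t, ht⟩ := hw ⟨x, by simp [g, hx]⟩
  exact ⟨t, congrArg Subtype.val ht⟩

open Module in
theorem finrank_centroid_le [CharZero K] (h₁ : ∀ a b c, T a b c = T b a c)
    (h₂ : ∀ a b c, T a b c = T a c b) (hnd : ∀ a, (∀ b c, T a b c = 0) → a = 0) :
    finrank K (centroid T) ≤ 4 := by
  obtain ⟨a, w, hw⟩ := exists_span_of_apply_eq_zero h₁ h₂ hnd
  let ev : centroid T →ₗ[K] (Fin 3 → K) := LinearMap.applyₗ a ∘ₗ (centroid T).subtype
  have hscal : ∀ φ ∈ LinearMap.ker ev, ∀ x, ∃ r : K, r • w = φ.1 x := fun φ hφ x => by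
    refine hw _ fun c => ?_
    have hφa : φ.1 a = 0 := hφ
    rw [h₁, φ.2 x a c, hφa]
    simp
  have hker : finrank K (LinearMap.ker ev) ≤ 1 := by
    by_cases hw0 : ∀ c d, T w c d = 0
    · have hbot : LinearMap.ker ev = ⊥ := by
        rw [Submodule.eq_bot_iff]
        intro φ hφ
        ext1
        refine LinearMap.ext fun x => ?_
        obtain ⟨r, hr⟩ := hscal φ hφ x
        rw [← hr, hnd w hw0]
        simp
      rw [hbot, finrank_bot]
      exact zero_le_one
    · push Not at hw0
      obtain ⟨c, d, hcd⟩ := hw0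
      rw [← Submodule.finrank_map_subtype_eq (centroid T) (LinearMap.ker ev)]
      refine (Submodule.finrank_mono (t := K ∙ ((T w).flip d).smulRight w) ?_).trans
        ((finrank_span_le_card _).trans (by simp))
      rintro _ ⟨φ, hφ, rfl⟩
      obtain ⟨r, hr⟩ := hscal φ hφ c
      refine Submodule.mem_span_singleton.2 ⟨r / T w c d, LinearMap.ext fun x => ?_⟩
      obtain ⟨t, ht⟩ := hscal φ hφ x
      have h := φ.2 x c d
      rw [← ht, ← hr] at h
      simp only [map_smul, LinearMap.smul_apply, smul_eq_mul] at h
      simp only [LinearMap.smul_apply, LinearMap.smulRight_apply, LinearMap.flip_apply,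
        Submodule.subtype_apply, ← ht, smul_smul]
      congr 1
      field_simp
      rw [mul_comm _ t]
      exact h.symm
  have h := LinearMap.finrank_range_add_finrank_ker (K := K) (V := centroid T) ev
  have hr : finrank K (LinearMap.range ev) ≤ 3 := by
    simpa using Submodule.finrank_le (LinearMap.range ev)
  omega

open Module in
theorem finrank_centroid_eq_three [CharZero K] (h₁ : ∀ a b c, T a b c = T b a c)
    (h₂ : ∀ a b c, T a b c = T a c b) (hnd : ∀ a, (∀ b c, T a b c = 0) → a = 0)
    (hC : 1 < finrank K (centroid T)) : finrank K (centroid T) = 3 := by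
  obtain ⟨r, hr⟩ := exists_finrank_eq_finrank_ker_add_two_mul (altForm_isAlt h₁)
  rw [ker_altForm h₂, finrank_linearMap] at hr
  simp at hr
  have h := finrank_centroid_le h₁ h₂ hnd
  omega

end Trilinear

namespace TernaryCubic

open Module

variable {K : Type*} [Field K]

theorem commute_pderiv {n : ℕ} (i j : Fin n) :
    Commute ((pderiv i).toLinearMap : Module.End K (MvPolynomial (Fin n) K))
      (pderiv j).toLinearMap := by
  have h : ⁅pderiv (R := K) i, pderiv (R := K) j⁆ = 0 := by
    apply derivation_ext
    intro k
    classical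
    simp only [Derivation.commutator_apply, pderiv_X, Derivation.zero_apply]
    have hs : ∀ l m : Fin n,
        pderiv l (Pi.single (M := fun _ => MvPolynomial (Fin n) K) m 1 k) = 0 := fun l m => by
      by_cases hkm : k = m <;> simp [hkm]
    simp [hs]
  refine LinearMap.ext fun p => ?_
  have := DFunLike.congr_fun h p
  simpa [Derivation.commutator_apply, sub_eq_zero] using this

theorem pdOp_eq (m : Fin 3 →₀ ℕ) : pdOp (K := K) m =
    (pderiv 0).toLinearMap ^ m 0 *
      ((pderiv 1).toLinearMap ^ m 1 * (pderiv 2).toLinearMap ^ m 2) := by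
  simp [pdOp, List.finRange_succ]

theorem pdOp_single_add (i : Fin 3) (m : Fin 3 →₀ ℕ) :
    pdOp (K := K) (Finsupp.single i 1 + m) = (pderiv i).toLinearMap * pdOp m := by
  have h10 := (commute_pderiv (K := K) (1 : Fin 3) 0).pow_right (m 0)
  have h20 := (commute_pderiv (K := K) (2 : Fin 3) 0).pow_right (m 0)
  have h21 := (commute_pderiv (K := K) (2 : Fin 3) 1).pow_right (m 1)
  simp only [pdOp_eq, Finsupp.add_apply]
  fin_cases i
  · simp [add_comm 1, pow_succ', mul_assoc]
  · simp [add_comm 1, pow_succ', mul_assoc, h10.left_comm]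
  · simp [add_comm 1, pow_succ', h20.left_comm, h21.left_comm]

/-- `contract` as a linear map in the differential operator. -/
noncomputable def contractHom (F : MvPolynomial (Fin 3) K) :
    MvPolynomial (Fin 3) K →ₗ[K] MvPolynomial (Fin 3) K :=
  (basisMonomials (Fin 3) K).constr K fun m => pdOp m F

theorem contractHom_apply (F p : MvPolynomial (Fin 3) K) : contractHom F p = contract p F :=
  Basis.constr_apply _ _ _ _

theorem contractHom_monomial (F : MvPolynomial (Fin 3) K) (m : Fin 3 →₀ ℕ) :
    contractHom F (monomial m 1) = pdOp m F := by
  have h := (basisMonomials (Fin 3) K).constr_basis K (fun m => pdOp m F) m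
  rwa [coe_basisMonomials] at h

theorem contractHom_X_mul (F p : MvPolynomial (Fin 3) K) (i : Fin 3) :
    contractHom F (X i * p) = pderiv i (contractHom F p) := by
  have h : contractHom F ∘ₗ LinearMap.mulLeft K (X i) =
      (pderiv i).toLinearMap ∘ₗ contractHom F := by
    refine (basisMonomials (Fin 3) K).ext fun m => ?_
    simp only [LinearMap.comp_apply, coe_basisMonomials, LinearMap.mulLeft_apply, X,
      monomial_mul, one_mul, contractHom_monomial, pdOp_single_add]
    rfl
  exact LinearMap.congr_fun h p

theorem contractHom_one (F : MvPolynomial (Fin 3) K) : contractHom F 1 = F := by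
  have h := contractHom_monomial F 0
  simpa [pdOp_eq] using h

theorem isHomogeneous_pderiv_pow {F : MvPolynomial (Fin 3) K} {n : ℕ} (hF : F.IsHomogeneous n)
    (i : Fin 3) (k : ℕ) :
    (((pderiv i).toLinearMap ^ k : Module.End K (MvPolynomial (Fin 3) K)) F).IsHomogeneous
      (n - k) := by
  induction k with
  | zero => simpa using hF
  | succ k ih =>
    rw [pow_succ', ← Nat.sub_sub]
    exact ih.pderiv

theorem isHomogeneous_contractHom {F p : MvPolynomial (Fin 3) K} {n d : ℕ}
    (hF : F.IsHomogeneous n) (hp : p.IsHomogeneous d) :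
    (contractHom F p).IsHomogeneous (n - d) := by
  rw [contractHom_apply]
  refine IsHomogeneous.sum _ _ _ fun m hm => ?_
  have hmd : m.degree = d := by
    rw [Finsupp.degree_eq_weight_one]
    exact hp (mem_support_iff.1 hm)
  refine (homogeneousSubmodule (Fin 3) K (n - d)).smul_mem _ ?_
  rw [pdOp_eq]
  have h := isHomogeneous_pderiv_pow (isHomogeneous_pderiv_pow
    (isHomogeneous_pderiv_pow hF 2 (m 2)) 1 (m 1)) 0 (m 0)
  have hd : n - d = n - m 2 - m 1 - m 0 := by
    rw [← hmd, Finsupp.degree_eq_sum, Fin.sum_univ_three]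
    omega
  rw [hd]
  exact h

theorem eq_zero_of_coeff_zero {G : MvPolynomial (Fin 3) K} (hG : G.IsHomogeneous 0)
    (h : coeff 0 G = 0) : G = 0 := by
  rw [← totalDegree_zero_iff_isHomogeneous, totalDegree_eq_zero_iff_eq_C] at hG
  rw [hG, h, C_0]

theorem eq_zero_of_pderiv_eq_zero [CharZero K] {G : MvPolynomial (Fin 3) K} {n : ℕ}
    (hG : G.IsHomogeneous (n + 1)) (h : ∀ i, pderiv i G = 0) : G = 0 := by
  have hE := hG.sum_X_mul_pderiv
  simp only [h, mul_zero, Finset.sum_const_zero] at hE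
  exact (smul_eq_zero.1 hE.symm).resolve_left n.succ_ne_zero

/-- The functional `p ↦ (p ⌟ F)(0)`. -/
noncomputable def eval₀ (F : MvPolynomial (Fin 3) K) : MvPolynomial (Fin 3) K →ₗ[K] K :=
  lcoeff K 0 ∘ₗ contractHom F

theorem eval₀_apply (F p : MvPolynomial (Fin 3) K) : eval₀ F p = coeff 0 (contractHom F p) := rfl

/-- The linear form with given coefficients. -/
noncomputable def linForm : (Fin 3 → K) →ₗ[K] MvPolynomial (Fin 3) K :=
  Fintype.linearCombination K X

theorem linForm_apply (a : Fin 3 → K) : linForm a = ∑ i, a i • (X i : MvPolynomial (Fin 3) K) :=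
  rfl

@[simp]
theorem linForm_single (i : Fin 3) : linForm (Pi.single i (1 : K)) = X i := by
  classical
  simp [linForm, Fintype.linearCombination_apply_single]

theorem range_linForm :
    LinearMap.range (linForm (K := K)) = homogeneousSubmodule (Fin 3) K 1 := by
  rw [homogeneousSubmodule_one_eq_span_X, linForm, Fintype.range_linearCombination]

theorem isHomogeneous_linForm (a : Fin 3 → K) : (linForm a).IsHomogeneous 1 :=
  range_linForm.le ⟨a, rfl⟩

theorem exists_linForm_eq {p : MvPolynomial (Fin 3) K} (hp : p.IsHomogeneous 1) :
    ∃ a, linForm a = p :=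
  range_linForm.ge hp

/-- The polarization of `F`. -/
noncomputable def polar (F : MvPolynomial (Fin 3) K) :
    (Fin 3 → K) →ₗ[K] (Fin 3 → K) →ₗ[K] (Fin 3 → K) →ₗ[K] K where
  toFun a := ((LinearMap.mul K (MvPolynomial (Fin 3) K)).compl₁₂ linForm linForm).compr₂
    (eval₀ F ∘ₗ LinearMap.mulLeft K (linForm a))
  map_add' a b := by
    refine LinearMap.ext fun c => LinearMap.ext fun d => ?_
    simp [add_mul]
  map_smul' r b := by
    refine LinearMap.ext fun c => LinearMap.ext fun d => ?_
    simp

theorem polar_apply (F : MvPolynomial (Fin 3) K) (a b c : Fin 3 → K) :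
    polar F a b c = eval₀ F (linForm a * (linForm b * linForm c)) := rfl

theorem polar_comm₁₂ (F : MvPolynomial (Fin 3) K) (a b c : Fin 3 → K) :
    polar F a b c = polar F b a c := by
  rw [polar_apply, polar_apply, mul_left_comm]

theorem polar_comm₂₃ (F : MvPolynomial (Fin 3) K) (a b c : Fin 3 → K) :
    polar F a b c = polar F a c b := by
  rw [polar_apply, polar_apply, mul_comm (linForm b)]

theorem contractHom_eq_zero_of_eval₀_X_mul [CharZero K] {F q : MvPolynomial (Fin 3) K}
    (hF : F.IsHomogeneous 3) (hq : q.IsHomogeneous 2) (h : ∀ i, eval₀ F (X i * q) = 0) :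
    contractHom F q = 0 := by
  refine eq_zero_of_pderiv_eq_zero (isHomogeneous_contractHom hF hq) fun i => ?_
  rw [← contractHom_X_mul]
  exact eq_zero_of_coeff_zero
    (isHomogeneous_contractHom hF ((isHomogeneous_X K i).mul hq)) (h i)

theorem contractHom_linForm_mul (F p : MvPolynomial (Fin 3) K) (a : Fin 3 → K) :
    contractHom F (linForm a * p) = ∑ i, a i • pderiv i (contractHom F p) := by
  simp only [linForm_apply, Finset.sum_mul, map_sum, smul_mul_assoc, map_smul, contractHom_X_mul]

theorem eq_zero_of_polar_eq_zero [CharZero K] {F : MvPolynomial (Fin 3) K}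
    (hF : F.IsHomogeneous 3)
    (hdep : LinearIndependent K ![pderiv (0 : Fin 3) F, pderiv 1 F, pderiv 2 F])
    (a : Fin 3 → K) (h : ∀ b c, polar F a b c = 0) : a = 0 := by
  have ha := isHomogeneous_linForm a
  have h0 : contractHom F (linForm a) = 0 := by
    refine eq_zero_of_pderiv_eq_zero (isHomogeneous_contractHom hF ha) fun i => ?_
    rw [← contractHom_X_mul]
    refine contractHom_eq_zero_of_eval₀_X_mul hF ((isHomogeneous_X K i).mul ha) fun j => ?_
    have h' := h (Pi.single i 1) (Pi.single j 1)
    rw [polar_apply, linForm_single, linForm_single] at h'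
    rw [← h']
    congr 1
    ring
  rw [← mul_one (linForm a), contractHom_linForm_mul, contractHom_one] at h0
  rw [Fintype.linearIndependent_iff] at hdep
  funext i
  refine hdep a ?_ i
  simpa [Fin.sum_univ_three] using h0

/-- The functional on cubics attached to an endomorphism of the space of linear forms. -/
noncomputable def cubicFunctional (F : MvPolynomial (Fin 3) K) :
    ((Fin 3 → K) →ₗ[K] (Fin 3 → K)) →ₗ[K] Dual K (homogeneousSubmodule (Fin 3) K 3) :=
  LinearMap.mk₂ K
    (fun φ p => (3 : K)⁻¹ *
      ∑ j, eval₀ F (linForm (φ (Pi.single j 1)) * pderiv j (p : MvPolynomial (Fin 3) K)))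
    (fun φ ψ p => by simp [add_mul, Finset.sum_add_distrib, mul_add])
    (fun r φ p => by simp [← Finset.mul_sum, mul_left_comm])
    (fun φ p q => by simp [mul_add, Finset.sum_add_distrib])
    (fun r φ p => by simp [← Finset.mul_sum, mul_left_comm])

theorem cubicFunctional_apply (F : MvPolynomial (Fin 3) K) (φ : (Fin 3 → K) →ₗ[K] (Fin 3 → K))
    (p : homogeneousSubmodule (Fin 3) K 3) :
    cubicFunctional F φ p = (3 : K)⁻¹ *
      ∑ j, eval₀ F (linForm (φ (Pi.single j 1)) * pderiv j (p : MvPolynomial (Fin 3) K)) := rfl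

theorem cubicFunctional_X_mul [CharZero K] {F : MvPolynomial (Fin 3) K}
    {φ : (Fin 3 → K) →ₗ[K] (Fin 3 → K)} (hφ : φ ∈ Trilinear.centroid (polar F))
    {q : MvPolynomial (Fin 3) K} (hq : q.IsHomogeneous 2) (k : Fin 3)
    (hmem : X k * q ∈ homogeneousSubmodule (Fin 3) K 3) :
    cubicFunctional F φ ⟨X k * q, hmem⟩ = eval₀ F (linForm (φ (Pi.single k 1)) * q) := by
  classical
  have hsymm : ∀ j, eval₀ F (linForm (φ (Pi.single j 1)) * (X k * pderiv j q)) =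
      eval₀ F (linForm (φ (Pi.single k 1)) * (X j * pderiv j q)) := fun j => by
    obtain ⟨c, hc⟩ := exists_linForm_eq (hq.pderiv (i := j))
    have h := hφ (Pi.single j 1) (Pi.single k 1) c
    simpa only [polar_apply, linForm_single, hc] using h
  have hE := hq.sum_X_mul_pderiv
  have hsum : ∑ j, eval₀ F (linForm (φ (Pi.single j 1)) * pderiv j (X k * q)) =
      3 * eval₀ F (linForm (φ (Pi.single k 1)) * q) := by
    simp only [pderiv_mul, mul_add, map_add, Finset.sum_add_distrib, hsymm]
    rw [← map_sum (eval₀ F) (fun j => linForm (φ (Pi.single k 1)) * (X j * pderiv j q)),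
      ← Finset.mul_sum, hE, mul_smul_comm, map_nsmul, Finset.sum_eq_single k]
    · simp
      ring
    · intro j _ hj
      simp [pderiv_X_of_ne hj.symm]
    · simp
  rw [cubicFunctional_apply, hsum]
  field_simp

/-- The span of the products of a variable and a quadric annihilating `F`. -/
noncomputable def quadricGenerated (F : MvPolynomial (Fin 3) K) :
    Submodule K (MvPolynomial (Fin 3) K) :=
  Submodule.span K {r | ∃ j : Fin 3, ∃ p ∈ annDeg F 2, r = X j * p}

theorem quadricGenerated_le (F : MvPolynomial (Fin 3) K) :
    quadricGenerated F ≤ homogeneousSubmodule (Fin 3) K 3 := by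
  refine Submodule.span_le.2 ?_
  rintro _ ⟨j, p, hp, rfl⟩
  exact (isHomogeneous_X K j).mul hp.1

theorem map_cubicFunctional_centroid [CharZero K] {F : MvPolynomial (Fin 3) K}
    (hF : F.IsHomogeneous 3) :
    (Trilinear.centroid (polar F)).map (cubicFunctional F) =
      ((quadricGenerated F).comap (homogeneousSubmodule (Fin 3) K 3).subtype).dualAnnihilator := by
  apply le_antisymm
  · rintro _ ⟨φ, hφ, rfl⟩
    rw [Submodule.mem_dualAnnihilator]
    rintro ⟨p, hpM⟩ (hp : p ∈ quadricGenerated F)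
    induction hp using Submodule.span_induction with
    | mem p hp =>
      obtain ⟨j, q, hq, rfl⟩ := hp
      have h0 : contractHom F q = 0 := by rw [contractHom_apply, hq.2]
      rw [cubicFunctional_X_mul hφ hq.1, eval₀_apply, contractHom_linForm_mul, h0]
      simp
    | zero => exact map_zero (cubicFunctional F φ)
    | add p q hp hq ihp ihq =>
      have hp' := ihp (quadricGenerated_le F hp)
      have hq' := ihq (quadricGenerated_le F hq)
      have h := map_add (cubicFunctional F φ) ⟨p, quadricGenerated_le F hp⟩
        ⟨q, quadricGenerated_le F hq⟩
      rw [hp', hq', add_zero] at h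
      exact h
    | smul r p hp ih =>
      have hp' := ih (quadricGenerated_le F hp)
      have h := map_smul (cubicFunctional F φ) r ⟨p, quadricGenerated_le F hp⟩
      rw [hp', smul_zero] at h
      exact h
  · intro g hg
    rw [Submodule.mem_dualAnnihilator] at hg
    obtain ⟨g', hg'⟩ := g.exists_extend
    have hg'M : ∀ p (hp : p ∈ homogeneousSubmodule (Fin 3) K 3), g' p = g ⟨p, hp⟩ :=
      fun p hp => LinearMap.congr_fun hg' ⟨p, hp⟩
    have hcoef : ∀ j, ∃ c : Fin 3 → K, ∀ q : MvPolynomial (Fin 3) K, q.IsHomogeneous 2 →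
        g' (X j * q) = eval₀ F (linForm c * q) := fun j => by
      let L : Fin 3 → homogeneousSubmodule (Fin 3) K 2 →ₗ[K] K := fun i =>
        eval₀ F ∘ₗ LinearMap.mulLeft K (X i) ∘ₗ (homogeneousSubmodule (Fin 3) K 2).subtype
      let G : homogeneousSubmodule (Fin 3) K 2 →ₗ[K] K :=
        g' ∘ₗ LinearMap.mulLeft K (X j) ∘ₗ (homogeneousSubmodule (Fin 3) K 2).subtype
      have hker : ⨅ i, LinearMap.ker (L i) ≤ LinearMap.ker G := by
        rintro ⟨q, hq⟩ hqL
        have hqL' : ∀ i, eval₀ F (X i * q) = 0 := fun i => (Submodule.mem_iInf _).1 hqL i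
        have hq0 := contractHom_eq_zero_of_eval₀_X_mul hF hq hqL'
        rw [contractHom_apply] at hq0
        have hm : X j * q ∈ homogeneousSubmodule (Fin 3) K 3 := (isHomogeneous_X K j).mul hq
        have h := hg ⟨X j * q, hm⟩ (Submodule.subset_span ⟨j, q, ⟨hq, hq0⟩, rfl⟩)
        rw [← hg'M] at h
        exact h
      obtain ⟨c, hc⟩ := (Submodule.mem_span_range_iff_exists_fun K).1
        (mem_span_of_iInf_ker_le_ker hker)
      refine ⟨c, fun q hq => ?_⟩
      have h := LinearMap.congr_fun hc ⟨q, hq⟩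
      simp only [LinearMap.sum_apply, LinearMap.smul_apply] at h
      rw [linForm_apply, Finset.sum_mul, map_sum]
      simp only [smul_mul_assoc, map_smul]
      exact h.symm
    choose c hc using hcoef
    let φ : (Fin 3 → K) →ₗ[K] (Fin 3 → K) := Fintype.linearCombination K c
    have hφ : ∀ j, φ (Pi.single j 1) = c j := fun j => by
      classical
      simp [φ, Fintype.linearCombination_apply_single]
    refine ⟨φ, Trilinear.mem_centroid_of_single fun i j d => ?_, ?_⟩
    · rw [hφ, hφ, polar_apply, polar_apply, linForm_single, linForm_single,
        ← hc i _ ((isHomogeneous_X K j).mul (isHomogeneous_linForm d)),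
        ← hc j _ ((isHomogeneous_X K i).mul (isHomogeneous_linForm d)), mul_left_comm]
    · refine LinearMap.ext fun p => ?_
      obtain ⟨p, hp⟩ := p
      have hE := IsHomogeneous.sum_X_mul_pderiv hp
      have h : ∑ j, g' (X j * pderiv j p) = 3 * g ⟨p, hp⟩ := by
        rw [← map_sum, hE, map_nsmul, hg'M p hp]
        simp
      rw [cubicFunctional_apply]
      simp only [hφ]
      rw [← Finset.sum_congr rfl fun j _ => hc j _ (IsHomogeneous.pderiv hp), h]
      field_simp

theorem finrank_quadricGenerated_add [CharZero K] {F : MvPolynomial (Fin 3) K}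
    (hF : F.IsHomogeneous 3)
    (hdep : LinearIndependent K ![pderiv (0 : Fin 3) F, pderiv 1 F, pderiv 2 F]) :
    finrank K (quadricGenerated F) + finrank K (Trilinear.centroid (polar F)) =
      finrank K (homogeneousSubmodule (Fin 3) K 3) := by
  have : FiniteDimensional K (homogeneousSubmodule (Fin 3) K 3) :=
    Module.Finite.iff_fg.2 (homogeneousSubmodule_fg _ _ 3)
  rw [← Subspace.finrank_add_finrank_dualAnnihilator_eq
    ((quadricGenerated F).comap (homogeneousSubmodule (Fin 3) K 3).subtype),
    ← map_cubicFunctional_centroid hF,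
    (Submodule.comapSubtypeEquivOfLe (quadricGenerated_le F)).finrank_eq]
  congr 1
  have hinj : Function.Injective
      ((cubicFunctional F).domRestrict (Trilinear.centroid (polar F))) := by
    rw [injective_iff_map_eq_zero]
    rintro ⟨φ, hφ⟩ h0
    have h0' : cubicFunctional F φ = 0 := h0
    ext1
    refine (Pi.basisFun K (Fin 3)).ext fun j => ?_
    rw [Pi.basisFun_apply]
    refine eq_zero_of_polar_eq_zero hF hdep _ fun b c => ?_
    have hq := (isHomogeneous_linForm b).mul (isHomogeneous_linForm c)
    rw [polar_apply, ← cubicFunctional_X_mul hφ hq j ((isHomogeneous_X K j).mul hq), h0']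
    rfl
  rw [← LinearMap.finrank_range_of_inj hinj, LinearMap.range_domRestrict]

theorem span_annDeg_three {F : MvPolynomial (Fin 3) K} (hF : F.IsHomogeneous 3) :
    Submodule.span K (annDeg F 3) =
      homogeneousSubmodule (Fin 3) K 3 ⊓ LinearMap.ker (eval₀ F) := by
  have h : annDeg F 3 =
      ((homogeneousSubmodule (Fin 3) K 3 ⊓ LinearMap.ker (eval₀ F) : Submodule K _) : Set _) := by
    ext p
    refine and_congr_right fun hp => ?_
    rw [← contractHom_apply]
    refine ⟨fun h0 => ?_, fun h0 => eq_zero_of_coeff_zero (isHomogeneous_contractHom hF hp) h0⟩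
    simp [eval₀_apply, h0]
  rw [h, Submodule.span_eq]

theorem finrank_span_annDeg_three_add_one [CharZero K] {F : MvPolynomial (Fin 3) K}
    (hF : F.IsHomogeneous 3)
    (hdep : LinearIndependent K ![pderiv (0 : Fin 3) F, pderiv 1 F, pderiv 2 F]) :
    finrank K (Submodule.span K (annDeg F 3)) + 1 =
      finrank K (homogeneousSubmodule (Fin 3) K 3) := by
  have : FiniteDimensional K (homogeneousSubmodule (Fin 3) K 3) :=
    Module.Finite.iff_fg.2 (homogeneousSubmodule_fg _ _ 3)
  let e : Dual K (homogeneousSubmodule (Fin 3) K 3) :=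
    eval₀ F ∘ₗ (homogeneousSubmodule (Fin 3) K 3).subtype
  have he : e ≠ 0 := by
    intro he
    have h := eq_zero_of_polar_eq_zero hF hdep (Pi.single 0 1) fun b c => by
      have hm := (isHomogeneous_linForm (Pi.single (0 : Fin 3) (1 : K))).mul
        ((isHomogeneous_linForm b).mul (isHomogeneous_linForm c))
      exact LinearMap.congr_fun he ⟨_, hm⟩
    simpa using congrFun h 0
  rw [← Dual.finrank_ker_add_one_of_ne_zero he, span_annDeg_three hF,
    ← Submodule.map_comap_subtype, Submodule.finrank_map_subtype_eq]
  rfl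

end TernaryCubic

/-- **Proposition 2.6, Item 1 (buchsbaum_eisenbud).** If a ternary cubic `F` depends
essentially on 3 variables and `Ann(F)` has a minimal cubic generator, then it has exactly
two minimal cubic generators. -/
theorem stmt1 {K : Type*} [Field K] [CharZero K] [IsAlgClosed K]
    (F : MvPolynomial (Fin 3) K) (hF : MvPolynomial.IsHomogeneous F 3)
    (hdep : LinearIndependent K ![pderiv (0 : Fin 3) F, pderiv 1 F, pderiv 2 F])
    (hproper :
      Submodule.span K {r : MvPolynomial (Fin 3) K | ∃ j : Fin 3, ∃ p ∈ annDeg F 2, r = X j * p} <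
        Submodule.span K (annDeg F 3)) :
    Module.finrank K
      ((Submodule.span K (annDeg F 3)) ⧸
        (Submodule.comap (Submodule.span K (annDeg F 3)).subtype
          (Submodule.span K {r : MvPolynomial (Fin 3) K | ∃ j : Fin 3, ∃ p ∈ annDeg F 2, r = X j * p}))) = 2 := by
  have hfd : FiniteDimensional K (homogeneousSubmodule (Fin 3) K 3) :=
    Module.Finite.iff_fg.2 (homogeneousSubmodule_fg _ _ 3)
  have hfdA : FiniteDimensional K (Submodule.span K (annDeg F 3)) :=
    Submodule.finiteDimensional_of_le
      ((TernaryCubic.span_annDeg_three hF).le.trans inf_le_left)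
  have hW := TernaryCubic.finrank_quadricGenerated_add hF hdep
  have hA := TernaryCubic.finrank_span_annDeg_three_add_one hF hdep
  have hlt := Submodule.finrank_lt_finrank_of_lt hproper
  have hq := Submodule.finrank_quotient_add_finrank
    ((TernaryCubic.quadricGenerated F).comap (Submodule.span K (annDeg F 3)).subtype)
  rw [(Submodule.comapSubtypeEquivOfLe (show TernaryCubic.quadricGenerated F ≤ _ from
    hproper.le)).finrank_eq] at hq
  change Module.finrank K (TernaryCubic.quadricGenerated F) < _ at hlt
  have hC := Trilinear.finrank_centroid_eq_three (TernaryCubic.polar_comm₁₂ F)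
    (TernaryCubic.polar_comm₂₃ F) (TernaryCubic.eq_zero_of_polar_eq_zero hF hdep) (by omega)
  change Module.finrank K (_ ⧸ (TernaryCubic.quadricGenerated F).comap
    (Submodule.span K (annDeg F 3)).subtype) = 2
  omega
end

section
/- Let K be an algebraically closed field of characteristic 0 and let F ∈ K[x_1,x_2,x_3] be a homogeneous polynomial of degree 3 whose three partial derivatives ∂F/∂x_1, ∂F/∂x_2, ∂F/∂x_3 are linearly independent over K (F depends essentially on 3 variables), and suppose that Ann(F) has at least one minimal generator in degree 3, i.e., the K-span of the products α_j·q with q ∈ Ann(F)_2 is a proper subspace of Ann(F)_3. Then F lies in the Zariski closure of the set of sums of three cubes of linear forms: every polynomial in the 10 coefficients of a ternary cubic which vanishes at every cubic of the form ℓ_1³ + ℓ_2³ + ℓ_3³ (ℓ_1,ℓ_2,ℓ_3 linear forms in x_1,x_2,x_3) also vanishes at F. In other words, F belongs to the affine cone over the third secant variety σ_3(v_3(ℙ²)) of the Veronese surface. -/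
open MvPolynomial

/-- Membership of `F` in the Zariski closure of the set of sums of three cubes of linear forms. -/
def MemCubeClosure {K : Type*} [Field K] (F : MvPolynomial (Fin 3) K) : Prop :=
  ∀ Φ : MvPolynomial ((Fin 3) →₀ ℕ) K,
    (∀ l₁ l₂ l₃ : MvPolynomial (Fin 3) K,
      MvPolynomial.IsHomogeneous l₁ 1 → MvPolynomial.IsHomogeneous l₂ 1 →
      MvPolynomial.IsHomogeneous l₃ 1 →
      MvPolynomial.eval (fun m => MvPolynomial.coeff m (l₁ ^ 3 + l₂ ^ 3 + l₃ ^ 3)) Φ = 0) →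
    MvPolynomial.eval (fun m => MvPolynomial.coeff m F) Φ = 0

section Closure

variable {K : Type*} [Field K]

/-- The closure contains the limit at `t = 0` of a polynomial arc whose members with `t ≠ 0` all
lie in it. -/
lemma memCubeClosure_of_arc [CharZero K] (A B E : MvPolynomial (Fin 3) K)
    (h : ∀ t : K, t ≠ 0 → MemCubeClosure (A + C t * B + C (t ^ 2) * E)) :
    MemCubeClosure A := by
  intro Φ hΦ
  let P : Polynomial K := aeval (fun m => Polynomial.C (coeff m A) +
    Polynomial.X * Polynomial.C (coeff m B) + Polynomial.X ^ 2 * Polynomial.C (coeff m E)) Φ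
  have hP (t : K) : P.eval t =
      eval (fun m => coeff m (A + C t * B + C (t ^ 2) * E)) Φ := by
    have := map_aeval (σ := Fin 3 →₀ ℕ) (R := K) (B := K)
      (fun m => Polynomial.C (coeff m A) +
        Polynomial.X * Polynomial.C (coeff m B) + Polynomial.X ^ 2 * Polynomial.C (coeff m E))
      (Polynomial.evalRingHom t) Φ
    simp only [Polynomial.coe_evalRingHom] at this
    rw [show P.eval t = _ from this]
    have hC : (Polynomial.evalRingHom t).comp (algebraMap K (Polynomial K)) = RingHom.id K := by
      ext; simp
    rw [hC, MvPolynomial.eval]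
    simp only [coeff_add, coeff_C_mul, Polynomial.eval_add, Polynomial.eval_mul,
      Polynomial.eval_C, Polynomial.eval_X, Polynomial.eval_pow]
  have h0 : Polynomial.X * P = 0 := by
    apply Polynomial.funext
    intro t
    rcases eq_or_ne t 0 with rfl | ht
    · simp
    · rw [Polynomial.eval_mul, hP, h t ht Φ hΦ, mul_zero, Polynomial.eval_zero]
  have := hP 0
  rw [(mul_eq_zero.mp h0).resolve_left Polynomial.X_ne_zero] at this
  simpa using this.symm

variable [IsAlgClosed K] {U Y Z : MvPolynomial (Fin 3) K}

lemma memCubeClosure_sum_cubes (hU : U.IsHomogeneous 1)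
    (hY : Y.IsHomogeneous 1) (hZ : Z.IsHomogeneous 1) (a b c : K) :
    MemCubeClosure (C a * U ^ 3 + C b * Y ^ 3 + C c * Z ^ 3) := by
  obtain ⟨a, rfl⟩ := IsAlgClosed.exists_pow_nat_eq a (n := 3) (by norm_num)
  obtain ⟨b, rfl⟩ := IsAlgClosed.exists_pow_nat_eq b (n := 3) (by norm_num)
  obtain ⟨c, rfl⟩ := IsAlgClosed.exists_pow_nat_eq c (n := 3) (by norm_num)
  intro Φ hΦ
  simpa [mul_pow] using hΦ _ _ _ (hU.C_mul a) (hY.C_mul b) (hZ.C_mul c)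

lemma memCubeClosure_cube_add_even [CharZero K] (hU : U.IsHomogeneous 1)
    (hY : Y.IsHomogeneous 1) (hZ : Z.IsHomogeneous 1) (a b d : K) :
    MemCubeClosure (C a * U ^ 3 + (C b * Y ^ 3 + C d * (Y * Z ^ 2))) := by
  have key (b : K) (hb : b ≠ 0) :
      MemCubeClosure (C a * U ^ 3 + (C b * Y ^ 3 + C d * (Y * Z ^ 2))) := by
    obtain ⟨p, hp⟩ := IsAlgClosed.exists_pow_nat_eq (b / 2) (n := 3) (by norm_num)
    have hp0 : p ≠ 0 := by
      rintro rfl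
      simp [hb, eq_comm (a := (0 : K))] at hp
    obtain ⟨q, hq⟩ := IsAlgClosed.exists_pow_nat_eq (d / (6 * p)) (n := 2) (by norm_num)
    have hb' : b = 2 * p ^ 3 := by rw [hp]; ring
    have hd' : d = 6 * p * q ^ 2 := by rw [hq]; field_simp
    convert memCubeClosure_sum_cubes hU ((hY.C_mul p).add (hZ.C_mul q))
      ((hY.C_mul p).sub (hZ.C_mul q)) a 1 1 using 1
    rw [hb', hd']
    simp only [map_mul, map_pow, map_ofNat, map_one]
    ring
  by_cases hb : b = 0
  · subst hb
    refine memCubeClosure_of_arc _ (Y ^ 3) 0 fun t ht => ?_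
    convert key t ht using 1
    simp only [map_zero]
    ring
  · exact key b hb

lemma memCubeClosure_cube_add_mul [CharZero K] (hU : U.IsHomogeneous 1)
    (hY : Y.IsHomogeneous 1) (hZ : Z.IsHomogeneous 1) (a b c d : K) :
    MemCubeClosure (C a * U ^ 3 + (C b * Y ^ 3 + C c * (Y ^ 2 * Z) + C d * (Y * Z ^ 2))) := by
  have key (d : K) (hd : d ≠ 0) : MemCubeClosure
      (C a * U ^ 3 + (C b * Y ^ 3 + C c * (Y ^ 2 * Z) + C d * (Y * Z ^ 2))) := by
    convert memCubeClosure_cube_add_even hU hY (hZ.add (hY.C_mul (c / (2 * d)))) a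
      (b - d * (c / (2 * d)) ^ 2) d using 1
    have hc : c = 2 * d * (c / (2 * d)) := by field_simp
    rw [show C c = C (2 * d * (c / (2 * d))) by rw [← hc]]
    simp only [map_mul, map_pow, map_ofNat, map_sub]
    ring
  by_cases hd : d = 0
  · subst hd
    refine memCubeClosure_of_arc _ (Y * Z ^ 2) 0 fun t ht => ?_
    convert key t ht using 1
    simp only [map_zero]
    ring
  · exact key d hd

/-- The closure contains the sum of a cube and a binary cubic form. -/
lemma memCubeClosure_cube_add_binary [CharZero K] (hU : U.IsHomogeneous 1)
    (hY : Y.IsHomogeneous 1) (hZ : Z.IsHomogeneous 1) (a b c d e : K) :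
    MemCubeClosure (C a * U ^ 3 +
      (C b * Y ^ 3 + C c * (Y ^ 2 * Z) + C d * (Y * Z ^ 2) + C e * Z ^ 3)) := by
  have key (b : K) (hb : b ≠ 0) : MemCubeClosure (C a * U ^ 3 +
      (C b * Y ^ 3 + C c * (Y ^ 2 * Z) + C d * (Y * Z ^ 2) + C e * Z ^ 3)) := by
    obtain ⟨r, hr⟩ := IsAlgClosed.exists_root (Cubic.mk b c d e).toPoly
      (by rw [Cubic.degree_of_a_ne_zero hb]; norm_num)
    have he : e = -(b * r ^ 3 + c * r ^ 2 + d * r) := by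
      simp only [Polynomial.IsRoot.def, Cubic.toPoly, Polynomial.eval_add, Polynomial.eval_mul,
        Polynomial.eval_C, Polynomial.eval_pow, Polynomial.eval_X] at hr
      linear_combination hr
    convert memCubeClosure_cube_add_mul hU (hY.sub (hZ.C_mul r)) hZ a b (3 * b * r + c)
      (3 * b * r ^ 2 + 2 * c * r + d) using 1
    rw [he]
    simp only [map_mul, map_pow, map_ofNat, map_add, map_neg]
    ring
  by_cases hb : b = 0
  · subst hb
    refine memCubeClosure_of_arc _ (Y ^ 3) 0 fun t ht => ?_
    convert key t ht using 1
    simp only [map_zero]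
    ring
  · exact key b hb

lemma memCubeClosure_cube_add_sq_mul [CharZero K] (hU : U.IsHomogeneous 1)
    (hY : Y.IsHomogeneous 1) (hZ : Z.IsHomogeneous 1) (a : K) :
    MemCubeClosure (C a * U ^ 3 + Y * Z ^ 2) := by
  refine memCubeClosure_of_arc _ (Y ^ 2 * Z) (C (1 / 3) * Y ^ 3) fun t ht => ?_
  convert memCubeClosure_sum_cubes hU (hZ.add (hY.C_mul t)) hZ a (1 / (3 * t))
    (-(1 / (3 * t))) using 1
  have h1 : (C (1 / (3 * t)) * C t * 3 : MvPolynomial (Fin 3) K) = 1 := by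
    rw [← map_ofNat C 3, ← map_mul, ← map_mul, ← map_one C]
    congr 1
    field_simp
  have h2 : (C (1 / 3) * 3 : MvPolynomial (Fin 3) K) = 1 := by
    rw [← map_ofNat C 3, ← map_mul, ← map_one C]
    congr 1
    norm_num
  simp only [map_pow, map_neg]
  linear_combination (-(Y * Z ^ 2) - C t * (Y ^ 2 * Z) - C (1 / 3) * C t ^ 2 * Y ^ 3) * h1 +
    C (1 / (3 * t)) * C t ^ 3 * Y ^ 3 * h2

/-- The closure contains a binary cubic form in `Y`, `Z` plus a multiple of `U * Z ^ 2`. -/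
lemma memCubeClosure_tangent_add_binary [CharZero K] (hU : U.IsHomogeneous 1)
    (hY : Y.IsHomogeneous 1) (hZ : Z.IsHomogeneous 1) (a b c d e : K) :
    MemCubeClosure (C a * (U * Z ^ 2) +
      (C b * Y ^ 3 + C c * (Y ^ 2 * Z) + C d * (Y * Z ^ 2) + C e * Z ^ 3)) := by
  have key (b : K) (hb : b ≠ 0) : MemCubeClosure (C a * (U * Z ^ 2) +
      (C b * Y ^ 3 + C c * (Y ^ 2 * Z) + C d * (Y * Z ^ 2) + C e * Z ^ 3)) := by
    obtain ⟨r, rfl⟩ : ∃ r, c = 3 * b * r := ⟨c / (3 * b), by field_simp⟩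
    convert memCubeClosure_cube_add_sq_mul (hY.add (hZ.C_mul r))
      (((hU.C_mul a).add (hY.C_mul (d - 3 * b * r ^ 2))).add (hZ.C_mul (e - b * r ^ 3))) hZ b
      using 1
    simp only [map_mul, map_pow, map_ofNat, map_sub]
    ring
  by_cases hb : b = 0
  · subst hb
    refine memCubeClosure_of_arc _ (Y ^ 3) 0 fun t ht => ?_
    convert key t ht using 1
    simp only [map_zero]
    ring
  · exact key b hb

end Closure

section LinearAlgebra

variable {K V : Type*} [Field K] [AddCommGroup V] [Module K V]

/-- If a nonscalar endomorphism is self-adjoint for a symmetric trilinear form `T`, then some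
nonzero vector `u` and some subspace `N` of codimension at most one satisfy `T u N V = 0`. -/
lemma exists_ne_zero_forall_eq_zero_of_selfAdjoint [IsAlgClosed K] [FiniteDimensional K V]
    [Nontrivial V] (T : V →ₗ[K] V →ₗ[K] V →ₗ[K] K) (hdim : Module.finrank K V = 3)
    (B : Module.End K V) (hB : ∀ c : K, B ≠ c • 1)
    (hTB : ∀ x y z, T (B x) y z = T x (B y) z) :
    ∃ u : V, u ≠ 0 ∧ ∃ N : Submodule K V, 2 ≤ Module.finrank K N ∧
      ∀ y ∈ N, ∀ z, T u y z = 0 := by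
  obtain ⟨c, hc⟩ := Module.End.exists_eigenvalue B
  obtain ⟨v, hv⟩ := hc.exists_hasEigenvector
  set D : Module.End K V := B - c • 1 with hD
  have hTD (x y z) : T (D x) y z = T x (D y) z := by
    simp [hD, hTB]
  have hDv : D v = 0 := by simp [hD, hv.apply_eq_smul]
  have hrank := LinearMap.finrank_range_add_finrank_ker D
  by_cases hker : 2 ≤ Module.finrank K (LinearMap.ker D)
  · obtain ⟨w, hw⟩ : ∃ w, D w ≠ 0 := by
      by_contra! h
      exact hB c (sub_eq_zero.mp (LinearMap.ext h))
    refine ⟨D w, hw, LinearMap.ker D, hker, fun y hy z => ?_⟩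
    rw [hTD, LinearMap.mem_ker.mp hy, map_zero, LinearMap.zero_apply]
  · refine ⟨v, hv.2, LinearMap.range D, by omega, ?_⟩
    rintro _ ⟨y, rfl⟩ z
    rw [← hTD, hDv, map_zero, LinearMap.zero_apply, LinearMap.zero_apply]

/-- Given a nonzero vector `u` and a subspace `N` of dimension at least two in a three-dimensional
space, some basis starting with `u` has its second vector in `N` and either its third or its first
vector in `N`. -/
lemma exists_basis_adapted [FiniteDimensional K V] (hdim : Module.finrank K V = 3)
    {u : V} (hu : u ≠ 0) (N : Submodule K V) (hN : 2 ≤ Module.finrank K N) :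
    ∃ b : Module.Basis (Fin 3) K V, b 0 = u ∧ b 1 ∈ N ∧ (b 2 ∈ N ∨ u ∈ N) := by
  have mk (y z : V) (hy : y ∉ Submodule.span K {u}) (hz : z ∉ Submodule.span K {u, y}) :
      ∃ b : Module.Basis (Fin 3) K V, b 0 = u ∧ b 1 = y ∧ b 2 = z := by
    have hli : LinearIndependent K ![z, y, u] := by
      refine linearIndependent_finCons.mpr ⟨linearIndependent_finCons.mpr ⟨?_, ?_⟩, ?_⟩
      · exact LinearIndependent.of_subsingleton 0 (by simpa using hu)
      · simpa using hy
      · simpa [Set.pair_comm] using hz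
    have hcard : Fintype.card (Fin 3) = Module.finrank K V := by simp [hdim]
    refine ⟨(basisOfLinearIndependentOfCardEqFinrank hli hcard).reindex Fin.revPerm, ?_, ?_, ?_⟩ <;>
      simp [Fin.rev]
  have notLe (S : Submodule K V) (hS : Module.finrank K S < Module.finrank K N) :
      ∃ y ∈ N, y ∉ S := by
    by_contra! h
    exact absurd (Submodule.finrank_mono (show N ≤ S from h)) (by omega)
  have hspan : Module.finrank K (Submodule.span K {u}) = 1 := finrank_span_singleton hu
  obtain ⟨y, hyN, hy⟩ := notLe (Submodule.span K {u}) (by omega)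
  by_cases huN : u ∈ N
  · obtain ⟨z, hz⟩ : ∃ z, z ∉ Submodule.span K {u, y} := by
      by_contra! h
      have h2 : Module.finrank K (Submodule.span K ({u, y} : Set V)) ≤ 2 := by
        classical
        have := finrank_span_finset_le_card (R := K) ({u, y} : Finset V)
        rw [Finset.coe_insert, Finset.coe_singleton] at this
        exact this.trans Finset.card_le_two
      rw [(Submodule.eq_top_iff').mpr h, finrank_top] at h2
      omega
    obtain ⟨b, h0, h1, -⟩ := mk y z hy hz
    exact ⟨b, h0, h1 ▸ hyN, Or.inr huN⟩
  · have hy0 : y ≠ 0 := fun h => hy (h ▸ Submodule.zero_mem _)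
    obtain ⟨z, hzN, hz⟩ := notLe (Submodule.span K {y}) (by rw [finrank_span_singleton hy0]; omega)
    obtain ⟨b, h0, h1, h2⟩ := mk y z hy (fun h => by
      obtain ⟨p, q, rfl⟩ := Submodule.mem_span_pair.mp h
      have hp : p ≠ 0 := by
        rintro rfl
        exact hz (Submodule.mem_span_singleton.mpr ⟨q, by simp⟩)
      refine huN ?_
      have := (N.sub_mem hzN (N.smul_mem q hyN))
      rw [add_sub_cancel_right] at this
      exact (N.smul_mem_iff hp).mp this)
    exact ⟨b, h0, h1 ▸ hyN, Or.inl (h2 ▸ hzN)⟩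

end LinearAlgebra

section Apolarity

variable {K : Type*}

lemma pderiv_pderiv_comm [CommRing K] {σ : Type*} (i j : σ) (p : MvPolynomial σ K) :
    pderiv i (pderiv j p) = pderiv j (pderiv i p) := by
  classical
  let D (i : σ) : Derivation K (MvPolynomial σ K) (MvPolynomial σ K) := pderiv i
  have h : ⁅D i, D j⁆ = 0 := by
    refine derivation_ext fun k => ?_
    simp only [D, Derivation.commutator_apply, pderiv_X, Pi.single_apply]
    split_ifs <;> simp
  have := DFunLike.congr_fun h p
  simpa [D, Derivation.commutator_apply, sub_eq_zero] using this

lemma pdOp_add_single [CommRing K] (m : Fin 3 →₀ ℕ) (i : Fin 3) (F : MvPolynomial (Fin 3) K) :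
    pdOp (m + Finsupp.single i 1) F = pderiv i (pdOp m F) := by
  let D (i : Fin 3) : Module.End K (MvPolynomial (Fin 3) K) := (pderiv i).toLinearMap
  have hD (i j : Fin 3) : Commute (D i) (D j) :=
    LinearMap.ext fun p => pderiv_pderiv_comm i j p
  have hprod (m : Fin 3 →₀ ℕ) : pdOp m = D 0 ^ m 0 * (D 1 ^ m 1 * D 2 ^ m 2) := by
    simp [pdOp, List.finRange_succ, D]
  have key : pdOp (m + Finsupp.single i 1) = D i * pdOp m := by
    rw [hprod, hprod]
    fin_cases i
    · simp [pow_succ', mul_assoc]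
    · simp [pow_succ', mul_assoc, ((hD 1 0).pow_right (m 0)).left_comm]
    · simp [pow_succ', ((hD 2 0).pow_right (m 0)).left_comm,
        ((hD 2 1).pow_right (m 1)).left_comm]
  rw [key]
  rfl

/-- The action `p ↦ p ⌟ F` as a linear map. -/
noncomputable def contractHom [CommRing K] {n : ℕ} (F : MvPolynomial (Fin n) K) :
    MvPolynomial (Fin n) K →ₗ[K] MvPolynomial (Fin n) K :=
  (basisMonomials (Fin n) K).constr K fun m => pdOp m F

lemma contractHom_apply [CommRing K] {n : ℕ} (F p : MvPolynomial (Fin n) K) :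
    contractHom F p = contract p F := by
  rw [contractHom, Module.Basis.constr_apply]
  rfl

lemma contractHom_monomial [CommRing K] {n : ℕ} (F : MvPolynomial (Fin n) K) (m : Fin n →₀ ℕ) :
    contractHom F (monomial m 1) = pdOp m F := by
  exact (basisMonomials (Fin n) K).constr_basis K _ m

lemma contractHom_one [CommRing K] {n : ℕ} (F : MvPolynomial (Fin n) K) :
    contractHom F 1 = F := by
  rw [← C_1, C_apply, contractHom_monomial, pdOp, List.prod_eq_one]
  · rfl
  · simp

lemma contractHom_X_mul [CommRing K] (F p : MvPolynomial (Fin 3) K) (i : Fin 3) :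
    contractHom F (X i * p) = pderiv i (contractHom F p) := by
  have : contractHom F ∘ₗ LinearMap.mulLeft K (X i) =
      (pderiv i).toLinearMap ∘ₗ contractHom F := by
    refine (basisMonomials (Fin 3) K).ext fun m => ?_
    have hX : X i * monomial m (1 : K) = monomial (m + Finsupp.single i 1) 1 := by
      rw [X, monomial_mul, add_comm, one_mul]
    simp only [coe_basisMonomials, LinearMap.comp_apply, LinearMap.mulLeft_apply, hX,
      contractHom_monomial, pdOp_add_single]
    rfl
  exact LinearMap.congr_fun this p

/-- The third partial derivatives of `F` at the origin. -/
noncomputable def polarCoeff [CommRing K] (F : MvPolynomial (Fin 3) K) (i j k : Fin 3) : K :=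
  coeff 0 (pderiv i (pderiv j (pderiv k F)))

lemma polarCoeff_swap_left [CommRing K] (F : MvPolynomial (Fin 3) K) (i j k : Fin 3) :
    polarCoeff F i j k = polarCoeff F j i k := by
  rw [polarCoeff, pderiv_pderiv_comm, polarCoeff]

lemma polarCoeff_swap_right [CommRing K] (F : MvPolynomial (Fin 3) K) (i j k : Fin 3) :
    polarCoeff F i j k = polarCoeff F i k j := by
  rw [polarCoeff, pderiv_pderiv_comm j k, polarCoeff]

lemma eq_C_coeff_zero_of_isHomogeneous_zero [CommRing K] {σ : Type*} {p : MvPolynomial σ K}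
    (hp : p.IsHomogeneous 0) : p = C (coeff 0 p) := by
  rwa [← totalDegree_zero_iff_isHomogeneous, totalDegree_eq_zero_iff_eq_C] at hp

lemma pderiv_three_eq_C [CommRing K] {F : MvPolynomial (Fin 3) K} (hF : F.IsHomogeneous 3)
    (i j k : Fin 3) : pderiv i (pderiv j (pderiv k F)) = C (polarCoeff F i j k) :=
  eq_C_coeff_zero_of_isHomogeneous_zero hF.pderiv.pderiv.pderiv

/-- A ternary cubic is recovered from its third partial derivatives. -/
lemma six_nsmul_eq_sum_polarCoeff [CommRing K] {F : MvPolynomial (Fin 3) K}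
    (hF : F.IsHomogeneous 3) :
    6 • F = ∑ i, ∑ j, ∑ k, polarCoeff F i j k • (X i * (X j * X k)) := by
  have h1 : ∑ i, X i * pderiv i F = 3 • F := hF.sum_X_mul_pderiv
  have h2 (i : Fin 3) : ∑ j, X j * pderiv j (pderiv i F) = 2 • pderiv i F :=
    hF.pderiv.sum_X_mul_pderiv
  have h3 (i j : Fin 3) : ∑ k, X k * C (polarCoeff F i j k) = pderiv j (pderiv i F) := by
    have : ∑ k, X k * pderiv k (pderiv j (pderiv i F)) = 1 • pderiv j (pderiv i F) :=
      hF.pderiv.pderiv.sum_X_mul_pderiv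
    simp only [pderiv_three_eq_C hF, one_smul] at this
    rw [← this]
    refine Finset.sum_congr rfl fun k _ => ?_
    rw [polarCoeff_swap_left, polarCoeff_swap_right, polarCoeff_swap_left]
  calc 6 • F = 2 • 3 • F := by rw [smul_smul]; norm_num
    _ = ∑ i, X i * ∑ j, X j * ∑ k, X k * C (polarCoeff F i j k) := by
      simp only [h3, h2, mul_smul_comm, ← Finset.smul_sum, h1]
    _ = _ := by
      simp only [Finset.mul_sum, smul_eq_C_mul]
      refine Finset.sum_congr rfl fun i _ => Finset.sum_congr rfl fun j _ =>
        Finset.sum_congr rfl fun k _ => ?_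
      ring

/-- The symmetric trilinear form attached to the third partial derivatives of `F`. -/
noncomputable def polarForm [CommRing K] (F : MvPolynomial (Fin 3) K) :
    (Fin 3 → K) →ₗ[K] (Fin 3 → K) →ₗ[K] (Fin 3 → K) →ₗ[K] K :=
  ∑ i, ∑ j, ∑ k, (LinearMap.proj i).smulRight ((LinearMap.proj j).smulRight
    (polarCoeff F i j k • LinearMap.proj k))

lemma polarForm_apply [CommRing K] (F : MvPolynomial (Fin 3) K) (x y z : Fin 3 → K) :
    polarForm F x y z = ∑ i, ∑ j, ∑ k, polarCoeff F i j k * (x i * y j * z k) := by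
  simp only [polarForm, LinearMap.sum_apply, LinearMap.smulRight_apply, LinearMap.smul_apply,
    LinearMap.proj_apply, smul_eq_mul]
  refine Finset.sum_congr rfl fun i _ => Finset.sum_congr rfl fun j _ =>
    Finset.sum_congr rfl fun k _ => ?_
  ring

lemma polarForm_swap_left [CommRing K] (F : MvPolynomial (Fin 3) K) (x y z : Fin 3 → K) :
    polarForm F x y z = polarForm F y x z := by
  rw [polarForm_apply, polarForm_apply, Finset.sum_comm]
  refine Finset.sum_congr rfl fun i _ => Finset.sum_congr rfl fun j _ =>
    Finset.sum_congr rfl fun k _ => ?_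
  rw [polarCoeff_swap_left, mul_comm (x j)]

lemma polarForm_swap_right [CommRing K] (F : MvPolynomial (Fin 3) K) (x y z : Fin 3 → K) :
    polarForm F x y z = polarForm F x z y := by
  rw [polarForm_apply, polarForm_apply]
  refine Finset.sum_congr rfl fun i _ => ?_
  rw [Finset.sum_comm]
  refine Finset.sum_congr rfl fun j _ => Finset.sum_congr rfl fun k _ => ?_
  rw [polarCoeff_swap_right]
  ring

lemma polarForm_self [CommRing K] {F : MvPolynomial (Fin 3) K} (hF : F.IsHomogeneous 3)
    (x : Fin 3 → K) : polarForm F x x x = 6 * eval x F := by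
  have h := congrArg (eval x) (six_nsmul_eq_sum_polarCoeff hF)
  simp only [map_sum, map_mul, smul_eval, eval_X, nsmul_eq_mul, Nat.cast_ofNat, map_ofNat] at h
  simp only [polarForm_apply, h, mul_assoc]

/-- A quadric `∑ q i j X i X j` annihilates `F` as soon as the contraction of `q` with the third
partial derivatives vanishes. -/
lemma sum_smul_X_mul_X_mem_annDeg [Field K] {F : MvPolynomial (Fin 3) K} (hF : F.IsHomogeneous 3)
    (q : Fin 3 → Fin 3 → K) (hq : ∀ k, ∑ i, ∑ j, q i j * polarCoeff F i j k = 0) :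
    ∑ i, ∑ j, q i j • (X i * X j) ∈ annDeg F 2 := by
  constructor
  · refine IsHomogeneous.sum _ _ _ fun i _ => IsHomogeneous.sum _ _ _ fun j _ => ?_
    rw [smul_eq_C_mul]
    exact ((isHomogeneous_X K i).mul (isHomogeneous_X K j)).C_mul _
  · rw [← contractHom_apply]
    have hX (i j : Fin 3) : contractHom F (X i * X j) = pderiv i (pderiv j F) := by
      rw [← mul_one (X j), contractHom_X_mul, contractHom_X_mul, contractHom_one]
    simp only [map_sum, map_smul, hX]
    have hh (i j : Fin 3) := ((hF.pderiv (i := j)).pderiv (i := i)).sum_X_mul_pderiv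
    simp only [show 3 - 1 - 1 = 1 from rfl, one_smul] at hh
    have hcomm (i j k : Fin 3) : pderiv k (pderiv i (pderiv j F)) = C (polarCoeff F i j k) := by
      rw [pderiv_three_eq_C hF, polarCoeff_swap_left, polarCoeff_swap_right]
    calc ∑ i, ∑ j, q i j • pderiv i (pderiv j F)
        = ∑ i, ∑ j, ∑ k, X k * C (q i j * polarCoeff F i j k) := by
          refine Finset.sum_congr rfl fun i _ => Finset.sum_congr rfl fun j _ => ?_
          rw [← hh, Finset.smul_sum]
          refine Finset.sum_congr rfl fun k _ => ?_
          rw [hcomm, smul_eq_C_mul, C_mul]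
          ring
      _ = ∑ k, X k * C (∑ i, ∑ j, q i j * polarCoeff F i j k) := by
          simp only [map_sum, Finset.mul_sum]
          rw [Finset.sum_comm_cycle]
      _ = 0 := by simp [hq]

/-- A cubic in the coordinates dual to a basis `b`. -/
lemma eq_sum_of_basis [Field K] [CharZero K] {F : MvPolynomial (Fin 3) K} (hF : F.IsHomogeneous 3)
    (b : Module.Basis (Fin 3) K (Fin 3 → K)) :
    ∃ L : Fin 3 → MvPolynomial (Fin 3) K, (∀ a, (L a).IsHomogeneous 1) ∧
      F = C (polarForm F (b 0) (b 0) (b 0) / 6) * L 0 ^ 3 +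
        C (polarForm F (b 0) (b 0) (b 1) / 2) * (L 0 ^ 2 * L 1) +
        C (polarForm F (b 0) (b 0) (b 2) / 2) * (L 0 ^ 2 * L 2) +
        C (polarForm F (b 0) (b 1) (b 1) / 2) * (L 0 * L 1 ^ 2) +
        C (polarForm F (b 0) (b 1) (b 2)) * (L 0 * L 1 * L 2) +
        C (polarForm F (b 0) (b 2) (b 2) / 2) * (L 0 * L 2 ^ 2) +
        (C (polarForm F (b 1) (b 1) (b 1) / 6) * L 1 ^ 3 +
        C (polarForm F (b 1) (b 1) (b 2) / 2) * (L 1 ^ 2 * L 2) +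
        C (polarForm F (b 1) (b 2) (b 2) / 2) * (L 1 * L 2 ^ 2) +
        C (polarForm F (b 2) (b 2) (b 2) / 6) * L 2 ^ 3) := by
  refine ⟨fun a => ∑ j, C (b.coord a (Pi.single j 1)) * X j,
    fun a => IsHomogeneous.sum _ _ _ fun j _ => isHomogeneous_C_mul_X _ _, ?_⟩
  refine MvPolynomial.funext fun x => ?_
  have hL (a : Fin 3) : eval x (∑ j, C (b.coord a (Pi.single j 1)) * X j) = b.coord a x := by
    conv_rhs => rw [pi_eq_sum_univ' x]
    simp [mul_comm]
  have hx : x = b.coord 0 x • b 0 + b.coord 1 x • b 1 + b.coord 2 x • b 2 := by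
    conv_lhs => rw [← b.sum_repr x, Fin.sum_univ_three]
    rfl
  have h6 := polarForm_self hF x
  have hs := polarForm_swap_left F
  have hr := polarForm_swap_right F
  simp only [map_add, map_mul, map_pow, eval_C, hL]
  generalize b.coord 0 x = α at *
  generalize b.coord 1 x = β at *
  generalize b.coord 2 x = γ at *
  suffices 6 * eval x F = 6 * _ from mul_left_cancel₀ (by norm_num) this
  rw [← h6]
  conv_lhs => rw [hx]
  simp only [map_add, map_smul, LinearMap.add_apply, LinearMap.smul_apply, smul_eq_mul,
    hs (b 1) (b 0), hs (b 2) (b 0), hs (b 2) (b 1), hr _ (b 1) (b 0), hr _ (b 2) (b 0),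
    hr _ (b 2) (b 1)]
  ring

/-- If `Ann(F)` has a minimal cubic generator, then some nonscalar endomorphism is self-adjoint
for the trilinear form of `F`. -/
lemma exists_selfAdjoint_of_span_lt [Field K] [CharZero K] {F : MvPolynomial (Fin 3) K}
    (hF : F.IsHomogeneous 3)
    (hlt : Submodule.span K
        {r : MvPolynomial (Fin 3) K | ∃ j : Fin 3, ∃ p ∈ annDeg F 2, r = X j * p} <
      Submodule.span K (annDeg F 3)) :
    ∃ B : Module.End K (Fin 3 → K), (∀ c : K, B ≠ c • 1) ∧
      ∀ x y z, polarForm F (B x) y z = polarForm F x (B y) z := by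
  obtain ⟨p, ⟨hp3, hpF⟩, hpn⟩ := Set.not_subset.mp fun h =>
    hlt.not_ge (Submodule.span_le.mpr h)
  obtain ⟨f, hfp, hf⟩ := Submodule.exists_le_ker_of_notMem hpn
  let g (i j k : Fin 3) : K := f (X i * (X j * X k))
  let φ (c : Fin 3 → Fin 3 → K) : (Fin 3 → Fin 3 → K) →ₗ[K] K :=
    ∑ i, ∑ j, c i j •
      ((LinearMap.proj j : (Fin 3 → K) →ₗ[K] K) ∘ₗ LinearMap.proj i)
  have hφ (c q : Fin 3 → Fin 3 → K) : φ c q = ∑ i, ∑ j, q i j * c i j := by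
    simp [φ, mul_comm]
  have hg (k : Fin 3) : ∃ a : Fin 3 → K, ∀ i j, g i j k = ∑ l, a l * polarCoeff F i j l := by
    have hmem : φ (fun i j => g i j k) ∈
        Submodule.span K (Set.range fun l => φ fun i j => polarCoeff F i j l) := by
      refine mem_span_of_iInf_ker_le_ker fun q hq => ?_
      simp only [Submodule.mem_iInf, LinearMap.mem_ker, hφ] at hq
      have := hf (Submodule.subset_span ⟨k, _, sum_smul_X_mul_X_mem_annDeg hF q hq, rfl⟩)
      rw [LinearMap.mem_ker] at this ⊢
      rw [hφ, ← this]
      simp only [Finset.mul_sum, map_sum, mul_smul_comm, map_smul, smul_eq_mul, g]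
      refine Finset.sum_congr rfl fun i _ => Finset.sum_congr rfl fun j _ => ?_
      congr 2
      ring
    obtain ⟨a, ha⟩ := Submodule.mem_span_range_iff_exists_fun K |>.mp hmem
    refine ⟨a, fun i j => ?_⟩
    have := LinearMap.congr_fun ha (Pi.single i (Pi.single j 1))
    simpa [φ, Pi.single_apply, ite_apply, eq_comm] using this
  choose a ha using hg
  let B : Module.End K (Fin 3 → K) := Matrix.mulVecLin (Matrix.of fun l k => a k l)
  have hB (x y z) : polarForm F x y (B z) = ∑ i, ∑ j, ∑ k, g i j k * (x i * y j * z k) := by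
    rw [polarForm_apply]
    refine Finset.sum_congr rfl fun i _ => Finset.sum_congr rfl fun j _ => ?_
    simp only [ha, B, Matrix.mulVecLin_apply, Matrix.mulVec, dotProduct, Matrix.of_apply,
      Finset.mul_sum, Finset.sum_mul]
    rw [Finset.sum_comm]
    refine Finset.sum_congr rfl fun k _ => Finset.sum_congr rfl fun l _ => ?_
    ring
  have hBs (x y z) : polarForm F x y (B z) = polarForm F x z (B y) := by
    rw [hB, hB]
    refine Finset.sum_congr rfl fun i _ => ?_
    rw [Finset.sum_comm]
    refine Finset.sum_congr rfl fun j _ => Finset.sum_congr rfl fun k _ => ?_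
    rw [show g i k j = g i j k by simp only [g, mul_comm (X j)]]
    ring
  refine ⟨B, fun c hc => hfp ?_, fun x y z => ?_⟩
  · have hgc (i j k : Fin 3) : g i j k = c * polarCoeff F i j k := by
      have hak (l : Fin 3) : a k l = c * (Pi.single k 1 : Fin 3 → K) l := by
        have := congrFun (LinearMap.congr_fun hc (Pi.single k 1)) l
        simpa [B] using this
      rw [ha]
      simp [hak, Pi.single_apply]
    have h6 := six_nsmul_eq_sum_polarCoeff hp3
    have hX (i j k : Fin 3) : contractHom F (X i * (X j * X k)) = C (polarCoeff F i j k) := by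
      rw [← mul_one (X k), contractHom_X_mul, contractHom_X_mul, contractHom_X_mul,
        contractHom_one, pderiv_three_eq_C hF]
    have h0 : ∑ i, ∑ j, ∑ k, polarCoeff p i j k * polarCoeff F i j k = 0 := by
      have h := congrArg (fun r => coeff 0 (contractHom F r)) h6
      simp only [map_nsmul, contractHom_apply F p, hpF, smul_zero, map_sum, map_smul, hX,
        coeff_zero, coeff_sum, coeff_smul, coeff_zero_C, smul_eq_mul] at h
      exact h.symm
    have h6f := congrArg f h6
    simp only [map_nsmul, map_sum, map_smul, smul_eq_mul] at h6f
    have : 6 • f p = c * ∑ i, ∑ j, ∑ k, polarCoeff p i j k * polarCoeff F i j k := by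
      rw [h6f]
      simp only [Finset.mul_sum]
      refine Finset.sum_congr rfl fun i _ => Finset.sum_congr rfl fun j _ =>
        Finset.sum_congr rfl fun k _ => ?_
      rw [show f (X i * (X j * X k)) = _ from hgc i j k]
      ring
    rw [h0, mul_zero] at this
    simpa using this
  · rw [polarForm_swap_left, polarForm_swap_right, hBs, polarForm_swap_left, hBs,
      polarForm_swap_right]

end Apolarity

/-- **Proposition 2.6, Item 2 (buchsbaum_eisenbud).** If a ternary cubic `F` depends
essentially on 3 variables and `Ann(F)` has a minimal cubic generator, then `F` lies in the
Zariski closure of the set of sums of three cubes of linear forms, i.e. in the affine cone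
over `σ₃(v₃(ℙ²))`. -/
theorem stmt2 {K : Type*} [Field K] [CharZero K] [IsAlgClosed K]
    (F : MvPolynomial (Fin 3) K) (hF : MvPolynomial.IsHomogeneous F 3)
    (hdep : LinearIndependent K ![pderiv (0 : Fin 3) F, pderiv 1 F, pderiv 2 F])
    (hproper :
      Submodule.span K {r : MvPolynomial (Fin 3) K | ∃ j : Fin 3, ∃ p ∈ annDeg F 2, r = X j * p} <
        Submodule.span K (annDeg F 3)) :
    ∀ Φ : MvPolynomial ((Fin 3) →₀ ℕ) K,
      (∀ l₁ l₂ l₃ : MvPolynomial (Fin 3) K,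
        MvPolynomial.IsHomogeneous l₁ 1 → MvPolynomial.IsHomogeneous l₂ 1 →
        MvPolynomial.IsHomogeneous l₃ 1 →
        MvPolynomial.eval (fun m => MvPolynomial.coeff m (l₁ ^ 3 + l₂ ^ 3 + l₃ ^ 3)) Φ = 0) →
      MvPolynomial.eval (fun m => MvPolynomial.coeff m F) Φ = 0 := by
  change MemCubeClosure F
  obtain ⟨B, hB, hTB⟩ := exists_selfAdjoint_of_span_lt hF hproper
  have hdim : Module.finrank K (Fin 3 → K) = 3 := by simp
  obtain ⟨u, hu, N, hN, hT⟩ :=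
    exists_ne_zero_forall_eq_zero_of_selfAdjoint (polarForm F) hdim B hB hTB
  obtain ⟨b, rfl, h1, h2⟩ := exists_basis_adapted hdim hu N hN
  obtain ⟨L, hL, hFL⟩ := eq_sum_of_basis hF b
  have hT1 := hT _ h1
  rcases h2 with h2 | h0
  · have h001 : polarForm F (b 0) (b 0) (b 1) = 0 := by rw [polarForm_swap_right, hT1]
    have h002 : polarForm F (b 0) (b 0) (b 2) = 0 := by rw [polarForm_swap_right, hT _ h2]
    simp only [hT1, hT _ h2, h001, h002, zero_div, map_zero, zero_mul, add_zero] at hFL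
    rw [hFL]
    exact memCubeClosure_cube_add_binary (hL 0) (hL 1) (hL 2) _ _ _ _ _
  · simp only [hT1, hT _ h0, zero_div, map_zero, zero_mul, add_zero, zero_add] at hFL
    rw [hFL]
    exact memCubeClosure_tangent_add_binary (hL 0) (hL 1) (hL 2) _ _ _ _ _
end

section
/- Let K be an algebraically closed field of characteristic 0, let n ≥ 3, and let W be a 2-dimensional K-linear subspace of the space of homogeneous degree-3 polynomials in K[x_1,…,x_n] such that for every f ∈ W there exist linear forms x, y ∈ K[x_1,…,x_n] with f a cubic form in x and y (i.e., f lies in the K-span of x³, x²y, xy², y³). Then either there exist linear forms x, y such that every element of W is a cubic form in x and y, or there exist linearly independent linear forms x, y, z such that W is the K-span of x²y and x²z. -/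
open MvPolynomial

section BinaryCubics

variable {K : Type*} [Field K] {n : ℕ}

/-- The space of cubic forms in `x` and `y`. -/
noncomputable abbrev binaryCubics (x y : MvPolynomial (Fin n) K) :
    Submodule K (MvPolynomial (Fin n) K) :=
  Submodule.span K {x ^ 3, x ^ 2 * y, x * y ^ 2, y ^ 3}

/-- A cubic form in some pair of linear forms. -/
def IsBinaryCubic (f : MvPolynomial (Fin n) K) : Prop :=
  ∃ x y : MvPolynomial (Fin n) K,
    IsHomogeneous x 1 ∧ IsHomogeneous y 1 ∧ f ∈ binaryCubics x y

/-- A scalar multiple of the cube of a linear form. -/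
def IsUnaryCubic (f : MvPolynomial (Fin n) K) : Prop :=
  ∃ (c : K) (l : MvPolynomial (Fin n) K), IsHomogeneous l 1 ∧ f = c • l ^ 3

theorem mem_binaryCubics {x y f : MvPolynomial (Fin n) K} :
    f ∈ binaryCubics x y ↔ ∃ a b c d : K,
      f = a • x ^ 3 + b • (x ^ 2 * y) + c • (x * y ^ 2) + d • y ^ 3 := by
  simp only [binaryCubics, Submodule.mem_span_insert, Submodule.mem_span_singleton]
  constructor
  · rintro ⟨a, _, ⟨b, _, ⟨c, _, ⟨d, rfl⟩, rfl⟩, rfl⟩, rfl⟩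
    exact ⟨a, b, c, d, by abel⟩
  · rintro ⟨a, b, c, d, rfl⟩
    exact ⟨a, _, ⟨b, _, ⟨c, _, ⟨d, rfl⟩, rfl⟩, rfl⟩, by abel⟩

theorem binaryCubics_le {u v x y : MvPolynomial (Fin n) K}
    (hu : u ∈ Submodule.span K {x, y}) (hv : v ∈ Submodule.span K {x, y}) :
    binaryCubics u v ≤ binaryCubics x y := by
  obtain ⟨a, b, rfl⟩ := Submodule.mem_span_pair.1 hu
  obtain ⟨c, d, rfl⟩ := Submodule.mem_span_pair.1 hv
  rw [binaryCubics, Submodule.span_le]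
  simp only [Set.insert_subset_iff, Set.singleton_subset_iff, SetLike.mem_coe, mem_binaryCubics,
    smul_eq_C_mul]
  refine ⟨⟨a ^ 3, 3 * a ^ 2 * b, 3 * a * b ^ 2, b ^ 3, ?_⟩,
    ⟨a ^ 2 * c, a ^ 2 * d + 2 * a * b * c, 2 * a * b * d + b ^ 2 * c, b ^ 2 * d, ?_⟩,
    ⟨a * c ^ 2, 2 * a * c * d + b * c ^ 2, a * d ^ 2 + 2 * b * c * d, b * d ^ 2, ?_⟩,
    ⟨c ^ 3, 3 * c ^ 2 * d, 3 * c * d ^ 2, d ^ 3, ?_⟩⟩ <;>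
  · simp only [map_mul, map_add, map_pow, map_ofNat]
    ring

theorem MvPolynomial.IsHomogeneous.linear_comb {x y : MvPolynomial (Fin n) K}
    (hx : IsHomogeneous x 1) (hy : IsHomogeneous y 1) (a b : K) : IsHomogeneous (a • x + b • y) 1 :=
  (homogeneousSubmodule (Fin n) K 1).add_mem (Submodule.smul_mem _ a hx)
    (Submodule.smul_mem _ b hy)

theorem MvPolynomial.IsHomogeneous.exists_linearMap {l : MvPolynomial (Fin n) K}
    (hl : IsHomogeneous l 1) :
    ∃ φ : (Fin n → K) →ₗ[K] K, ∀ v, eval v l = φ v := by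
  have hl' : l ∈ homogeneousSubmodule (Fin n) K 1 := hl
  rw [homogeneousSubmodule_one_eq_span_X] at hl'
  induction hl' using Submodule.span_induction with
  | mem x h =>
    obtain ⟨i, rfl⟩ := h
    exact ⟨LinearMap.proj i, fun v => by simp⟩
  | zero => exact ⟨0, fun v => by simp⟩
  | add p q hp hq ihp ihq =>
    rw [← homogeneousSubmodule_one_eq_span_X] at hp hq
    obtain ⟨φ, hφ⟩ := ihp hp
    obtain ⟨ψ, hψ⟩ := ihq hq
    exact ⟨φ + ψ, fun v => by simp [hφ, hψ]⟩
  | smul a p hp ih =>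
    rw [← homogeneousSubmodule_one_eq_span_X] at hp
    obtain ⟨φ, hφ⟩ := ih hp
    exact ⟨a • φ, fun v => by simp [hφ, smul_eval]⟩

theorem MvPolynomial.IsHomogeneous.eval_comb {l : MvPolynomial (Fin n) K} (hl : IsHomogeneous l 1)
    (p q r : K) (u v w : Fin n → K) :
    eval (p • u + q • v + r • w) l = p * eval u l + q * eval v l + r * eval w l := by
  obtain ⟨φ, hφ⟩ := hl.exists_linearMap
  simp [hφ]

theorem exists_eval_eq [Infinite K] {k : ℕ} {x : Fin k → MvPolynomial (Fin n) K}
    (hx : ∀ i, IsHomogeneous (x i) 1) (hli : LinearIndependent K x) (t : Fin k → K) :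
    ∃ v : Fin n → K, ∀ i, eval v (x i) = t i := by
  choose φ hφ using fun i => (hx i).exists_linearMap
  have hf : LinearIndependent K (fun i (v : Fin n → K) => φ i v) := by
    rw [Fintype.linearIndependent_iff] at hli ⊢
    intro c hc
    refine hli c (MvPolynomial.funext fun v => ?_)
    simpa [hφ, smul_eval] using congrFun hc v
  rw [← span_flip_eq_top_iff_linearIndependent] at hf
  have hle : Submodule.span K (Set.range (flip fun i (v : Fin n → K) => φ i v)) ≤
      LinearMap.range (LinearMap.pi φ) := by
    rw [Submodule.span_le]
    rintro _ ⟨v, rfl⟩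
    exact ⟨v, rfl⟩
  rw [hf] at hle
  obtain ⟨v, hv⟩ := hle (Submodule.mem_top (x := t))
  exact ⟨v, fun i => by rw [hφ, ← hv]; rfl⟩

theorem exists_common_zero (u v : Fin 3 → K) : ∃ a b c : K, (a ≠ 0 ∨ b ≠ 0 ∨ c ≠ 0) ∧
    a * u 0 + b * u 1 + c * u 2 = 0 ∧ a * v 0 + b * v 1 + c * v 2 = 0 := by
  have hdet : (Matrix.of ![u, v, 0]).det = 0 :=
    Matrix.det_eq_zero_of_row_eq_zero 2 fun j => by simp
  obtain ⟨w, hw, h⟩ := Matrix.exists_mulVec_eq_zero_iff.2 hdet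
  refine ⟨w 0, w 1, w 2, ?_, ?_, ?_⟩
  · by_contra! hc
    exact hw (by ext i; fin_cases i <;> simp [hc])
  · simpa [Matrix.mulVec, dotProduct, Fin.sum_univ_three, mul_comm (w _)] using congrFun h 0
  · simpa [Matrix.mulVec, dotProduct, Fin.sum_univ_three, mul_comm (w _)] using congrFun h 1

/-- If a binary cubic restricts on a three-dimensional slice to `F(p, q) + G(p, r)`, some nonzero
directional derivative of this restriction vanishes; its coefficients are listed. -/
theorem IsBinaryCubic.exists_direction [CharZero K] {h : MvPolynomial (Fin n) K}
    (hh : IsBinaryCubic h)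
    (u v w : Fin n → K) {α₀ α₁ α₂ α₃ β₀ β₁ β₂ β₃ : K}
    (hQ : ∀ p q r : K, eval (p • u + q • v + r • w) h =
      α₀ * p ^ 3 + α₁ * (p ^ 2 * q) + α₂ * (p * q ^ 2) + α₃ * q ^ 3 +
      (β₀ * p ^ 3 + β₁ * (p ^ 2 * r) + β₂ * (p * r ^ 2) + β₃ * r ^ 3)) :
    ∃ a b c : K, (a ≠ 0 ∨ b ≠ 0 ∨ c ≠ 0) ∧
      3 * a * α₀ + b * α₁ + (3 * a * β₀ + c * β₁) = 0 ∧
      a * α₁ + b * α₂ = 0 ∧ a * α₂ + 3 * b * α₃ = 0 ∧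
      a * β₁ + c * β₂ = 0 ∧ a * β₂ + 3 * c * β₃ = 0 := by
  obtain ⟨x, y, hx, hy, hmem⟩ := hh
  obtain ⟨k₀, k₁, k₂, k₃, rfl⟩ := mem_binaryCubics.1 hmem
  obtain ⟨a, b, c, hne, h₁, h₂⟩ := exists_common_zero
    ![eval u x, eval v x, eval w x] ![eval u y, eval v y, eval w y]
  simp only [Matrix.cons_val_zero, Matrix.cons_val_one, Matrix.cons_val] at h₁ h₂
  have hinv (p q r s : K) := (hQ (p + s * a) (q + s * b) (r + s * c)).symm.trans <| Eq.trans (by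
    have hX : eval ((p + s * a) • u + (q + s * b) • v + (r + s * c) • w) x =
        eval (p • u + q • v + r • w) x := by
      rw [hx.eval_comb, hx.eval_comb]
      linear_combination s * h₁
    have hY : eval ((p + s * a) • u + (q + s * b) • v + (r + s * c) • w) y =
        eval (p • u + q • v + r • w) y := by
      rw [hy.eval_comb, hy.eval_comb]
      linear_combination s * h₂
    simp only [map_add, map_mul, map_pow, smul_eval, hX, hY]) (hQ p q r)
  have hD (p q r : K) :
      (3 * a * α₀ + b * α₁ + (3 * a * β₀ + c * β₁)) * p ^ 2 + 2 * (a * α₁ + b * α₂) * (p * q) +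
      (a * α₂ + 3 * b * α₃) * q ^ 2 + 2 * (a * β₁ + c * β₂) * (p * r) +
      (a * β₂ + 3 * c * β₃) * r ^ 2 = 0 := by
    linear_combination (8 * (hinv p q r 1 - hinv p q r (-1)) -
      (hinv p q r 2 - hinv p q r (-2))) / 12
  exact ⟨a, b, c, hne, by linear_combination hD 1 0 0,
    by linear_combination (hD 1 1 0 - hD 1 0 0 - hD 0 1 0) / 2,
    by linear_combination hD 0 1 0,
    by linear_combination (hD 1 0 1 - hD 1 0 0 - hD 0 0 1) / 2,
    by linear_combination hD 0 0 1⟩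

theorem isUnaryCubic_of_direction {x y : MvPolynomial (Fin n) K} (hx : IsHomogeneous x 1)
    (hy : IsHomogeneous y 1) [CharZero K] {α₀ α₁ α₂ α₃ a b : K} (hab : a ≠ 0 ∨ b ≠ 0)
    (h₁ : 3 * a * α₀ + b * α₁ = 0) (h₂ : a * α₁ + b * α₂ = 0) (h₃ : a * α₂ + 3 * b * α₃ = 0) :
    IsUnaryCubic (α₀ • x ^ 3 + α₁ • (x ^ 2 * y) + α₂ • (x * y ^ 2) + α₃ • y ^ 3) := by
  by_cases hb : b = 0
  · subst hb
    have ha : a ≠ 0 := by simpa using hab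
    have e₀ : α₀ = 0 := by simpa [ha] using h₁
    have e₁ : α₁ = 0 := by simpa [ha] using h₂
    have e₂ : α₂ = 0 := by simpa [ha] using h₃
    exact ⟨α₃, y, hy, by simp [e₀, e₁, e₂]⟩
  · obtain ⟨m, rfl⟩ : ∃ m, a = b * m := ⟨a / b, by field_simp⟩
    have e₁ : α₁ = -(3 * m * α₀) := mul_left_cancel₀ hb (by linear_combination h₁)
    have e₂ : α₂ = 3 * m ^ 2 * α₀ :=
      mul_left_cancel₀ hb (by linear_combination h₂ - b * m * e₁)
    have e₃ : α₃ = -(m ^ 3 * α₀) :=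
      mul_left_cancel₀ (mul_ne_zero three_ne_zero hb)
        (by linear_combination h₃ - b * m * e₂)
    refine ⟨α₀, (1 : K) • x + (-m) • y, hx.linear_comb hy _ _, ?_⟩
    rw [e₁, e₂, e₃]
    simp only [smul_eq_C_mul, map_mul, map_neg, map_pow, map_ofNat, map_one]
    ring

theorem linearIndependent_of_not_isUnaryCubic {x y f : MvPolynomial (Fin n) K}
    (hx : IsHomogeneous x 1) (hy : IsHomogeneous y 1) (hf : f ∈ binaryCubics x y)
    (hfu : ¬ IsUnaryCubic f) : LinearIndependent K ![x, y] := by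
  have aux {l : MvPolynomial (Fin n) K} (hl : IsHomogeneous l 1) (h : f ∈ binaryCubics l 0) :
      False := by
    obtain ⟨a, b, c, d, rfl⟩ := mem_binaryCubics.1 h
    exact hfu ⟨a, l, hl, by simp⟩
  by_contra hli
  rw [linearIndependent_fin2] at hli
  simp only [Matrix.cons_val_one, Matrix.cons_val_zero, not_and_or, not_forall, not_not] at hli
  rcases hli with h0 | ⟨a, h⟩
  · exact aux hx (h0 ▸ hf)
  · refine aux hy (binaryCubics_le ?_ ?_ hf)
    · exact Submodule.mem_span_pair.2 ⟨a, 0, by simpa using h⟩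
    · exact Submodule.subset_span (by simp)

/-- The two possible shapes of a pencil of binary cubics, in terms of a generating pair. -/
def PencilShape (f g : MvPolynomial (Fin n) K) : Prop :=
  (∃ x y : MvPolynomial (Fin n) K, IsHomogeneous x 1 ∧ IsHomogeneous y 1 ∧
    f ∈ binaryCubics x y ∧ g ∈ binaryCubics x y) ∨
  (∃ x y z : MvPolynomial (Fin n) K, IsHomogeneous x 1 ∧ IsHomogeneous y 1 ∧
    IsHomogeneous z 1 ∧ LinearIndependent K ![x, y, z] ∧ f = x ^ 2 * y ∧ g = x ^ 2 * z)

theorem pencilShape_of_common_form [CharZero K] {x y z f g : MvPolynomial (Fin n) K}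
    (hx : IsHomogeneous x 1) (hy : IsHomogeneous y 1) (hz : IsHomogeneous z 1)
    (hli : LinearIndependent K ![z, x, y]) (hf : f ∈ binaryCubics x y)
    (hg : g ∈ binaryCubics x z) (hfu : ¬ IsUnaryCubic f)
    (hadd : IsBinaryCubic (f + g)) (hsub : IsBinaryCubic (f - g)) : PencilShape f g := by
  obtain ⟨α₀, α₁, α₂, α₃, rfl⟩ := mem_binaryCubics.1 hf
  obtain ⟨β₀, β₁, β₂, β₃, rfl⟩ := mem_binaryCubics.1 hg
  have hu {a b : K} (h₁ : 3 * a * α₀ + b * α₁ = 0) (h₂ : a * α₁ + b * α₂ = 0)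
      (h₃ : a * α₂ + 3 * b * α₃ = 0) : a = 0 ∧ b = 0 := by
    by_contra hab
    exact hfu (isUnaryCubic_of_direction hx hy (by tauto) h₁ h₂ h₃)
  by_cases hβ : β₁ = 0 ∧ β₂ = 0 ∧ β₃ = 0
  · obtain ⟨rfl, rfl, rfl⟩ := hβ
    exact .inl ⟨x, y, hx, hy, hf, mem_binaryCubics.2 ⟨β₀, 0, 0, 0, by simp⟩⟩
  have hhom : ∀ i, IsHomogeneous (![z, x, y] i) 1 := by
    intro i; fin_cases i <;> simpa
  obtain ⟨u, hu'⟩ := exists_eval_eq hhom hli ![0, 1, 0]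
  obtain ⟨v, hv'⟩ := exists_eval_eq hhom hli ![0, 0, 1]
  obtain ⟨w, hw'⟩ := exists_eval_eq hhom hli ![1, 0, 0]
  simp only [Fin.forall_fin_succ, Matrix.cons_val_zero, Matrix.cons_val_succ, IsEmpty.forall_iff,
    and_true] at hu' hv' hw'
  have ex (p q r : K) : eval (p • u + q • v + r • w) x = p := by
    simp [hx.eval_comb, hu', hv', hw']
  have ey (p q r : K) : eval (p • u + q • v + r • w) y = q := by
    simp [hy.eval_comb, hu', hv', hw']
  have ez (p q r : K) : eval (p • u + q • v + r • w) z = r := by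
    simp [hz.eval_comb, hu', hv', hw']
  obtain ⟨a, b, c, hne, h₁, h₂, h₃, h₄, h₅⟩ := hadd.exists_direction u v w
    (α₀ := α₀) (α₁ := α₁) (α₂ := α₂) (α₃ := α₃) (β₀ := β₀) (β₁ := β₁) (β₂ := β₂) (β₃ := β₃)
    (fun p q r => by simp only [map_add, map_mul, map_pow, smul_eval, ex, ey, ez])
  obtain ⟨a', b', c', hne', h₁', h₂', h₃', h₄', h₅'⟩ := hsub.exists_direction u v w
    (α₀ := α₀) (α₁ := α₁) (α₂ := α₂) (α₃ := α₃) (β₀ := -β₀) (β₁ := -β₁) (β₂ := -β₂) (β₃ := -β₃)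
    (fun p q r => by
      simp only [map_add, map_sub, map_mul, map_pow, smul_eval, ex, ey, ez]; ring)
  have shape (hα₂ : α₂ = 0) (hα₃ : α₃ = 0) (hβ₂ : β₂ = 0) (hβ₃ : β₃ = 0) : PencilShape
      (α₀ • x ^ 3 + α₁ • (x ^ 2 * y) + α₂ • (x * y ^ 2) + α₃ • y ^ 3)
      (β₀ • x ^ 3 + β₁ • (x ^ 2 * z) + β₂ • (x * z ^ 2) + β₃ • z ^ 3) := by
    have hα₁ : α₁ ≠ 0 := fun h => one_ne_zero (hu (a := 0) (b := 1)
      (by simp [h]) (by simp [hα₂]) (by simp [hα₃])).2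
    have hβ₁ : β₁ ≠ 0 := fun h => hβ ⟨h, hβ₂, hβ₃⟩
    refine .inr ⟨x, α₀ • x + α₁ • y, β₀ • x + β₁ • z, hx, hx.linear_comb hy _ _,
      hx.linear_comb hz _ _, ?_, ?_, ?_⟩
    · rw [Fintype.linearIndependent_iff] at hli ⊢
      intro k hk
      have := hli ![k 2 * β₁, k 0 + k 1 * α₀ + k 2 * β₀, k 1 * α₁] (by
        rw [← hk]
        simp only [Fin.sum_univ_three, Matrix.cons_val_zero, Matrix.cons_val_one, Matrix.cons_val]
        module)
      simp only [Fin.forall_fin_succ, Matrix.cons_val_zero, Matrix.cons_val_succ,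
        IsEmpty.forall_iff, and_true, mul_eq_zero, hα₁, hβ₁, or_false] at this ⊢
      obtain ⟨k₂, k₀, k₁⟩ := this
      refine ⟨by simpa [k₁, k₂] using k₀, k₁, k₂⟩
    · simp only [hα₂, hα₃, smul_eq_C_mul, map_zero]; ring
    · simp only [hβ₂, hβ₃, smul_eq_C_mul, map_zero]; ring
  have degenerate {b c : K} (hne : b ≠ 0 ∨ c ≠ 0) (h₁ : b * α₁ + c * β₁ = 0) (h₂ : b * α₂ = 0)
      (h₃ : b * α₃ = 0) (h₄ : c * β₂ = 0) (h₅ : c * β₃ = 0) :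
      α₂ = 0 ∧ α₃ = 0 ∧ β₂ = 0 ∧ β₃ = 0 := by
    have hb : b ≠ 0 := by
      rintro rfl
      have hc : c ≠ 0 := by simpa using hne
      simp only [zero_mul, zero_add, mul_eq_zero, hc, false_or] at h₁ h₄ h₅
      exact hβ ⟨h₁, h₄, h₅⟩
    have hc : c ≠ 0 := by
      rintro rfl
      exact hb (hu (a := 0) (b := b) (by linear_combination h₁) (by linear_combination h₂)
        (by linear_combination 3 * h₃)).2
    simp only [mul_eq_zero, hb, hc, false_or] at h₂ h₃ h₄ h₅
    exact ⟨h₂, h₃, h₄, h₅⟩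
  by_cases ha : a = 0
  · subst ha
    obtain ⟨e₂, e₃, e₄, e₅⟩ := degenerate (b := b) (c := c) (by simpa using hne)
      (by linear_combination h₁) (by linear_combination h₂) (by linear_combination h₃ / 3)
      (by linear_combination h₄) (by linear_combination h₅ / 3)
    exact shape e₂ e₃ e₄ e₅
  by_cases ha' : a' = 0
  · subst ha'
    obtain ⟨e₂, e₃, e₄, e₅⟩ := degenerate (b := b') (c := -c') (by simpa using hne')
      (by linear_combination h₁') (by linear_combination h₂') (by linear_combination h₃' / 3)
      (by linear_combination h₄') (by linear_combination h₅' / 3)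
    exact shape e₂ e₃ e₄ e₅
  exfalso
  obtain ⟨m, rfl⟩ : ∃ m, b = a * m := ⟨b / a, by field_simp⟩
  obtain ⟨l, rfl⟩ : ∃ l, c = a * l := ⟨c / a, by field_simp⟩
  obtain ⟨m', rfl⟩ : ∃ m, b' = a' * m := ⟨b' / a', by field_simp⟩
  obtain ⟨l', rfl⟩ : ∃ l, c' = a' * l := ⟨c' / a', by field_simp⟩
  have d₁ : 3 * α₀ + m * α₁ + (3 * β₀ + l * β₁) = 0 :=
    mul_left_cancel₀ ha (by linear_combination h₁)
  have d₂ : α₁ + m * α₂ = 0 := mul_left_cancel₀ ha (by linear_combination h₂)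
  have d₃ : α₂ + 3 * m * α₃ = 0 := mul_left_cancel₀ ha (by linear_combination h₃)
  have d₄ : β₁ + l * β₂ = 0 := mul_left_cancel₀ ha (by linear_combination h₄)
  have d₅ : β₂ + 3 * l * β₃ = 0 := mul_left_cancel₀ ha (by linear_combination h₅)
  have d₁' : 3 * α₀ + m' * α₁ - (3 * β₀ + l' * β₁) = 0 :=
    mul_left_cancel₀ ha' (by linear_combination h₁')
  have d₂' : α₁ + m' * α₂ = 0 := mul_left_cancel₀ ha' (by linear_combination h₂')
  have d₃' : α₂ + 3 * m' * α₃ = 0 := mul_left_cancel₀ ha' (by linear_combination h₃')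
  have d₄' : β₁ + l' * β₂ = 0 := mul_left_cancel₀ ha' (by linear_combination -h₄')
  have d₅' : β₂ + 3 * l' * β₃ = 0 := mul_left_cancel₀ ha' (by linear_combination -h₅')
  have hm : m = m' := by
    by_contra hm
    have hm := sub_ne_zero.2 hm
    have e₂ : α₂ = 0 := mul_left_cancel₀ hm (by linear_combination d₂ - d₂')
    have e₃ : α₃ = 0 := mul_left_cancel₀ hm (by linear_combination (d₃ - d₃') / 3)
    have e₁ : α₁ = 0 := by linear_combination d₂ - m * e₂
    exact one_ne_zero (hu (a := 0) (b := 1) (by simp [e₁]) (by simp [e₂]) (by simp [e₃])).2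
  have hl : l = l' := by
    by_contra hl
    have hl := sub_ne_zero.2 hl
    have e₂ : β₂ = 0 := mul_left_cancel₀ hl (by linear_combination d₄ - d₄')
    have e₃ : β₃ = 0 := mul_left_cancel₀ hl (by linear_combination (d₅ - d₅') / 3)
    exact hβ ⟨by linear_combination d₄ - l * e₂, e₂, e₃⟩
  subst hm hl
  exact one_ne_zero (hu (a := 1) (b := m) (by linear_combination (d₁ + d₁') / 2)
    (by linear_combination d₂) (by linear_combination d₃)).1

theorem eq_zero_of_disjoint_forms [CharZero K] {x y z w f g : MvPolynomial (Fin n) K}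
    (hx : IsHomogeneous x 1) (hy : IsHomogeneous y 1) (hz : IsHomogeneous z 1)
    (hw : IsHomogeneous w 1) (hli : LinearIndependent K ![w, z, x, y])
    (hf : f ∈ binaryCubics x y) (hg : g ∈ binaryCubics z w) (hfu : ¬ IsUnaryCubic f)
    (hadd : IsBinaryCubic (f + g)) : g = 0 := by
  obtain ⟨α₀, α₁, α₂, α₃, rfl⟩ := mem_binaryCubics.1 hf
  obtain ⟨β₀, β₁, β₂, β₃, rfl⟩ := mem_binaryCubics.1 hg
  have hhom : ∀ i, IsHomogeneous (![w, z, x, y] i) 1 := by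
    intro i; fin_cases i <;> simpa
  obtain ⟨u, hu⟩ := exists_eval_eq hhom hli ![0, 0, 1, 0]
  obtain ⟨v, hv⟩ := exists_eval_eq hhom hli ![0, 0, 0, 1]
  have key (s t : K) : β₀ * s ^ 3 + β₁ * (s ^ 2 * t) + β₂ * (s * t ^ 2) + β₃ * t ^ 3 = 0 := by
    obtain ⟨e, he⟩ := exists_eval_eq hhom hli ![t, s, 0, 0]
    simp only [Fin.forall_fin_succ, Matrix.cons_val_zero, Matrix.cons_val_succ,
      IsEmpty.forall_iff, and_true] at hu hv he
    obtain ⟨a, b, c, hne, h₁, h₂, h₃, -, h₅⟩ := hadd.exists_direction u v e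
      (α₀ := α₀) (α₁ := α₁) (α₂ := α₂) (α₃ := α₃) (β₀ := 0) (β₁ := 0) (β₂ := 0)
      (β₃ := β₀ * s ^ 3 + β₁ * (s ^ 2 * t) + β₂ * (s * t ^ 2) + β₃ * t ^ 3)
      (fun p q r => by
        simp only [map_add, map_mul, map_pow, smul_eval, hx.eval_comb,
          hy.eval_comb, hz.eval_comb, hw.eval_comb,
          hu, hv, he]
        ring)
    have hab : ¬ (a ≠ 0 ∨ b ≠ 0) := fun hab => hfu (isUnaryCubic_of_direction hx hy hab
      (by linear_combination h₁) h₂ h₃)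
    push Not at hab
    obtain ⟨rfl, rfl⟩ := hab
    have hc : c ≠ 0 := by simpa using hne
    exact mul_left_cancel₀ hc (by linear_combination h₅ / 3)
  have e₀ : β₀ = 0 := by linear_combination key 1 0
  have e₃ : β₃ = 0 := by linear_combination key 0 1
  have e₂ : β₂ = 0 := by linear_combination (key 1 1 - key (-1) 1) / 2 - e₀
  have e₁ : β₁ = 0 := by linear_combination (key 1 1 + key (-1) 1) / 2 - e₃
  simp [e₀, e₁, e₂, e₃]

theorem pencilShape_of_notMem_span [CharZero K] {x y z w f g : MvPolynomial (Fin n) K}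
    (hx : IsHomogeneous x 1) (hy : IsHomogeneous y 1) (hz : IsHomogeneous z 1)
    (hw : IsHomogeneous w 1) (hzmem : z ∉ Submodule.span K {x, y})
    (hf : f ∈ binaryCubics x y) (hg : g ∈ binaryCubics z w) (hfu : ¬ IsUnaryCubic f)
    (hadd : IsBinaryCubic (f + g)) (hsub : IsBinaryCubic (f - g)) : PencilShape f g := by
  have hxy := linearIndependent_of_not_isUnaryCubic hx hy hf hfu
  have hli : LinearIndependent K ![z, x, y] :=
    linearIndependent_finCons.2 ⟨hxy, by simpa [Set.pair_comm] using hzmem⟩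
  by_cases hwmem : w ∈ Submodule.span K {z, x, y}
  · obtain ⟨c, t, ht, rfl⟩ := Submodule.mem_span_insert.1 hwmem
    obtain ⟨a, b, rfl⟩ := Submodule.mem_span_pair.1 ht
    have hg' : g ∈ binaryCubics (a • x + b • y) z := by
      refine binaryCubics_le ?_ ?_ hg
      · exact Submodule.subset_span (by simp)
      · exact Submodule.mem_span_pair.2 ⟨1, c, by module⟩
    by_cases ha : a = 0
    · refine pencilShape_of_common_form hy hx hz ?_ (binaryCubics_le ?_ ?_ hf)
        (binaryCubics_le ?_ ?_ hg') hfu hadd hsub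
      · refine linearIndependent_finCons.2 ⟨?_, ?_⟩
        · exact LinearIndependent.pair_symm_iff.1 hxy
        · simpa using hzmem
      · exact Submodule.subset_span (by simp)
      · exact Submodule.subset_span (by simp)
      · exact Submodule.mem_span_pair.2 ⟨b, 0, by simp [ha]⟩
      · exact Submodule.subset_span (by simp)
    · have hxmem : x ∈ Submodule.span K {a • x + b • y, y} :=
        Submodule.mem_span_pair.2 ⟨a⁻¹, -(a⁻¹ * b), by
          rw [smul_add, smul_smul, inv_mul_cancel₀ ha]; module⟩
      refine pencilShape_of_common_form (hx.linear_comb hy a b) hy hz ?_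
        (binaryCubics_le hxmem (Submodule.subset_span (by simp)) hf) hg' hfu hadd hsub
      rw [Fintype.linearIndependent_iff] at hli ⊢
      intro k hk
      have := hli ![k 0, k 1 * a, k 1 * b + k 2] (by
        rw [← hk]
        simp only [Fin.sum_univ_three, Matrix.cons_val_zero, Matrix.cons_val_one, Matrix.cons_val]
        module)
      simp only [Fin.forall_fin_succ, Matrix.cons_val_zero, Matrix.cons_val_succ,
        IsEmpty.forall_iff, and_true, mul_eq_zero, ha, or_false] at this ⊢
      obtain ⟨k₀, k₁, k₂⟩ := this
      exact ⟨k₀, k₁, by simpa [k₁] using k₂⟩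
  · have hli' : LinearIndependent K ![w, z, x, y] :=
      linearIndependent_finCons.2 ⟨hli, by
        rw [Matrix.range_cons, Matrix.range_cons, Matrix.range_cons, Matrix.range_empty]
        simpa only [Set.union_empty, Set.singleton_union] using hwmem⟩
    have hg0 := eq_zero_of_disjoint_forms hx hy hz hw hli' hf hg hfu hadd
    exact .inl ⟨x, y, hx, hy, hf, hg0 ▸ Submodule.zero_mem _⟩

theorem pencilShape_of_not_isUnaryCubic [CharZero K] {f g : MvPolynomial (Fin n) K}
    (hf : IsBinaryCubic f) (hg : IsBinaryCubic g) (hfu : ¬ IsUnaryCubic f)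
    (hadd : IsBinaryCubic (f + g)) (hsub : IsBinaryCubic (f - g)) : PencilShape f g := by
  obtain ⟨x, y, hx, hy, hf⟩ := hf
  obtain ⟨z, w, hz, hw, hg⟩ := hg
  by_cases hzmem : z ∈ Submodule.span K {x, y}
  · by_cases hwmem : w ∈ Submodule.span K {x, y}
    · exact .inl ⟨x, y, hx, hy, hf, binaryCubics_le hzmem hwmem hg⟩
    · refine pencilShape_of_notMem_span hx hy hw hz hwmem hf ?_ hfu hadd hsub
      exact binaryCubics_le (Submodule.subset_span (by simp)) (Submodule.subset_span (by simp)) hg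
  · exact pencilShape_of_notMem_span hx hy hz hw hzmem hf hg hfu hadd hsub

end BinaryCubics

theorem Submodule.exists_eq_span_pair_of_finrank_eq_two {K V : Type*} [Field K] [AddCommGroup V]
    [Module K V] {W : Submodule K V} (hW : Module.finrank K W = 2) {f : V} (hf : f ∈ W)
    (hf0 : f ≠ 0) : ∃ g ∈ W, W = Submodule.span K {f, g} := by
  have : FiniteDimensional K W := Module.finite_of_finrank_pos (by omega)
  obtain ⟨g, hg, hgf⟩ : ∃ g ∈ W, g ∉ Submodule.span K {f} := by
    by_contra! h
    have h₁ := Submodule.finrank_mono (show W ≤ Submodule.span K {f} from h)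
    have h₂ := finrank_span_singleton (K := K) hf0
    omega
  refine ⟨g, hg, (Submodule.eq_of_le_of_finrank_eq ?_ ?_).symm⟩
  · simp [Submodule.span_le, Set.insert_subset_iff, hf, hg]
  · have hli : LinearIndependent K ![g, f] :=
      linearIndependent_finCons.2 ⟨by simpa using hf0, by simpa using hgf⟩
    have := finrank_span_eq_card hli
    rw [Matrix.range_cons, Matrix.range_cons, Matrix.range_empty, Set.union_empty,
      Set.singleton_union, Set.pair_comm] at this
    rw [this, hW, Fintype.card_fin]

/-- **Lemma 2.7 (annoying_cubics).** A pencil of cubics, each a binary cubic in some pair of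
linear forms, either consists of cubics in one fixed pair of variables, or equals
`⟨x²y, x²z⟩`. -/
theorem stmt3 {K : Type*} [Field K] [CharZero K] [IsAlgClosed K] {n : ℕ} (hn : 3 ≤ n)
    (W : Submodule K (MvPolynomial (Fin n) K))
    (hdim : Module.finrank K W = 2)
    (hhom : ∀ f ∈ W, MvPolynomial.IsHomogeneous f 3)
    (hpencil : ∀ f ∈ W, ∃ x y : MvPolynomial (Fin n) K,
      MvPolynomial.IsHomogeneous x 1 ∧ MvPolynomial.IsHomogeneous y 1 ∧
      f ∈ Submodule.span K {x ^ 3, x ^ 2 * y, x * y ^ 2, y ^ 3}) :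
    (∃ x y : MvPolynomial (Fin n) K,
      MvPolynomial.IsHomogeneous x 1 ∧ MvPolynomial.IsHomogeneous y 1 ∧
      ∀ f ∈ W, f ∈ Submodule.span K {x ^ 3, x ^ 2 * y, x * y ^ 2, y ^ 3}) ∨
    (∃ x y z : MvPolynomial (Fin n) K,
      MvPolynomial.IsHomogeneous x 1 ∧ MvPolynomial.IsHomogeneous y 1 ∧
      MvPolynomial.IsHomogeneous z 1 ∧ LinearIndependent K ![x, y, z] ∧
      W = Submodule.span K {x ^ 2 * y, x ^ 2 * z}) := by
  have le_binaryCubics {f g x y : MvPolynomial (Fin n) K}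
      (hW : W = Submodule.span K {f, g}) (hf : f ∈ binaryCubics x y)
      (hg : g ∈ binaryCubics x y) : W ≤ binaryCubics x y := by
    rw [hW, Submodule.span_le]
    simp only [Set.insert_subset_iff, Set.singleton_subset_iff]
    exact ⟨hf, hg⟩
  by_cases hu : ∀ f ∈ W, IsUnaryCubic f
  · have hW0 : W ≠ ⊥ := by
      rintro rfl
      simp at hdim
    obtain ⟨f, hf, hf0⟩ := W.exists_mem_ne_zero_of_ne_bot hW0
    obtain ⟨g, hg, hW⟩ := Submodule.exists_eq_span_pair_of_finrank_eq_two hdim hf hf0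
    obtain ⟨c, x, hx, hfx⟩ := hu f hf
    obtain ⟨d, y, hy, hgy⟩ := hu g hg
    exact .inl ⟨x, y, hx, hy, le_binaryCubics hW
      (mem_binaryCubics.2 ⟨c, 0, 0, 0, by simp [hfx]⟩)
      (mem_binaryCubics.2 ⟨0, 0, 0, d, by simp [hgy]⟩)⟩
  · push Not at hu
    obtain ⟨f, hf, hfu⟩ := hu
    have hf0 : f ≠ 0 := fun h => hfu ⟨0, 0, isHomogeneous_zero _ _ _, by simp [h]⟩
    obtain ⟨g, hg, hW⟩ := Submodule.exists_eq_span_pair_of_finrank_eq_two hdim hf hf0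
    rcases pencilShape_of_not_isUnaryCubic (hpencil f hf) (hpencil g hg) hfu
      (hpencil _ (W.add_mem hf hg)) (hpencil _ (W.sub_mem hf hg)) with
      ⟨x, y, hx, hy, hfm, hgm⟩ | ⟨x, y, z, hx, hy, hz, hli, rfl, rfl⟩
    · exact .inl ⟨x, y, hx, hy, le_binaryCubics hW hfm hgm⟩
    · exact .inr ⟨x, y, z, hx, hy, hz, hli, hW⟩
end

section
/- Let K be an algebraically closed field of characteristic 0. Let B_1,…,B_4 be 4×4 matrices over K and c_1,…,c_4 ∈ K^4 such that c_1,…,c_4 are linearly independent and the images of B_1,…,B_4 together span K^4 (the B_i have trivial common cokernel). For i = 1,…,4 let A_i be the 9×9 block matrix, with rows and columns partitioned into blocks of sizes 4, 4, 1, whose only possibly nonzero blocks are the (1,2) block B_i and the (2,3) block c_i. Assume A_1, A_2, A_3, A_4 pairwise commute. Then (A_1,…,A_4) lies in the Zariski closure of the set of simultaneously diagonalizable quadruples of 9×9 matrices: every polynomial over K in the 4·81 matrix entries that vanishes at every simultaneously diagonalizable quadruple of 9×9 matrices also vanishes at (A_1,…,A_4). (This is the matrix form of: every local algebra with Hilbert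 function (1,4,4) is smoothable.) -/
open Matrix

/-- A tuple of square matrices is simultaneously diagonalizable. -/
def SimDiag {K : Type*} [Field K] {N ι : Type*} [Fintype ι] [DecidableEq ι]
    (A : N → Matrix ι ι K) : Prop :=
  ∃ P : Matrix ι ι K, IsUnit P ∧ ∀ i, (P⁻¹ * A i * P).IsDiag

/-- A tuple of square matrices lies in the Zariski closure of the set of simultaneously
diagonalizable tuples (the principal component): every polynomial in the matrix entries
vanishing on all simultaneously diagonalizable tuples vanishes at the given tuple. -/
def InSimDiagClosure {K : Type*} [Field K] {N ι : Type*} [Fintype ι] [DecidableEq ι]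
    (A : N → Matrix ι ι K) : Prop :=
  ∀ Φ : MvPolynomial (N × ι × ι) K,
    (∀ B : N → Matrix ι ι K, SimDiag B →
      MvPolynomial.eval (fun x => B x.1 x.2.1 x.2.2) Φ = 0) →
    MvPolynomial.eval (fun x => A x.1 x.2.1 x.2.2) Φ = 0

/-- The 9×9 block matrix with blocks of sizes 4, 4, 1, whose only nonzero blocks are the
(1,2) block `B` and the (2,3) block `c`. -/
def blockMat144 {K : Type*} [Field K] (B : Matrix (Fin 4) (Fin 4) K) (c : Fin 4 → K) :
    Matrix (Fin 4 ⊕ (Fin 4 ⊕ Fin 1)) (Fin 4 ⊕ (Fin 4 ⊕ Fin 1)) K :=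
  Matrix.of fun p q =>
    match p, q with
    | Sum.inl a, Sum.inr (Sum.inl b) => B a b
    | Sum.inr (Sum.inl a), Sum.inr (Sum.inr _) => c a
    | _, _ => 0

namespace MvPolynomial

variable {K σ τ : Type*}

lemma pderiv_bind₁ [CommRing K] [Fintype σ] (Ψ : σ → MvPolynomial τ K) (F : MvPolynomial σ K)
    (i : τ) :
    pderiv i (bind₁ Ψ F) = ∑ j, bind₁ Ψ (pderiv j F) * pderiv i (Ψ j) := by
  classical
  induction F using MvPolynomial.induction_on with
  | C a => simp
  | add p q hp hq => simp [hp, hq, add_mul, Finset.sum_add_distrib]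
  | mul_X p j hp =>
    simp only [map_mul, bind₁_X_right, pderiv_mul, hp, map_add, add_mul, Finset.sum_add_distrib,
      Finset.sum_mul, pderiv_X]
    congr 1
    · exact Finset.sum_congr rfl fun x _ => by ring
    · rw [Finset.sum_eq_single j] <;> simp +contextual

lemma totalDegree_pderiv_lt_of_ne_zero [CommRing K] {F : MvPolynomial σ K} {j : σ}
    (h : pderiv j F ≠ 0) : (pderiv j F).totalDegree < F.totalDegree := by
  classical
  obtain ⟨m₀, hm₀⟩ := support_nonempty.2 h
  have hlt : ∀ m ∈ (pderiv j F).support, (m.sum fun _ e => e) < F.totalDegree := fun m hm => by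
    rw [mem_support_iff, coeff_pderiv] at hm
    have := le_totalDegree (mem_support_iff.2 (left_ne_zero_of_mul hm))
    rw [Finsupp.sum_add_index' (by simp) (by simp), Finsupp.sum_single_index rfl] at this
    omega
  exact (Finset.sup_lt_iff ((Nat.zero_le _).trans_lt (hlt m₀ hm₀))).2 hlt

lemma eq_C_of_forall_pderiv_eq_zero [Field K] [CharZero K] {F : MvPolynomial σ K}
    (h : ∀ j, pderiv j F = 0) : F = C (coeff 0 F) := by
  classical
  ext m
  rw [coeff_C]
  split_ifs with hm
  · rw [hm]
  · obtain ⟨j, hj⟩ := Finsupp.ne_iff.1 (Ne.symm hm)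
    have hle : Finsupp.single j 1 ≤ m := by
      rw [Finsupp.single_le_iff]
      exact Nat.one_le_iff_ne_zero.2 hj
    have := congrArg (coeff (m - Finsupp.single j 1)) (h j)
    rw [coeff_pderiv, tsub_add_cancel_of_le hle, coeff_zero] at this
    exact (mul_eq_zero.1 this).resolve_right (Nat.cast_add_one_ne_zero _)

/-- Jacobian criterion: if the differential of the polynomial map `Ψ` is onto at some point, then
`Ψ` is dominant. -/
theorem eq_zero_of_bind₁_eq_zero [Field K] [CharZero K] [Fintype σ] [Fintype τ]
    (Ψ : σ → MvPolynomial τ K) (x₀ : τ → K)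
    (hx₀ : ∀ v : σ → K, (∀ i, ∑ j, v j * eval x₀ (pderiv i (Ψ j)) = 0) → v = 0)
    (F : MvPolynomial σ K) (hF : bind₁ Ψ F = 0) : F = 0 := by
  classical
  let J : Matrix τ σ (MvPolynomial τ K) := Matrix.of fun i j => pderiv i (Ψ j)
  obtain ⟨f, hf⟩ := LinearMap.exists_leftInverse_of_injective
    (Matrix.toLin' (J.map (eval x₀))) <| LinearMap.ker_eq_bot'.2 fun v hv => hx₀ v fun i => by
      have := congrFun hv i
      rw [Matrix.toLin'_apply, Pi.zero_apply] at this
      rw [← this]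
      simp [J, Matrix.mulVec, dotProduct, mul_comm]
  have hR : LinearMap.toMatrix' f * J.map (eval x₀) = 1 := by
    rw [← LinearMap.toMatrix'_toLin' (J.map (eval x₀)), ← LinearMap.toMatrix'_comp, hf,
      LinearMap.toMatrix'_id]
  let R : Matrix σ τ (MvPolynomial τ K) := (LinearMap.toMatrix' f).map C
  have hdet : (R * J).det ≠ 0 := by
    intro h
    have h' := congrArg (eval x₀) h
    rw [RingHom.map_det, RingHom.mapMatrix_apply, Matrix.map_mul] at h'
    have : R.map (eval x₀) = LinearMap.toMatrix' f := by
      ext; simp [R]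
    rw [this, hR] at h'
    simp at h'
  induction hn : F.totalDegree using Nat.strong_induction_on generalizing F with
  | _ n ih =>
    have hgrad : (fun j => bind₁ Ψ (pderiv j F)) = 0 := by
      refine Matrix.eq_zero_of_mulVec_eq_zero hdet ?_
      have hJ : J.mulVec (fun j => bind₁ Ψ (pderiv j F)) = 0 := by
        ext1 i
        rw [Pi.zero_apply, ← map_zero (pderiv i), ← hF, pderiv_bind₁]
        simp [J, Matrix.mulVec, dotProduct, mul_comm]
      rw [← Matrix.mulVec_mulVec, hJ, Matrix.mulVec_zero]
    have hpd : ∀ j, pderiv j F = 0 := fun j => by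
      by_contra hj
      exact hj (ih _ (hn ▸ totalDegree_pderiv_lt_of_ne_zero hj) _ (congrFun hgrad j) rfl)
    have hC := eq_C_of_forall_pderiv_eq_zero hpd
    rw [hC, bind₁_C_right, C_eq_zero] at hF
    rw [hC, hF, C_0]

end MvPolynomial

section Closure

variable {K N ι : Type*} [Field K] [Fintype ι] [DecidableEq ι]

lemma SimDiag.inSimDiagClosure {A : N → Matrix ι ι K} (hA : SimDiag A) : InSimDiagClosure A :=
  fun _ hΦ => hΦ A hA

lemma simDiag_of_conj_diagonal {P P' : Matrix ι ι K} (hP : P * P' = 1) (d : N → ι → K) :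
    SimDiag fun j => P * diagonal (d j) * P' := by
  have hP' : P' * P = 1 := mul_eq_one_comm.1 hP
  refine ⟨P, ⟨⟨P, P', hP, hP'⟩, rfl⟩, fun j => ?_⟩
  rw [Matrix.inv_eq_right_inv hP, ← mul_assoc, ← mul_assoc, hP', one_mul, mul_assoc, hP', mul_one]
  exact isDiag_diagonal _

lemma inSimDiagClosure_of_polynomial [Infinite K] (A : N → Matrix ι ι (Polynomial K))
    {d : Polynomial K} (hd : d ≠ 0)
    (h : ∀ t, d.eval t ≠ 0 → InSimDiagClosure fun j => (A j).map (Polynomial.eval t)) (t₀ : K) :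
    InSimDiagClosure fun j => (A j).map (Polynomial.eval t₀) := by
  intro Φ hΦ
  let p : Polynomial K := MvPolynomial.aeval (fun x : N × ι × ι => A x.1 x.2.1 x.2.2) Φ
  have hp : ∀ t, p.eval t = MvPolynomial.eval
      (fun x : N × ι × ι => (A x.1).map (Polynomial.eval t) x.2.1 x.2.2) Φ := fun t => by
    have := MvPolynomial.map_aeval (fun x : N × ι × ι => A x.1 x.2.1 x.2.2)
      (Polynomial.evalRingHom t) Φ
    rw [Polynomial.coe_evalRingHom] at this
    rw [this]
    exact MvPolynomial.eval₂Hom_congr (by ext; simp) rfl rfl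
  have hpd : p * d = 0 := Polynomial.funext fun t => by
    by_cases ht : d.eval t = 0
    · simp [ht]
    · rw [Polynomial.eval_mul, hp t, h t ht Φ hΦ, zero_mul, Polynomial.eval_zero]
  rw [← hp, (mul_eq_zero.1 hpd).resolve_right hd, Polynomial.eval_zero]

end Closure

section Degeneration

variable {K N : Type*} [Field K]

/-- The grading of the basis for which the blocks of `blockMat144` have degree one. -/
def blockWeight : Fin 4 ⊕ (Fin 4 ⊕ Fin 1) → ℕ
  | Sum.inl _ => 2
  | Sum.inr (Sum.inl _) => 1
  | Sum.inr (Sum.inr _) => 0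

/-- Rescaling the basis degenerates a diagonalizable tuple with vanishing (1,3) blocks to its
part of degree one. -/
lemma inSimDiagClosure_blockMat144_of_conj_diagonal [Infinite K]
    {P P' : Matrix (Fin 4 ⊕ (Fin 4 ⊕ Fin 1)) (Fin 4 ⊕ (Fin 4 ⊕ Fin 1)) K} (hP : P * P' = 1)
    (d : N → Fin 4 ⊕ (Fin 4 ⊕ Fin 1) → K) (B : N → Matrix (Fin 4) (Fin 4) K)
    (c : N → Fin 4 → K)
    (h₁₂ : ∀ j a b, (P * diagonal (d j) * P') (Sum.inl a) (Sum.inr (Sum.inl b)) = B j a b)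
    (h₁₃ : ∀ j a b, (P * diagonal (d j) * P') (Sum.inl a) (Sum.inr (Sum.inr b)) = 0)
    (h₂₃ : ∀ j a b, (P * diagonal (d j) * P') (Sum.inr (Sum.inl a)) (Sum.inr (Sum.inr b)) =
      c j a) :
    InSimDiagClosure fun j => blockMat144 (B j) (c j) := by
  let A : N → Matrix (Fin 4 ⊕ (Fin 4 ⊕ Fin 1)) (Fin 4 ⊕ (Fin 4 ⊕ Fin 1)) (Polynomial K) :=
    fun j => Matrix.of fun p q => Polynomial.C ((P * diagonal (d j) * P') p q) *
      Polynomial.X ^ (1 + blockWeight q - blockWeight p)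
  have key := inSimDiagClosure_of_polynomial A Polynomial.X_ne_zero (fun t ht => ?_) 0
  · convert key using 1
    funext j
    ext p q
    rcases p with a | a | a <;> rcases q with b | b | b <;>
      simp [A, blockMat144, blockWeight, h₁₂, h₁₃, h₂₃]
  · rw [Polynomial.eval_X] at ht
    apply SimDiag.inSimDiagClosure
    have hS : (diagonal (fun p => (t ^ blockWeight p)⁻¹) * P) *
        (P' * diagonal fun p => t ^ blockWeight p) = 1 := by
      rw [mul_assoc, ← mul_assoc P, hP, one_mul, diagonal_mul_diagonal]
      rw [← diagonal_one]
      congr 1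
      funext p
      exact inv_mul_cancel₀ (pow_ne_zero _ ht)
    convert simDiag_of_conj_diagonal hS fun j => t • d j using 1
    funext j
    have : diagonal (fun p => (t ^ blockWeight p)⁻¹) * P * diagonal (t • d j) *
        (P' * diagonal fun p => t ^ blockWeight p) =
        diagonal (fun p => (t ^ blockWeight p)⁻¹) * (t • (P * diagonal (d j) * P')) *
          diagonal fun p => t ^ blockWeight p := by
      simp only [diagonal_smul, Matrix.mul_smul, Matrix.smul_mul, Matrix.mul_assoc]
    rw [this]
    ext p q
    have h₀ := h₁₃ j
    simp only [A, mul_diagonal, diagonal_mul, Matrix.smul_apply, Matrix.map_apply, of_apply,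
      Polynomial.eval_mul, Polynomial.eval_C, Polynomial.eval_pow, Polynomial.eval_X, smul_eq_mul]
    generalize P * diagonal (d j) * P' = M at h₀ ⊢
    rcases p with a | a | a <;> rcases q with b | b | b <;> simp only [blockWeight, h₀] <;>
      field_simp <;> ring

end Degeneration

section QuadricTensor

/-- The `j`-th slice of the tensor `∑ l, g l ⊗ (h l ^ 2 - ∑ a, h l a • e a ^ 2) ∘ L` of quadrics:
the multiplication tensor of the leading forms of the ideal of the points `0`, `e a`, `h l`. -/
def quadricTensor {R : Type*} [CommRing R] (g L h : Matrix (Fin 4) (Fin 4) R) (j : Fin 4) :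
    Matrix (Fin 4) (Fin 4) R :=
  Matrix.of fun k m => ∑ l, g k l * ((∑ a, h l a * L a j) * (∑ a, h l a * L a m) -
    ∑ a, h l a * L a j * L a m)

lemma map_quadricTensor {R S : Type*} [CommRing R] [CommRing S] (f : R →+* S)
    (g L h : Matrix (Fin 4) (Fin 4) R) (j k m : Fin 4) :
    f (quadricTensor g L h j k m) = quadricTensor (g.map f) (L.map f) (h.map f) j k m := by
  simp [quadricTensor]

lemma quadricTensor_eq {R : Type*} [CommRing R] (g L h : Matrix (Fin 4) (Fin 4) R) (j : Fin 4) :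
    quadricTensor g L h j = g * (diagonal (fun l => (h * L) l j) * (h * L) -
      h * diagonal (fun a => L a j) * L) := by
  ext k m
  simp [quadricTensor, Matrix.mul_apply, diagonal_apply]

lemma fromCols_add_fromCols {R m n₁ n₂ : Type*} [Add R] (A₁ B₁ : Matrix m n₁ R)
    (A₂ B₂ : Matrix m n₂ R) :
    fromCols A₁ A₂ + fromCols B₁ B₂ = fromCols (A₁ + B₁) (A₂ + B₂) := by
  ext a (b | b) <;> rfl

variable {K : Type*} [Field K]

lemma inSimDiagClosure_quadricTensor_of_det_ne_zero [Infinite K]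
    (g L h c : Matrix (Fin 4) (Fin 4) K) (hg : g.det ≠ 0) (hL : L.det ≠ 0) (hc : c.det ≠ 0) :
    InSimDiagClosure fun j => blockMat144 (quadricTensor g L h j * c⁻¹) (fun a => c a j) := by
  have hg' := g.mul_nonsing_inv hg.isUnit
  have hL' := L.nonsing_inv_mul hL.isUnit
  have hc' := c.mul_nonsing_inv hc.isUnit
  let e : Matrix (Fin 4) (Fin 1) K := Matrix.of fun _ _ => 1
  let P : Matrix (Fin 4 ⊕ (Fin 4 ⊕ Fin 1)) (Fin 4 ⊕ (Fin 4 ⊕ Fin 1)) K :=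
    fromBlocks g (fromCols (-(g * h)) (g * (h * e) - g * e)) 0
      (fromBlocks (c * L⁻¹) (-(c * L⁻¹ * e)) 0 1)
  let P' : Matrix (Fin 4 ⊕ (Fin 4 ⊕ Fin 1)) (Fin 4 ⊕ (Fin 4 ⊕ Fin 1)) K :=
    fromBlocks g⁻¹ (fromCols (h * (L * c⁻¹)) e) 0 (fromBlocks (L * c⁻¹) e 0 1)
  let d : Fin 4 → Fin 4 ⊕ (Fin 4 ⊕ Fin 1) → K := fun j =>
    Sum.elim (fun l => (h * L) l j) (Sum.elim (fun a => L a j) 0)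
  have hcL : c * L⁻¹ * (L * c⁻¹) = 1 := by
    rw [mul_assoc, ← mul_assoc L⁻¹, hL', one_mul, hc']
  have hP : P * P' = 1 := by
    simp [P, P', fromBlocks_multiply, fromCols_mul_fromBlocks, mul_fromCols, hg', hcL,
      Matrix.mul_assoc, fromCols_add_fromCols]
    rw [show g * e + (-(g * (h * e)) + (g * (h * e) - g * e)) = 0 by abel]
    simp
  have hPd : ∀ j, P * diagonal (d j) * P' = fromBlocks (g * diagonal (fun l => (h * L) l j) * g⁻¹)
      (fromCols (quadricTensor g L h j * c⁻¹) 0) 0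
      (fromBlocks (c * L⁻¹ * diagonal (fun a => L a j) * (L * c⁻¹))
        (Matrix.of fun a _ => c a j) 0 0) := by
    intro j
    have hcol : ∀ M N : Matrix (Fin 4) (Fin 4) K, (M * Matrix.of fun a (_ : Fin 1) => N a j) =
        Matrix.of fun a _ => (M * N) a j := fun M N => by
      ext; simp [Matrix.mul_apply]
    have hLe : diagonal (fun a => L a j) * e = Matrix.of fun a _ => L a j := by
      ext; simp [e]
    have hhe : diagonal (fun l => (h * L) l j) * e = h * Matrix.of fun a _ => L a j := by
      ext; rw [diagonal_mul]; simp [e, hcol]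
    have hce : c * (L⁻¹ * Matrix.of fun a (_ : Fin 1) => L a j) = Matrix.of fun a _ => c a j := by
      rw [hcol, hL', hcol, Matrix.mul_one]
    have hd : diagonal (d j) = fromBlocks (diagonal fun l => (h * L) l j) 0 0
        (fromBlocks (diagonal fun a => L a j) 0 0 0) := by
      simp only [d, ← fromBlocks_diagonal]
      simp
    simp [P, P', hd, fromBlocks_multiply, fromCols_mul_fromBlocks, mul_fromCols, quadricTensor_eq,
      hLe, hhe, hce, Matrix.mul_assoc, fromCols_add_fromCols,
      Matrix.mul_add, Matrix.add_mul, sub_eq_add_neg]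
  refine inSimDiagClosure_blockMat144_of_conj_diagonal hP d _ _ (fun j a b => ?_)
    (fun j a b => ?_) fun j a b => ?_ <;> simp [hPd]

lemma inSimDiagClosure_quadricTensor [Infinite K]
    (g L h c : Matrix (Fin 4) (Fin 4) K) (hc : c.det ≠ 0) :
    InSimDiagClosure fun j => blockMat144 (quadricTensor g L h j * c⁻¹) (fun a => c a j) := by
  let A : Fin 4 → Matrix (Fin 4 ⊕ (Fin 4 ⊕ Fin 1)) (Fin 4 ⊕ (Fin 4 ⊕ Fin 1)) (Polynomial K) :=
    fun j => Matrix.of fun p q =>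
      match p, q with
      | Sum.inl a, Sum.inr (Sum.inl b) =>
        (quadricTensor (-g).charmatrix (-L).charmatrix (h.map Polynomial.C) j *
          c⁻¹.map Polynomial.C) a b
      | Sum.inr (Sum.inl a), Sum.inr (Sum.inr _) => Polynomial.C (c a j)
      | _, _ => 0
  have hmap : ∀ (M : Matrix (Fin 4) (Fin 4) K) t,
      (-M).charmatrix.map (Polynomial.evalRingHom t) = Matrix.scalar _ t + M := fun M t => by
    ext i j
    by_cases hij : i = j <;> simp [hij]
  have hA : ∀ t, (fun j => (A j).map (Polynomial.eval t)) = fun j =>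
      blockMat144 (quadricTensor (Matrix.scalar _ t + g) (Matrix.scalar _ t + L) h j * c⁻¹)
        (fun a => c a j) := fun t => by
    funext j
    ext p q
    rcases p with a | a | a <;> rcases q with b | b | b <;> simp [A, blockMat144]
    simp only [Matrix.mul_apply, Polynomial.eval_finsetSum, Polynomial.eval_mul,
      ← Polynomial.coe_evalRingHom, map_quadricTensor, hmap]
    simp [Matrix.map_map, Function.comp_def]
  have hdet : (-g).charpoly * (-L).charpoly ≠ 0 :=
    mul_ne_zero (charpoly_monic _).ne_zero (charpoly_monic _).ne_zero
  have := inSimDiagClosure_of_polynomial A hdet (fun t ht => ?_) 0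
  · simpa [hA] using this
  · rw [hA]
    rw [Polynomial.eval_mul, eval_charpoly, eval_charpoly, sub_neg_eq_add, sub_neg_eq_add] at ht
    exact inSimDiagClosure_quadricTensor_of_det_ne_zero _ _ _ _ (left_ne_zero_of_mul ht)
      (right_ne_zero_of_mul ht) hc

end QuadricTensor

section Dominance

open MvPolynomial

/-- Coordinates of the triples `(g, L, h)`, together with an antisymmetric correction. -/
abbrev TensorParam : Type :=
  Fin 4 × Fin 4 ⊕ Fin 4 × Fin 4 ⊕ Fin 4 × Fin 4 ⊕ Fin 4 × Fin 4 × Fin 4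

variable (K : Type*) [Field K]

/-- The generic tensor `quadricTensor g L h`, up to tensors antisymmetric in the last two
indices. -/
noncomputable def genericTensor (s : Fin 4 × Fin 4 × Fin 4) : MvPolynomial TensorParam K :=
  quadricTensor (Matrix.of fun i j => X (Sum.inl (i, j)))
    (Matrix.of fun i j => X (Sum.inr (Sum.inl (i, j))))
    (Matrix.of fun i j => X (Sum.inr (Sum.inr (Sum.inl (i, j))))) s.2.1 s.1 s.2.2 +
  (X (Sum.inr (Sum.inr (Sum.inr s))) - X (Sum.inr (Sum.inr (Sum.inr (s.1, s.2.2, s.2.1)))))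

/-- The point `g = L = 1`, `h l = e l + e (l + 1)`, at which `quadricTensor` consists of the
quadrics `2 e l e (l + 1)`. -/
def basePoint : TensorParam → K :=
  Sum.elim (fun p => if p.1 = p.2 then 1 else 0) <|
    Sum.elim (fun p => if p.1 = p.2 then 1 else 0) <|
      Sum.elim (fun p => (if p.2 = p.1 then 1 else 0) + if p.2 = p.1 + 1 then 1 else 0) 0

variable {K}

lemma eq_zero_of_orthogonal_genericTensor [CharZero K] (v : Fin 4 × Fin 4 × Fin 4 → K)
    (hv : ∀ i, ∑ s, v s * eval (basePoint K) (pderiv i (genericTensor K s)) = 0) : v = 0 := by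
  have hsymm : ∀ k i j, v (k, i, j) = v (k, j, i) := fun k i j => by
    have := hv (Sum.inr (Sum.inr (Sum.inr (k, i, j))))
    simp [genericTensor, quadricTensor, pderiv_X, Pi.single_apply, Fintype.sum_prod_type] at this
    simp only [ite_and, mul_sub, mul_ite, mul_one, mul_zero, Finset.sum_sub_distrib,
      Finset.sum_ite_irrel, Finset.sum_const_zero, Finset.sum_ite_eq', Finset.mem_univ,
      if_true] at this
    exact sub_eq_zero.1 this
  have hg : ∀ k l, v (k, l, l + 1) = 0 := fun k l => by
    have := hv (Sum.inl (k, l))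
    simp [genericTensor, quadricTensor, pderiv_X, Pi.single_apply, Fintype.sum_prod_type,
      basePoint, apply_ite (eval _)] at this
    simp only [ite_and, mul_add, mul_sub, mul_ite, mul_one, mul_zero, Finset.sum_add_distrib,
      Finset.sum_sub_distrib, Finset.sum_ite_irrel, Finset.sum_const_zero, Finset.sum_ite_eq',
      Finset.mem_univ, if_true] at this
    linear_combination (1 / 2) * this - (1 / 2) * hsymm k (l + 1) l
  have hh : ∀ k m, 2 * (v (k, m, k) + v (k, m, k + 1)) = v (k, m, m) := fun k m => by
    have := hv (Sum.inr (Sum.inr (Sum.inl (k, m))))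
    simp [genericTensor, quadricTensor, pderiv_X, Pi.single_apply, Fintype.sum_prod_type,
      basePoint, apply_ite (eval _)] at this
    simp only [ite_and, mul_add, mul_sub, mul_ite, mul_one, mul_zero, Finset.sum_add_distrib,
      Finset.sum_sub_distrib, Finset.sum_ite_irrel, Finset.sum_const_zero, Finset.sum_ite_eq,
      Finset.sum_ite_eq', Finset.mem_univ, if_true] at this
    linear_combination this + hsymm k m k + hsymm k m (k + 1)
  have hL : ∀ a b, v (a + 1, b, a + 2) + v (a, b, a) = 0 := fun a b => by
    have := hv (Sum.inr (Sum.inl (a + 1, b)))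
    simp [genericTensor, quadricTensor, pderiv_X, Pi.single_apply, Fintype.sum_prod_type,
      basePoint, apply_ite (eval _)] at this
    simp only [ite_and, mul_add, mul_sub, mul_ite, mul_one, mul_zero, Finset.sum_add_distrib,
      Finset.sum_sub_distrib, Finset.sum_ite_irrel, Finset.sum_const_zero, Finset.sum_ite_eq,
      Finset.sum_ite_eq', Finset.mem_univ, if_true, add_left_inj, add_assoc,
      show (1 + 1 : Fin 4) = 2 from rfl] at this
    linear_combination (1 / 2) * this + (1 / 2) * hsymm (a + 1) b (a + 2) + (1 / 2) * hsymm a b a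
  have e₂ : ∀ k : Fin 4, k + 1 + 1 = k + 2 := by decide
  have e₃ : ∀ k : Fin 4, k + 2 + 1 = k + 3 := by decide
  have e₄ : ∀ k : Fin 4, k + 3 + 1 = k := by decide
  have e₅ : ∀ k : Fin 4, k + 3 + 2 = k + 1 := by decide
  have h₀₀ : ∀ k, v (k, k, k) = 0 := fun k => by
    linear_combination hh k k - 2 * hg k k
  have h₁₁ : ∀ k, v (k, k + 1, k + 1) = 0 := fun k => by
    linear_combination hh k (k + 1) - 2 * hsymm k (k + 1) k - 2 * hg k k
  have h₁₂ : ∀ k, v (k, k + 1, k + 2) = 0 := fun k => e₂ k ▸ hg k (k + 1)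
  have h₂₃ : ∀ k, v (k, k + 2, k + 3) = 0 := fun k => e₃ k ▸ hg k (k + 2)
  have h₃₀ : ∀ k, v (k, k + 3, k) = 0 := fun k => by simpa only [e₄] using hg k (k + 3)
  have h₂₀ : ∀ k, v (k, k + 2, k) = 0 := fun k => by
    have := h₁₁ (k + 1)
    rw [e₂] at this
    linear_combination hL k (k + 2) - this
  have h₃₁ : ∀ k, v (k, k + 3, k + 1) = 0 := fun k => by
    have := hL (k + 3) (k + 3)
    rw [e₄, e₅] at this
    linear_combination this - h₀₀ (k + 3)
  have h₂₂ : ∀ k, v (k, k + 2, k + 2) = 0 := fun k => by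
    linear_combination -hh k (k + 2) + 2 * h₂₀ k + 2 * hsymm k (k + 2) (k + 1) + 2 * h₁₂ k
  have h₃₃ : ∀ k, v (k, k + 3, k + 3) = 0 := fun k => by
    linear_combination -hh k (k + 3) + 2 * h₃₀ k + 2 * h₃₁ k
  have hcases : ∀ k j : Fin 4, j = k ∨ j = k + 1 ∨ j = k + 2 ∨ j = k + 3 := by decide
  funext ⟨k, i, j⟩
  rw [Pi.zero_apply]
  rcases hcases k i with hi | hi | hi | hi <;> rcases hcases k j with hj | hj | hj | hj <;>
    rw [hi, hj] <;> first | solve_by_elim | (rw [hsymm]; solve_by_elim)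

end Dominance

section Main

open MvPolynomial

variable {K : Type*} [Field K]

lemma eval_bind₁ {σ τ : Type*} (x : τ → K) (f : σ → MvPolynomial τ K) (F : MvPolynomial σ K) :
    eval x (bind₁ f F) = eval (fun i => eval x (f i)) F :=
  eval₂Hom_bind₁ (RingHom.id K) x f F

lemma quadricTensor_comm {R : Type*} [CommRing R] (g L h : Matrix (Fin 4) (Fin 4) R)
    (j k m : Fin 4) : quadricTensor g L h j k m = quadricTensor g L h m k j := by
  simp only [quadricTensor, Matrix.of_apply]
  refine Finset.sum_congr rfl fun l _ => ?_
  rw [mul_comm (∑ a, h l a * L a j), Finset.sum_congr rfl fun a _ => mul_right_comm _ _ _]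

/-- The symmetrization of `genericTensor` takes the same values as `quadricTensor`. -/
lemma eval_genericTensor_add (x : TensorParam → K) (k i j : Fin 4) :
    eval x (genericTensor K (k, i, j)) + eval x (genericTensor K (k, j, i)) =
      quadricTensor (Matrix.of fun a b => 2 * x (Sum.inl (a, b)))
        (Matrix.of fun a b => x (Sum.inr (Sum.inl (a, b))))
        (Matrix.of fun a b => x (Sum.inr (Sum.inr (Sum.inl (a, b))))) i k j := by
  have htwo : ∀ g L h : Matrix (Fin 4) (Fin 4) K,
      quadricTensor (Matrix.of fun a b => 2 * g a b) L h i k j = 2 * quadricTensor g L h i k j :=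
    fun g L h => by simp [quadricTensor, Finset.mul_sum, mul_assoc]
  have hmap : ∀ g L h : Fin 4 → Fin 4 → MvPolynomial TensorParam K, ∀ i j,
      eval x (quadricTensor (Matrix.of g) (Matrix.of L) (Matrix.of h) i k j) =
        quadricTensor (Matrix.of fun a b => eval x (g a b)) (Matrix.of fun a b => eval x (L a b))
          (Matrix.of fun a b => eval x (h a b)) i k j := fun g L h i j =>
    map_quadricTensor (eval x) _ _ _ i k j
  simp only [genericTensor, map_add, map_sub, hmap, eval_X]
  rw [quadricTensor_comm _ _ _ j k i]
  exact Eq.trans (by ring) (htwo (Matrix.of fun a b => x (Sum.inl (a, b))) _ _).symm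

/-- Multiplication matrices whose quadrics are the symmetrization of an arbitrary tensor. -/
noncomputable def symmTensorMatrix (S : Fin 4 × Fin 4 × Fin 4 → K) (j : Fin 4) :
    Matrix (Fin 4) (Fin 4) K :=
  Matrix.of fun k m => S (k, j, m) + S (k, m, j)

/-- If the conclusion holds for the tensors `quadricTensor`, it holds for all symmetric ones. -/
lemma inSimDiagClosure_symmTensorMatrix [CharZero K] (c : Matrix (Fin 4) (Fin 4) K)
    (hc : c.det ≠ 0) (S : Fin 4 × Fin 4 × Fin 4 → K) :
    InSimDiagClosure fun j => blockMat144 (symmTensorMatrix S j * c⁻¹) (fun a => c a j) := by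
  intro Φ hΦ
  let Γ : Fin 4 × (Fin 4 ⊕ (Fin 4 ⊕ Fin 1)) × (Fin 4 ⊕ (Fin 4 ⊕ Fin 1)) →
      MvPolynomial (Fin 4 × Fin 4 × Fin 4) K := fun y =>
    match y.2.1, y.2.2 with
    | Sum.inl a, Sum.inr (Sum.inl b) => ∑ m, (X (a, y.1, m) + X (a, m, y.1)) * C (c⁻¹ m b)
    | Sum.inr (Sum.inl a), Sum.inr (Sum.inr _) => C (c a y.1)
    | _, _ => 0
  have heval : ∀ S, eval S (bind₁ Γ Φ) = eval (fun y =>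
      blockMat144 (symmTensorMatrix S y.1 * c⁻¹) (fun a => c a y.1) y.2.1 y.2.2) Φ := fun S => by
    rw [eval_bind₁]
    congr 2
    funext ⟨j, p, q⟩
    rcases p with a | a | a <;> rcases q with b | b | b <;>
      simp [Γ, blockMat144, symmTensorMatrix, Matrix.mul_apply]
  rw [← heval, eq_zero_of_bind₁_eq_zero (genericTensor K) (basePoint K)
    eq_zero_of_orthogonal_genericTensor (bind₁ Γ Φ), map_zero]
  refine MvPolynomial.funext fun x => ?_
  have hx : ∀ j, symmTensorMatrix (fun s => eval x (genericTensor K s)) j =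
      quadricTensor (Matrix.of fun a b => 2 * x (Sum.inl (a, b)))
        (Matrix.of fun a b => x (Sum.inr (Sum.inl (a, b))))
        (Matrix.of fun a b => x (Sum.inr (Sum.inr (Sum.inl (a, b))))) j := fun j => by
    ext k m
    exact eval_genericTensor_add x k j m
  rw [eval_bind₁, heval, map_zero]
  simp only [hx]
  exact inSimDiagClosure_quadricTensor _ _ _ c hc Φ hΦ

lemma blockMat144_mul_blockMat144_apply (B B' : Matrix (Fin 4) (Fin 4) K) (c c' : Fin 4 → K)
    (k : Fin 4) : (blockMat144 B c * blockMat144 B' c') (Sum.inl k) (Sum.inr (Sum.inr 0)) =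
      ∑ m, B k m * c' m := by
  simp [blockMat144, Matrix.mul_apply]

end Main

/-- **Proposition 5.1, case (1,4,4).** Every local algebra with Hilbert function (1,4,4)
is smoothable, in matrix form. -/
theorem stmt10 {K : Type*} [Field K] [CharZero K] [IsAlgClosed K]
    (B : Fin 4 → Matrix (Fin 4) (Fin 4) K) (c : Fin 4 → (Fin 4 → K))
    (A : Fin 4 → Matrix (Fin 4 ⊕ (Fin 4 ⊕ Fin 1)) (Fin 4 ⊕ (Fin 4 ⊕ Fin 1)) K)
    (hA : A = fun i => blockMat144 (B i) (c i))
    (hc : LinearIndependent K c)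
    (hB : (⨆ i, LinearMap.range (Matrix.mulVecLin (B i))) = ⊤)
    (hcomm : ∀ i j, A i * A j = A j * A i) :
    InSimDiagClosure A := by
  let M : Matrix (Fin 4) (Fin 4) K := (Matrix.of c)ᵀ
  have hM : M.det ≠ 0 := by
    rw [Matrix.det_transpose]
    exact ((Matrix.isUnit_iff_isUnit_det _).1
      (Matrix.linearIndependent_rows_iff_isUnit.1 hc)).ne_zero
  have hBM : ∀ i j k, (B i * M) k j = (B j * M) k i := fun i j k => by
    have := congrFun (congrFun (hcomm i j) (Sum.inl k)) (Sum.inr (Sum.inr 0))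
    rw [hA, blockMat144_mul_blockMat144_apply, blockMat144_mul_blockMat144_apply] at this
    rw [Matrix.mul_apply, Matrix.mul_apply]
    exact this
  have hS : ∀ j, symmTensorMatrix (fun s => (B s.2.1 * M) s.1 s.2.2 / 2) j = B j * M := fun j => by
    ext k m
    rw [symmTensorMatrix, Matrix.of_apply, hBM m j, add_halves]
  have := inSimDiagClosure_symmTensorMatrix M hM fun s => (B s.2.1 * M) s.1 s.2.2 / 2
  simp only [hS, Matrix.mul_assoc, M.mul_nonsing_inv hM.isUnit, mul_one] at this
  rw [hA]
  exact this
end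

section
/- Let K be an algebraically closed field of characteristic 0. Let B_1,…,B_5 be 4×5 matrices over K and c_1,…,c_5 ∈ K^5 such that c_1,…,c_5 are linearly independent and the images of B_1,…,B_5 together span K^4 (the B_i have trivial common cokernel). For i = 1,…,5 let A_i be the 10×10 block matrix, with rows and columns partitioned into blocks of sizes 4, 5, 1, whose only possibly nonzero blocks are the (1,2) block B_i and the (2,3) block c_i. Assume A_1,…,A_5 pairwise commute. Then (A_1,…,A_5) lies in the Zariski closure of the set of simultaneously diagonalizable quintuples of 10×10 matrices: every polynomial over K in the 5·100 matrix entries that vanishes at every simultaneously diagonalizable quintuple of 10×10 matrices also vanishes at (A_1,…,A_5). (This is the matrix form of: every local algebra with Hilbert function (1,5,4) is smoothable.) -/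
open Matrix

/-- The 10×10 block matrix with blocks of sizes 4, 5, 1, whose only nonzero blocks are the
(1,2) block `B` and the (2,3) block `c`. -/
def blockMat154 {K : Type*} [Field K] (B : Matrix (Fin 4) (Fin 5) K) (c : Fin 5 → K) :
    Matrix (Fin 4 ⊕ (Fin 5 ⊕ Fin 1)) (Fin 4 ⊕ (Fin 5 ⊕ Fin 1)) K :=
  Matrix.of fun p q =>
    match p, q with
    | Sum.inl a, Sum.inr (Sum.inl b) => B a b
    | Sum.inr (Sum.inl a), Sum.inr (Sum.inr _) => c a
    | _, _ => 0

open MvPolynomial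

theorem simDiag_of_mul_eq {K N ι : Type*} [Field K] [Fintype ι] [DecidableEq ι]
    {A D : N → Matrix ι ι K} {R : Matrix ι ι K} (hR : IsUnit R) (hD : ∀ i, (D i).IsDiag)
    (h : ∀ i, R * A i = D i * R) : SimDiag A := by
  have hdet := (Matrix.isUnit_iff_isUnit_det R).mp hR
  refine ⟨R⁻¹, Matrix.isUnit_nonsing_inv_iff.mpr hR, fun i => ?_⟩
  rw [Matrix.nonsing_inv_nonsing_inv _ hdet, h, Matrix.mul_assoc, Matrix.mul_nonsing_inv _ hdet,
    Matrix.mul_one]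
  exact hD i

/-- A tuple that is the limit at `t = 0` of a line of simultaneously diagonalizable tuples lies in
the closure. -/
theorem inSimDiagClosure_of_pencil {K N ι : Type*} [Field K] [Infinite K] [Fintype ι]
    [DecidableEq ι] {A E : N → Matrix ι ι K}
    (h : ∀ t : K, t ≠ 0 → SimDiag (fun i => A i + t • E i)) :
    InSimDiagClosure A := by
  intro Φ hΦ
  let P : Polynomial K := aeval (fun x : N × ι × ι =>
    Polynomial.C (A x.1 x.2.1 x.2.2) + Polynomial.X * Polynomial.C (E x.1 x.2.1 x.2.2)) Φ
  have hP : ∀ t, P.eval t = MvPolynomial.eval (fun x => (A x.1 + t • E x.1) x.2.1 x.2.2) Φ := by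
    intro t
    rw [← Polynomial.coe_evalRingHom, ← MvPolynomial.coe_aeval_eq_eval]
    simp only [P, aeval_def, hom_eval₂]
    congr 1
    · ext; simp
    · ext x; simp [mul_comm (E x.1 x.2.1 x.2.2)]
  have h0 : P * Polynomial.X = 0 := Polynomial.funext fun t => by
    by_cases ht : t = 0
    · simp [ht]
    · rw [Polynomial.eval_mul, hP, hΦ _ (h t ht), zero_mul, Polynomial.eval_zero]
  have h1 : P = 0 := (mul_eq_zero.mp h0).resolve_right Polynomial.X_ne_zero
  simpa [h1] using (hP 0).symm

/-- The bilinear form `p b k * p b l - δ k l * p b k`, one for each coordinate `b` of five points in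
four-space, the points being the columns of `p`. -/
def pointForm {R : Type*} [CommRing R] (p : Matrix (Fin 4) (Fin 5) R) (b : Fin 4) (k l : Fin 5) :
    R :=
  p b k * p b l - if k = l then p b k else 0

/-- The web of forms spanned by the `pointForm`s, after the change of basis `G` of the web and the
change of frame `g` of the underlying space. -/
def webForm {R : Type*} [CommRing R] (p : Matrix (Fin 4) (Fin 5) R) (G : Matrix (Fin 4) (Fin 4) R)
    (g : Matrix (Fin 5) (Fin 5) R) (a : Fin 4) (i j : Fin 5) : R :=
  ∑ b, ∑ k, ∑ l, G a b * g i k * g j l * pointForm p b k l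

theorem pointForm_comm {R : Type*} [CommRing R] (p : Matrix (Fin 4) (Fin 5) R) (b : Fin 4)
    (k l : Fin 5) : pointForm p b k l = pointForm p b l k := by
  by_cases h : k = l
  · rw [h]
  · simp [pointForm, h, Ne.symm h, mul_comm]

theorem webForm_comm {R : Type*} [CommRing R] (p : Matrix (Fin 4) (Fin 5) R)
    (G : Matrix (Fin 4) (Fin 4) R) (g : Matrix (Fin 5) (Fin 5) R) (a : Fin 4) (i j : Fin 5) :
    webForm p G g a i j = webForm p G g a j i := by
  refine Finset.sum_congr rfl fun b _ => ?_
  rw [Finset.sum_comm]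
  refine Finset.sum_congr rfl fun k _ => Finset.sum_congr rfl fun l _ => ?_
  rw [pointForm_comm]
  ring

theorem map_webForm {R S : Type*} [CommRing R] [CommRing S] (f : R →+* S)
    (p : Matrix (Fin 4) (Fin 5) R) (G : Matrix (Fin 4) (Fin 4) R)
    (g : Matrix (Fin 5) (Fin 5) R) (a : Fin 4) (i j : Fin 5) :
    f (webForm p G g a i j) = webForm (p.map f) (G.map f) (g.map f) a i j := by
  simp only [webForm, pointForm, map_sum, map_mul, map_sub, Matrix.map_apply, apply_ite f, map_zero]

theorem blockDiag_mul_blockMat154 {K : Type*} [Field K] (G : Matrix (Fin 4) (Fin 4) K)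
    (H : Matrix (Fin 5) (Fin 5) K) (B : Matrix (Fin 4) (Fin 5) K) (c : Fin 5 → K) :
    fromBlocks G 0 0 (fromBlocks H 0 0 1) * blockMat154 B c = blockMat154 (G * B) (H *ᵥ c) := by
  ext (a | a | a) (b | b | b) <;>
    simp [Matrix.mul_apply, Fintype.sum_sum_type, blockMat154, Matrix.mulVec, dotProduct]

theorem blockMat154_mul_blockDiag {K : Type*} [Field K] (G : Matrix (Fin 4) (Fin 4) K)
    (H : Matrix (Fin 5) (Fin 5) K) (B : Matrix (Fin 4) (Fin 5) K) (c : Fin 5 → K) :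
    blockMat154 B c * fromBlocks G 0 0 (fromBlocks H 0 0 1) = blockMat154 (B * H) c := by
  ext (a | a | a) (b | b | b) <;>
    simp [Matrix.mul_apply, Fintype.sum_sum_type, blockMat154, Fin.fin_one_eq_zero]

theorem sum_smul_blockMat154 {K : Type*} [Field K] {ι : Type*} [Fintype ι] (r : ι → K)
    (B : ι → Matrix (Fin 4) (Fin 5) K) (c : ι → Fin 5 → K) :
    ∑ k, r k • blockMat154 (B k) (c k) = blockMat154 (∑ k, r k • B k) (∑ k, r k • c k) := by
  ext (a | a | a) (b | b | b) <;> simp [blockMat154, Matrix.sum_apply, Finset.sum_apply]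

/-- The matrix of evaluations of a basis of functions at ten points: four points for the first block,
five for the second and the origin. -/
def pointEval {K : Type*} [Field K] (p : Matrix (Fin 4) (Fin 5) K) (t : K) :
    Matrix (Fin 4 ⊕ (Fin 5 ⊕ Fin 1)) (Fin 4 ⊕ (Fin 5 ⊕ Fin 1)) K :=
  fromBlocks (t ^ 2 • 1) (fromCols (t • p) (of fun _ _ => 1)) 0
    (fromBlocks (t • 1) (of fun _ _ => 1) 0 1)

/-- The value of the `k`-th coordinate at the ten points underlying `pointEval`. -/
def pointCoord {K : Type*} [Field K] (p : Matrix (Fin 4) (Fin 5) K) (k : Fin 5) :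
    Fin 4 ⊕ (Fin 5 ⊕ Fin 1) → K :=
  Sum.elim (fun a => p a k) (Sum.elim (Pi.single k 1) 0)

/-- The limit as `t` tends to zero of multiplication by the `k`-th coordinate. -/
def firstOrder {K : Type*} [Field K] (p : Matrix (Fin 4) (Fin 5) K) (k : Fin 5) :
    Matrix (Fin 4 ⊕ (Fin 5 ⊕ Fin 1)) (Fin 4 ⊕ (Fin 5 ⊕ Fin 1)) K :=
  blockMat154 (of fun b l => pointForm p b k l) (Pi.single k 1)

theorem isUnit_pointEval {K : Type*} [Field K] (p : Matrix (Fin 4) (Fin 5) K) {t : K} (ht : t ≠ 0) :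
    IsUnit (pointEval p t) := by
  rw [Matrix.isUnit_iff_isUnit_det, isUnit_iff_ne_zero, pointEval, det_fromBlocks_zero₂₁,
    det_fromBlocks_zero₂₁]
  simp [ht]

theorem pointEval_mul {K : Type*} [Field K] (p : Matrix (Fin 4) (Fin 5) K) (t : K) (k : Fin 5) :
    pointEval p t * (firstOrder p k + t • diagonal (pointCoord p k)) =
      (t • diagonal (pointCoord p k)) * pointEval p t := by
  ext (a | a | a) (b | b | b) <;>
    simp [Matrix.mul_apply, Fintype.sum_sum_type, blockMat154, pointEval, firstOrder, pointCoord,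
      Matrix.one_apply, diagonal_apply, pointForm, Pi.single_apply]
  · split_ifs with h
    · rw [h]; ring
    · rfl
  · simp only [eq_comm (a := b)]
    split_ifs with h
    · rw [h]; ring
    · ring
  · by_cases h : a = b <;> simp [h]

theorem webForm_eq_mul {R : Type*} [CommRing R] (p : Matrix (Fin 4) (Fin 5) R)
    (G : Matrix (Fin 4) (Fin 4) R) (g : Matrix (Fin 5) (Fin 5) R) (a : Fin 4) (i j : Fin 5) :
    webForm p G g a i j =
      (G * (∑ k, g i k • of fun b l => pointForm p b k l) * gᵀ) a j := by
  simp only [webForm, Matrix.mul_apply, Matrix.sum_apply, Matrix.smul_apply, Matrix.of_apply,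
    Matrix.transpose_apply, smul_eq_mul, Finset.sum_mul, Finset.mul_sum]
  rw [Finset.sum_congr rfl fun b _ => Finset.sum_comm, Finset.sum_comm]
  exact Finset.sum_congr rfl fun l _ => Finset.sum_congr rfl fun b _ =>
    Finset.sum_congr rfl fun k _ => by ring

/-- Tuples whose web of forms comes from points lie in the closure. -/
theorem inSimDiagClosure_web {K : Type*} [Field K] [Infinite K] (p : Matrix (Fin 4) (Fin 5) K)
    {G : Matrix (Fin 4) (Fin 4) K} {g C : Matrix (Fin 5) (Fin 5) K} (hG : IsUnit G) (hg : IsUnit g)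
    (hC : IsUnit C) :
    InSimDiagClosure fun i =>
      blockMat154 (of fun a j => ∑ k, webForm p G g a i k * C⁻¹ k j) fun j => C j i := by
  have hGd := (Matrix.isUnit_iff_isUnit_det G).mp hG
  have hCd := (Matrix.isUnit_iff_isUnit_det C).mp hC
  have hgt : IsUnit gᵀ := by
    rwa [Matrix.isUnit_iff_isUnit_det, det_transpose, ← Matrix.isUnit_iff_isUnit_det]
  have hgd := (Matrix.isUnit_iff_isUnit_det _).mp hgt
  let S : Matrix (Fin 4 ⊕ (Fin 5 ⊕ Fin 1)) (Fin 4 ⊕ (Fin 5 ⊕ Fin 1)) K :=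
    fromBlocks G 0 0 (fromBlocks (C * (gᵀ)⁻¹) 0 0 1)
  have hS : IsUnit S := by
    rw [Matrix.isUnit_iff_isUnit_det]
    simp only [S, det_fromBlocks_zero₂₁, det_mul, det_one, mul_one]
    exact hGd.mul (hCd.mul ((Matrix.isUnit_iff_isUnit_det _).mp
      (Matrix.isUnit_nonsing_inv_iff.mpr hgt)))
  have hSd := (Matrix.isUnit_iff_isUnit_det S).mp hS
  let D : Fin 5 → Matrix (Fin 4 ⊕ (Fin 5 ⊕ Fin 1)) (Fin 4 ⊕ (Fin 5 ⊕ Fin 1)) K :=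
    fun i => ∑ k, g i k • diagonal (pointCoord p k)
  have hA : ∀ i, blockMat154 (of fun a j => ∑ k, webForm p G g a i k * C⁻¹ k j) (fun j => C j i) =
      S * (∑ k, g i k • firstOrder p k) * S⁻¹ := by
    intro i
    rw [← Matrix.mul_nonsing_inv_cancel_right S (blockMat154 _ _) hSd]
    congr 1
    simp only [firstOrder, sum_smul_blockMat154, S, blockDiag_mul_blockMat154,
      blockMat154_mul_blockDiag]
    congr 1
    · have h1 : (of fun a j => ∑ k, webForm p G g a i k * C⁻¹ k j) =
          G * (∑ k, g i k • of fun b l => pointForm p b k l) * gᵀ * C⁻¹ := by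
        ext a j
        rw [Matrix.mul_apply]
        simp only [Matrix.of_apply, webForm_eq_mul]
      rw [h1, Matrix.mul_assoc, ← Matrix.mul_assoc C⁻¹, Matrix.nonsing_inv_mul _ hCd,
        Matrix.one_mul, Matrix.mul_assoc, Matrix.mul_nonsing_inv _ hgd, Matrix.mul_one]
    · have h1 : ∑ k, g i k • Pi.single k (1 : K) = gᵀ *ᵥ Pi.single i 1 := by
        ext j
        simp [Finset.sum_apply, Pi.single_apply]
      rw [h1, Matrix.mulVec_mulVec, Matrix.mul_assoc, Matrix.nonsing_inv_mul _ hgd,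
        Matrix.mul_one, Matrix.mulVec_single_one]
      rfl
  refine inSimDiagClosure_of_pencil (E := fun i => S * D i * S⁻¹) fun t ht => ?_
  refine simDiag_of_mul_eq (D := fun i => t • D i) (R := pointEval p t * S⁻¹)
    ((isUnit_pointEval p ht).mul (Matrix.isUnit_nonsing_inv_iff.mpr hS)) (fun i => ?_) fun i => ?_
  · intro x y hxy
    simp [D, Matrix.sum_apply, Matrix.diagonal_apply_ne _ hxy]
  · have h1 : pointEval p t * (∑ k, g i k • firstOrder p k + t • D i) = t • D i * pointEval p t := by
      simp only [D, Finset.smul_sum, ← Finset.sum_add_distrib, Finset.mul_sum, Finset.sum_mul]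
      refine Finset.sum_congr rfl fun k _ => ?_
      rw [smul_comm t, ← smul_add, Matrix.mul_smul, pointEval_mul, ← Matrix.smul_mul]
    rw [hA, ← Matrix.smul_mul, ← Matrix.mul_smul, ← Matrix.add_mul, ← Matrix.mul_add,
      Matrix.mul_assoc (pointEval p t), ← Matrix.mul_assoc S⁻¹, ← Matrix.mul_assoc S⁻¹,
      Matrix.nonsing_inv_mul _ hSd, Matrix.one_mul, ← Matrix.mul_assoc, h1, Matrix.mul_assoc]

/-- The derivative of `webForm` at a point where both matrices specialize to the identity. -/
theorem eval_derivation_webForm {K τ : Type*} [Field K]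
    (D : Derivation K (MvPolynomial τ K) (MvPolynomial τ K)) (x : τ → K)
    (P : Matrix (Fin 4) (Fin 5) (MvPolynomial τ K)) (G : Matrix (Fin 4) (Fin 4) (MvPolynomial τ K))
    (g : Matrix (Fin 5) (Fin 5) (MvPolynomial τ K)) (hG : G.map (eval x) = 1)
    (hg : g.map (eval x) = 1) (a : Fin 4) (i j : Fin 5) :
    eval x (D (webForm P G g a i j)) =
      ∑ b, eval x (D (G a b)) * pointForm (P.map (eval x)) b i j +
      ∑ k, eval x (D (g i k)) * pointForm (P.map (eval x)) a k j +
      ∑ k, eval x (D (g j k)) * pointForm (P.map (eval x)) a i k +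
      (P.map (eval x) a i * eval x (D (P a j)) + P.map (eval x) a j * eval x (D (P a i)) -
        if i = j then eval x (D (P a i)) else 0) := by
  have hG' : ∀ a b, eval x (G a b) = (1 : Matrix (Fin 4) (Fin 4) K) a b := fun a b => by
    rw [← hG, Matrix.map_apply]
  have hg' : ∀ a b, eval x (g a b) = (1 : Matrix (Fin 5) (Fin 5) K) a b := fun a b => by
    rw [← hg, Matrix.map_apply]
  have hP : ∀ b k l, eval x (pointForm P b k l) = pointForm (P.map (eval x)) b k l := by
    intro b k l
    simp only [pointForm, map_sub, map_mul, Matrix.map_apply]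
    split_ifs <;> simp
  have hDP : eval x (D (pointForm P a i j)) = P.map (eval x) a i * eval x (D (P a j)) +
      P.map (eval x) a j * eval x (D (P a i)) - if i = j then eval x (D (P a i)) else 0 := by
    simp only [pointForm, map_sub, Derivation.leibniz, map_add, smul_eq_mul, map_mul,
      Matrix.map_apply]
    split_ifs <;> simp
  rw [← hDP]
  simp only [webForm, map_sum, Derivation.leibniz, smul_eq_mul, map_add, map_mul, hG', hg', hP,
    Finset.sum_add_distrib, mul_add, Matrix.one_apply]
  simp [mul_comm]
  ring

/-- The parameters: the alternating part of a web of bilinear forms, the coordinates of five points,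
the mixing matrix and the frame. -/
abbrev WebIndex : Type :=
  (Fin 4 × Fin 5 × Fin 5) ⊕ (Fin 4 × Fin 5) ⊕ (Fin 4 × Fin 4) ⊕ (Fin 5 × Fin 5)

namespace WebIndex

variable {R : Type*}

/-- The matrix of point coordinates among the parameters. -/
def points (y : WebIndex → R) : Matrix (Fin 4) (Fin 5) R := of fun a i => y (.inr (.inl (a, i)))

/-- The change of basis of the web among the parameters. -/
def mixing (y : WebIndex → R) : Matrix (Fin 4) (Fin 4) R :=
  of fun a b => y (.inr (.inr (.inl (a, b))))

/-- The change of frame among the parameters. -/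
def frame (y : WebIndex → R) : Matrix (Fin 5) (Fin 5) R :=
  of fun i j => y (.inr (.inr (.inr (i, j))))

/-- The web of bilinear forms with given parameters. -/
def webMap [CommRing R] (y : WebIndex → R) (s : Fin 4 × Fin 5 × Fin 5) : R :=
  webForm (points y) (mixing y) (frame y) s.1 s.2.1 s.2.2 +
    (y (.inl s) - y (.inl (s.1, s.2.2, s.2.1)))

theorem eval_webMap {K : Type*} [Field K] (y : WebIndex → K) (s : Fin 4 × Fin 5 × Fin 5) :
    eval y (webMap (X : WebIndex → MvPolynomial WebIndex K) s) = webMap y s := by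
  have h1 : (points X).map (eval y) = points y := by ext; simp [points]
  have h2 : (mixing X).map (eval y) = mixing y := by ext; simp [mixing]
  have h3 : (frame X).map (eval y) = frame y := by ext; simp [frame]
  simp [webMap, map_webForm, h1, h2, h3]

/-- Five points at which the parametrization of webs is submersive. -/
def specialPoints (K : Type*) [Field K] : Matrix (Fin 4) (Fin 5) K :=
  !![1, -1, 1, 0, 0; 1, 0, 0, 0, 1; 0, 0, 1, -1, 0; 0, 2, 0, 1, 1]

set_option maxHeartbeats 4000000 in
/-- A web of symmetric matrices orthogonal to all first order deformations of the web attached to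
`specialPoints` vanishes. -/
theorem eq_zero_of_orthogonal {K : Type*} [Field K] [CharZero K] (w : Fin 4 → Fin 5 → Fin 5 → K)
    (hs : ∀ a i j, w a i j = w a j i)
    (hG : ∀ a b, ∑ i, ∑ j, w a i j * pointForm (specialPoints K) b i j = 0)
    (hp : ∀ a i, 2 * ∑ j, w a i j * specialPoints K a j = w a i i)
    (hg : ∀ i k, ∑ a, ∑ j, w a i j * pointForm (specialPoints K) a j k = 0) : w = 0 := by
  simp [funext_iff, Fin.forall_fin_succ, Fin.sum_univ_succ, pointForm, specialPoints]
    at hs hG hp hg ⊢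
  grind (splits := 200)

/-- The parameters given by `specialPoints` and identity matrices. -/
def base (K : Type*) [Field K] : WebIndex → K
  | .inl _ => 0
  | .inr (.inl s) => specialPoints K s.1 s.2
  | .inr (.inr (.inl s)) => (1 : Matrix _ _ K) s.1 s.2
  | .inr (.inr (.inr s)) => (1 : Matrix _ _ K) s.1 s.2

theorem eval_pderiv_webMap {K : Type*} [Field K] (v : WebIndex) (s : Fin 4 × Fin 5 × Fin 5) :
    eval (base K) (pderiv v (webMap X s)) =
      ∑ b, eval (base K) (pderiv v (mixing X s.1 b)) * pointForm (specialPoints K) b s.2.1 s.2.2 +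
      ∑ k, eval (base K) (pderiv v (frame X s.2.1 k)) *
        pointForm (specialPoints K) s.1 k s.2.2 +
      ∑ k, eval (base K) (pderiv v (frame X s.2.2 k)) *
        pointForm (specialPoints K) s.1 s.2.1 k +
      (specialPoints K s.1 s.2.1 * eval (base K) (pderiv v (points X s.1 s.2.2)) +
        specialPoints K s.1 s.2.2 * eval (base K) (pderiv v (points X s.1 s.2.1)) -
        if s.2.1 = s.2.2 then eval (base K) (pderiv v (points X s.1 s.2.1)) else 0) +
      (eval (base K) (pderiv v (X (.inl s))) -
        eval (base K) (pderiv v (X (.inl (s.1, s.2.2, s.2.1))))) := by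
  have hP : (points X).map (eval (base K)) = specialPoints K := by ext; simp [points, base]
  have hM : (mixing X).map (eval (base K)) = 1 := by ext; simp [mixing, base]
  have hF : (frame X).map (eval (base K)) = 1 := by ext; simp [frame, base]
  simp only [webMap, map_add, map_sub, eval_derivation_webForm _ _ _ _ _ hM hF, hP]

/-- The differential of `webMap` at `base` is surjective. -/
theorem webMap_submersive {K : Type*} [Field K] [CharZero K] (w : Fin 4 × Fin 5 × Fin 5 → K)
    (hw : ∀ v : WebIndex, ∑ s, w s * eval (base K) (pderiv v (webMap X s)) = 0) : w = 0 := by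
  have hX : ∀ u v : WebIndex,
      eval (base K) (pderiv v (X u)) = if u = v then 1 else 0 := by
    intro u v
    rw [pderiv_X, Pi.single_apply, apply_ite (eval (base K)), map_one, map_zero]
  simp only [eval_pderiv_webMap, points, mixing, frame, of_apply, hX] at hw
  have hsym : ∀ a i j, w (a, i, j) = w (a, j, i) := by
    intro a i j
    have := hw (.inl (a, i, j))
    simp [Fintype.sum_prod_type, mul_sub, Prod.ext_iff, ite_and] at this
    exact sub_eq_zero.mp this
  have hG : ∀ a b, ∑ i, ∑ j, w (a, i, j) * pointForm (specialPoints K) b i j = 0 := by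
    intro a b
    have := hw (.inr (.inr (.inl (a, b))))
    simp [Fintype.sum_prod_type, Prod.ext_iff, ite_and] at this
    exact this
  have hp : ∀ a i, 2 * ∑ j, w (a, i, j) * specialPoints K a j = w (a, i, i) := by
    intro a i
    have := hw (.inr (.inl (a, i)))
    simp [Fintype.sum_prod_type, Prod.ext_iff, ite_and, mul_sub, mul_add,
      Finset.sum_add_distrib] at this
    rw [← sub_eq_zero, ← this]
    simp only [hsym a _ i]
    ring
  have hg : ∀ i k, ∑ a, ∑ j, w (a, i, j) * pointForm (specialPoints K) a j k = 0 := by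
    intro i k
    have := hw (.inr (.inr (.inr (i, k))))
    simp [Fintype.sum_prod_type, Prod.ext_iff, ite_and, mul_add,
      Finset.sum_add_distrib] at this
    simp only [hsym _ _ i, pointForm_comm _ _ k] at this
    exact add_self_eq_zero.mp this
  have := eq_zero_of_orthogonal (fun a i j => w (a, i, j)) hsym hG hp hg
  funext ⟨a, i, j⟩
  exact congrFun (congrFun (congrFun this a) i) j

end WebIndex

/-- A polynomial with vanishing partial derivatives is constant. -/
theorem eq_C_of_pderiv_eq_zero {R σ : Type*} [CommRing R] [IsDomain R] [CharZero R]
    (f : MvPolynomial σ R) (h : ∀ s, pderiv s f = 0) : f = C (coeff 0 f) := by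
  classical
  ext m
  rw [coeff_C]
  split_ifs with hm
  · rw [hm]
  · obtain ⟨s, hs⟩ := Finsupp.ne_iff.mp (Ne.symm hm)
    have h1 := coeff_pderiv (i := s) f (m - Finsupp.single s 1)
    have h2 : m - Finsupp.single s 1 + Finsupp.single s 1 = m :=
      tsub_add_cancel_of_le (by simpa [Nat.one_le_iff_ne_zero] using hs)
    rw [h, h2, coeff_zero, eq_comm] at h1
    exact (mul_eq_zero.mp h1).resolve_right (Nat.cast_add_one_ne_zero _)

theorem totalDegree_pderiv_le {R σ : Type*} [CommRing R] (f : MvPolynomial σ R) (s : σ) :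
    (pderiv s f).totalDegree ≤ f.totalDegree - 1 := by
  classical
  refine Finset.sup_le fun m hm => ?_
  have h1 : m + Finsupp.single s 1 ∈ f.support := by
    rw [mem_support_iff, coeff_pderiv] at hm
    exact mem_support_iff.mpr (left_ne_zero_of_mul hm)
  have h2 := le_totalDegree h1
  rw [Finsupp.sum_add_index' (by simp) (by simp), Finsupp.sum_single_index rfl] at h2
  omega

/-- If the algebraic relations between the `φ s` are stable under partial derivatives, then the
`φ s` are algebraically independent. -/
theorem eq_zero_of_aeval_eq_zero_of_pderiv {R σ τ : Type*} [CommRing R] [IsDomain R] [CharZero R]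
    (φ : σ → MvPolynomial τ R)
    (H : ∀ f : MvPolynomial σ R, aeval φ f = 0 → ∀ s, aeval φ (pderiv s f) = 0)
    (f : MvPolynomial σ R) (hf : aeval φ f = 0) : f = 0 := by
  induction hn : f.totalDegree using Nat.strong_induction_on generalizing f with
  | _ n ih =>
    have h1 : ∀ s, pderiv s f = 0 := by
      intro s
      by_cases h0 : n = 0
      · rw [h0, totalDegree_eq_zero_iff_eq_C] at hn
        rw [hn, pderiv_C]
      · exact ih _ (by have := totalDegree_pderiv_le f s; omega) _ (H f hf s) rfl
    rw [eq_C_of_pderiv_eq_zero f h1] at hf ⊢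
    simpa using hf

/-- Chain rule for a derivation applied to a polynomial expression. -/
theorem derivation_aeval {R A M σ : Type*} [CommRing R] [CommRing A] [Algebra R A]
    [AddCommGroup M] [Module A M] [Module R M] [IsScalarTower R A M] [Fintype σ]
    (D : Derivation R A M) (φ : σ → A) (f : MvPolynomial σ R) :
    D (aeval φ f) = ∑ s, aeval φ (pderiv s f) • D (φ s) := by
  classical
  induction f using MvPolynomial.induction_on with
  | C r => simp
  | add p q hp hq => simp [hp, hq, add_smul, Finset.sum_add_distrib]
  | mul_X p n hp =>
    simp [Derivation.leibniz, hp, pderiv_X, add_smul, Finset.sum_add_distrib, Pi.single_apply,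
      Finset.smul_sum, mul_smul, apply_ite, ite_smul]

/-- Jacobian criterion: polynomials whose differentials at some point are linearly independent are
algebraically independent. -/
theorem eq_zero_of_aeval_eq_zero_of_jacobian {K σ τ : Type*} [Field K] [CharZero K]
    [Fintype σ] [Fintype τ]
    (φ : σ → MvPolynomial τ K) (x : τ → K)
    (hx : ∀ w : σ → K, (∀ v, ∑ s, w s * eval x (pderiv v (φ s)) = 0) → w = 0)
    (f : MvPolynomial σ K) (hf : aeval φ f = 0) : f = 0 := by
  classical
  refine eq_zero_of_aeval_eq_zero_of_pderiv φ (fun f hf => ?_) f hf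
  let J : Matrix τ σ (MvPolynomial τ K) := Matrix.of fun v s => pderiv v (φ s)
  have hJ : J.mulVec (fun s => aeval φ (pderiv s f)) = 0 := by
    funext v
    have := derivation_aeval (pderiv v) φ f
    rw [hf, map_zero] at this
    simp only [Matrix.mulVec, dotProduct, J, Matrix.of_apply, Pi.zero_apply]
    rw [this]
    exact Finset.sum_congr rfl fun s _ => mul_comm _ _
  have hinj : Function.Injective (J.map (eval x)).mulVec := by
    rw [← Matrix.coe_mulVecLin]
    refine (injective_iff_map_eq_zero _).mpr fun w hw => hx w fun v => ?_
    have := congrFun hw v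
    simpa [Matrix.mulVec, dotProduct, J, mul_comm] using this
  obtain ⟨l, hl⟩ := (J.map (eval x)).mulVecLin.exists_leftInverse_of_injective
    (LinearMap.ker_eq_bot.mpr hinj)
  obtain ⟨L, hL⟩ : ∃ L : Matrix σ τ K, L * J.map (eval x) = 1 := by
    refine ⟨LinearMap.toMatrix' l, ?_⟩
    apply Matrix.toLin'.injective
    rw [Matrix.toLin'_mul, Matrix.toLin'_toMatrix', Matrix.toLin'_one]
    exact hl
  let M : Matrix σ τ (MvPolynomial τ K) := L.map C
  have hM : M.map (eval x) = L := by ext; simp [M]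
  have hdet : (M * J).det ≠ 0 := by
    intro h
    have h1 : eval x (M * J).det = 1 := by
      rw [RingHom.map_det, RingHom.mapMatrix_apply, Matrix.map_mul, hM, hL, Matrix.det_one]
    rw [h, map_zero] at h1
    exact zero_ne_one h1
  have := Matrix.eq_zero_of_mulVec_eq_zero hdet (v := fun s => aeval φ (pderiv s f)) (by
    rw [← Matrix.mulVec_mulVec, hJ, Matrix.mulVec_zero])
  exact congrFun this

theorem eval_aeval {K σ τ : Type*} [Field K] (φ : σ → MvPolynomial τ K) (y : τ → K)
    (f : MvPolynomial σ K) : eval y (aeval φ f) = eval (fun s => eval y (φ s)) f := by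
  rw [← coe_aeval_eq_eval, ← coe_aeval_eq_eval]
  exact comp_aeval_apply φ (aeval y) f

theorem webForm_smul {R : Type*} [CommRing R] (r : R) (p : Matrix (Fin 4) (Fin 5) R)
    (G : Matrix (Fin 4) (Fin 4) R) (g : Matrix (Fin 5) (Fin 5) R) (a : Fin 4) (i j : Fin 5) :
    webForm p (r • G) g a i j = r * webForm p G g a i j := by
  simp only [webForm, Matrix.smul_apply, smul_eq_mul, Finset.mul_sum, mul_assoc]

/-- Every tuple of block matrices whose associated web of forms is symmetric lies in the closure. -/
theorem inSimDiagClosure_of_symm {K : Type*} [Field K] [CharZero K]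
    (q : Fin 4 → Fin 5 → Fin 5 → K) (hq : ∀ a i j, q a i j = q a j i)
    {C : Matrix (Fin 5) (Fin 5) K} (hC : IsUnit C) :
    InSimDiagClosure fun i =>
      blockMat154 (of fun a j => ∑ k, q a i k * C⁻¹ k j) fun j => C j i := by
  intro Φ hΦ
  let e : Fin 5 × (Fin 4 ⊕ (Fin 5 ⊕ Fin 1)) × (Fin 4 ⊕ (Fin 5 ⊕ Fin 1)) →
      MvPolynomial (Fin 4 × Fin 5 × Fin 5) K := fun x =>
    match x with
    | (i, .inl a, .inr (.inl j)) =>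
      ∑ k, (X (a, i, k) + X (a, k, i)) * MvPolynomial.C (C⁻¹ k j)
    | (i, .inr (.inl j), .inr (.inr _)) => MvPolynomial.C (C j i)
    | _ => 0
  have he : ∀ (m : Fin 4 × Fin 5 × Fin 5 → K) x, eval m (e x) =
      blockMat154 (of fun a j => ∑ k, (m (a, x.1, k) + m (a, k, x.1)) * C⁻¹ k j)
        (fun j => C j x.1) x.2.1 x.2.2 := by
    rintro m ⟨i, a | a | a, b | b | b⟩ <;> simp [e, blockMat154]
  have hf : ∀ m : Fin 4 × Fin 5 × Fin 5 → K, eval m (aeval e Φ) =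
      eval (fun x => blockMat154 (of fun a j =>
        ∑ k, (m (a, x.1, k) + m (a, k, x.1)) * C⁻¹ k j) (fun j => C j x.1) x.2.1 x.2.2) Φ := by
    intro m
    rw [eval_aeval, funext (he m)]
  have hweb : aeval (WebIndex.webMap X) (aeval e Φ) *
      ((WebIndex.mixing (X : WebIndex → MvPolynomial WebIndex K)).det *
        (WebIndex.frame (X : WebIndex → MvPolynomial WebIndex K)).det) = 0 := by
    refine MvPolynomial.funext fun y => ?_
    have h1 : (WebIndex.mixing (X : WebIndex → MvPolynomial WebIndex K)).map (eval y) =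
        WebIndex.mixing y := by ext; simp [WebIndex.mixing]
    have h2 : (WebIndex.frame (X : WebIndex → MvPolynomial WebIndex K)).map (eval y) =
        WebIndex.frame y := by ext; simp [WebIndex.frame]
    rw [map_mul, map_mul, RingHom.map_det, RingHom.map_det, RingHom.mapMatrix_apply,
      RingHom.mapMatrix_apply, h1, h2, map_zero]
    by_cases hG : (WebIndex.mixing y).det = 0
    · simp [hG]
    by_cases hg : (WebIndex.frame y).det = 0
    · simp [hg]
    have h3 : eval y (aeval (WebIndex.webMap X) (aeval e Φ)) =
        eval (WebIndex.webMap y) (aeval e Φ) := by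
      rw [eval_aeval, funext (WebIndex.eval_webMap y)]
    have h4 : ∀ a i k, WebIndex.webMap y (a, i, k) + WebIndex.webMap y (a, k, i) =
        webForm (WebIndex.points y) ((2 : K) • WebIndex.mixing y) (WebIndex.frame y) a i k := by
      intro a i k
      rw [webForm_smul, WebIndex.webMap, WebIndex.webMap, webForm_comm _ _ _ a k i]
      ring
    rw [h3, hf]
    simp only [h4]
    have hG' : IsUnit ((2 : K) • WebIndex.mixing y) := by
      rw [Matrix.isUnit_iff_isUnit_det, det_smul, isUnit_iff_ne_zero]
      exact mul_ne_zero (pow_ne_zero _ two_ne_zero) hG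
    have hg' : IsUnit (WebIndex.frame y) :=
      (Matrix.isUnit_iff_isUnit_det _).mpr (isUnit_iff_ne_zero.mpr hg)
    rw [inSimDiagClosure_web (WebIndex.points y) hG' hg' hC Φ hΦ, zero_mul]
  have hdet : (WebIndex.mixing (X : WebIndex → MvPolynomial WebIndex K)).det *
        (WebIndex.frame (X : WebIndex → MvPolynomial WebIndex K)).det ≠ 0 := by
    intro h
    have h1 : (WebIndex.mixing (X : WebIndex → MvPolynomial WebIndex K)).map
        (eval (WebIndex.base K)) = 1 := by ext; simp [WebIndex.mixing, WebIndex.base]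
    have h2 : (WebIndex.frame (X : WebIndex → MvPolynomial WebIndex K)).map
        (eval (WebIndex.base K)) = 1 := by ext; simp [WebIndex.frame, WebIndex.base]
    have h3 := congrArg (eval (WebIndex.base K)) h
    rw [map_mul, RingHom.map_det, RingHom.map_det, RingHom.mapMatrix_apply,
      RingHom.mapMatrix_apply, h1, h2, map_zero, det_one, det_one, mul_one] at h3
    exact one_ne_zero h3
  have h0 : aeval e Φ = 0 :=
    eq_zero_of_aeval_eq_zero_of_jacobian (WebIndex.webMap X) (WebIndex.base K)
      WebIndex.webMap_submersive _ ((mul_eq_zero.mp hweb).resolve_right hdet)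
  have h1 := hf fun s => q s.1 s.2.1 s.2.2 / 2
  rw [h0, map_zero] at h1
  have h2 : ∀ a i k, q a i k / 2 + q a k i / 2 = q a i k := by
    intro a i k
    rw [hq a k i, add_halves]
  simpa only [h2] using h1.symm

/-- **Proposition 5.1, case (1,5,4).** Every local algebra with Hilbert function (1,5,4)
is smoothable, in matrix form. -/
theorem stmt11 {K : Type*} [Field K] [CharZero K] [IsAlgClosed K]
    (B : Fin 5 → Matrix (Fin 4) (Fin 5) K) (c : Fin 5 → (Fin 5 → K))
    (A : Fin 5 → Matrix (Fin 4 ⊕ (Fin 5 ⊕ Fin 1)) (Fin 4 ⊕ (Fin 5 ⊕ Fin 1)) K)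
    (hA : A = fun i => blockMat154 (B i) (c i))
    (hc : LinearIndependent K c)
    (hB : (⨆ i, LinearMap.range (Matrix.mulVecLin (B i))) = ⊤)
    (hcomm : ∀ i j, A i * A j = A j * A i) :
    InSimDiagClosure A := by
  let C : Matrix (Fin 5) (Fin 5) K := of fun j i => c i j
  have hC : IsUnit C := Matrix.linearIndependent_cols_iff_isUnit.mp hc
  have hq : ∀ a i j, (B i * C) a j = (B j * C) a i := by
    intro a i j
    have h := congrFun (congrFun (hcomm i j) (.inl a)) (.inr (.inr 0))
    simpa [hA, blockMat154, Matrix.mul_apply, Fintype.sum_sum_type, C] using h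
  have h := inSimDiagClosure_of_symm (fun a i j => (B i * C) a j) hq hC
  convert h using 1
  rw [hA]
  funext i
  have h1 : B i = of fun a j => ∑ k, (B i * C) a k * C⁻¹ k j := by
    ext a j
    rw [of_apply, ← Matrix.mul_apply,
      Matrix.mul_nonsing_inv_cancel_right _ _ ((Matrix.isUnit_iff_isUnit_det C).mp hC)]
  rw [← h1]
  rfl
end
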